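/- The space of orientation-preserving real-analytic actions of Z^d on the closed interval [0,1] is path-connected. -/

import Mathlib

open Set MeasureTheory Filter Topology

noncomputable section

/-- An orientation-preserving real-analytic diffeomorphism of the interval `[0,1]`. -/
structure AnDiffeo : Type where
  toFun : ℝ → ℝ
  map_zero : toFun 0 = 0
  map_one : toFun 1 = 1
  bijOn : BijOn toFun (Icc (0:ℝ) 1) (Icc (0:ℝ) 1)
  analytic : AnalyticOnNhd ℝ toFun (Icc (0:ℝ) 1)
  deriv_pos : ∀ x ∈ Icc (0:ℝ) 1, 0 < deriv toFun x

/-- A real-analytic action of `ℤᵈ` on `[0,1]`: a `d`-tuple of commuting orientation-preserving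
real-analytic diffeomorphisms of `[0,1]` (the images of the canonical generators). -/
structure AnAction (d : ℕ) where
  gen : Fin d → AnDiffeo
  comm : ∀ i j : Fin d, ∀ x ∈ Icc (0:ℝ) 1,
    (gen i).toFun ((gen j).toFun x) = (gen j).toFun ((gen i).toFun x)

/-- Convergence of a sequence of real-analytic functions on `[0,1]` in the natural topology of
`Cω([0,1])`: there is an open neighborhood of `[0,1]` in `ℂ` to which everything extends
holomorphically, with uniform convergence of the extensions on that neighborhood. -/
def AnTendsto (u : ℕ → ℝ → ℝ) (v : ℝ → ℝ) : Prop :=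
  ∃ U : Set ℂ, IsOpen U ∧ (Complex.ofReal '' Icc (0:ℝ) 1) ⊆ U ∧
    ∃ (F : ℕ → ℂ → ℂ) (G : ℂ → ℂ),
      (∀ n, DifferentiableOn ℂ (F n) U) ∧ DifferentiableOn ℂ G U ∧
      (∀ n, ∀ x ∈ Icc (0:ℝ) 1, F n (Complex.ofReal x) = Complex.ofReal (u n x)) ∧
      (∀ x ∈ Icc (0:ℝ) 1, G (Complex.ofReal x) = Complex.ofReal (v x)) ∧
      TendstoUniformlyOn F G atTop U

/-- A path `γ` of real-analytic actions is continuous if, sequentially in the parameter, all the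
generators converge in the topology of `Cω([0,1])`. -/
def AnPathContinuous {d : ℕ} (γ : ℝ → AnAction d) : Prop :=
  ∀ t₀ ∈ Icc (0:ℝ) 1, ∀ t : ℕ → ℝ, (∀ n, t n ∈ Icc (0:ℝ) 1) →
    Tendsto t atTop (𝓝 t₀) →
    ∀ i : Fin d, AnTendsto (fun n => ((γ (t n)).gen i).toFun) (((γ t₀).gen i).toFun)


/-- local complex extension of a real-analytic function -/
theorem ext_local {g : ℝ → ℝ} {x : ℝ} (hg : AnalyticAt ℝ g x) :
    ∃ F : ℂ → ℂ, AnalyticAt ℂ F (x:ℂ) ∧ ∀ᶠ y : ℝ in 𝓝 x, F (y:ℂ) = ((g y : ℝ) : ℂ) := by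
  obtain ⟨p, r, hp⟩ := hg
  obtain ⟨s, hs0, hsr⟩ := ENNReal.lt_iff_exists_nnreal_btwn.1 hp.r_pos
  have hs0' : (0:ℝ) < s := by exact_mod_cast hs0
  have hsum := p.summable_norm_mul_pow (hsr.trans_le hp.r_le)
  refine ⟨fun z => ∑' n, ((p.coeff n : ℝ) : ℂ) * (z - x) ^ n, ?_, ?_⟩
  · have hd : DifferentiableOn ℂ (fun z : ℂ => ∑' n, ((p.coeff n : ℝ) : ℂ) * (z - x) ^ n)
        (Metric.ball (x:ℂ) s) := by
      apply Complex.differentiableOn_tsum_of_summable_norm hsum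
      · intro n; fun_prop
      · exact Metric.isOpen_ball
      · intro n z hz
        rw [norm_mul, norm_pow, Complex.norm_real]
        have h1 : ‖p.coeff n‖ = ‖p n‖ := by
          simp [FormalMultilinearSeries.norm_apply_eq_norm_coef]
        rw [h1]
        have : ‖z - x‖ ≤ s := by
          rw [Metric.mem_ball, dist_eq_norm] at hz; exact hz.le
        gcongr
    exact hd.analyticAt (Metric.ball_mem_nhds _ hs0')
  · filter_upwards [Metric.ball_mem_nhds x hs0'] with y hy
    have hy' : y ∈ Metric.eball x r := by
      have : edist y x < s := by
        rw [Metric.mem_ball] at hy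
        rw [edist_dist, ENNReal.ofReal_lt_iff_lt_toReal dist_nonneg (by simp)]
        simpa using hy
      exact this.trans hsr
    have h := hp.hasSum_sub hy'
    have h2 : HasSum (fun n => ((p.coeff n : ℝ) : ℂ) * ((y:ℂ) - x) ^ n) ((g y : ℝ):ℂ) := by
      have := Complex.hasSum_ofReal.2 h
      convert this using 2 with n
      simp [FormalMultilinearSeries.apply_eq_pow_smul_coeff]
      ring
    exact h2.tsum_eq

/-- gluing along real centres -/
theorem glue (r : ℝ → ℝ) (F : ℝ → ℂ → ℂ) (u : ℝ → ℝ) (T : Set ℝ) (hT : T ⊆ Icc (0:ℝ) 1)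
    (hd : ∀ p ∈ T, DifferentiableOn ℂ (F p) (Metric.ball (p:ℂ) (r p)))
    (hu : ∀ p ∈ T, ∀ x ∈ Icc (0:ℝ) 1, |x - p| < r p → F p (x:ℂ) = ((u x : ℝ):ℂ)) :
    ∃ G : ℂ → ℂ, ∀ p ∈ T, EqOn G (F p) (Metric.ball (p:ℂ) (r p)) := by
  have key : ∀ p ∈ T, ∀ q ∈ T, p < q → ∀ z, z ∈ Metric.ball (p:ℂ) (r p) →
      z ∈ Metric.ball (q:ℂ) (r q) → F p z = F q z := by
    intro p hp q hq hpq z hzp hzq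
    have hrp : 0 < r p := Metric.pos_of_mem_ball hzp
    have hrq : 0 < r q := Metric.pos_of_mem_ball hzq
    have hlt : q - p < r p + r q := by
      have h1 : dist (p:ℂ) q ≤ dist (p:ℂ) z + dist z q := dist_triangle _ _ _
      rw [Metric.mem_ball] at hzp hzq
      rw [dist_comm (p:ℂ) z] at h1
      have h2 : dist (p:ℂ) q = q - p := by
        rw [Complex.dist_eq, ← Complex.ofReal_sub, Complex.norm_real, Real.norm_eq_abs,
          abs_sub_comm, abs_of_pos (by linarith)]
      linarith
    set a := max p (q - r q)
    set b := min q (p + r p)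
    have hab : a < b := by
      simp only [a, b, max_lt_iff, lt_min_iff]; refine ⟨⟨?_, ?_⟩, ?_, ?_⟩ <;> linarith
    have hO : IsOpen (Metric.ball (p:ℂ) (r p) ∩ Metric.ball (q:ℂ) (r q)) :=
      Metric.isOpen_ball.inter Metric.isOpen_ball
    have hin : ∀ x ∈ Ioo a b, |x - p| < r p ∧ |x - q| < r q ∧ x ∈ Icc (0:ℝ) 1 := by
      intro x hx
      have h1 : p < x := (le_max_left _ _).trans_lt hx.1
      have h2 : q - r q < x := (le_max_right _ _).trans_lt hx.1
      have h3 : x < q := hx.2.trans_le (min_le_left _ _)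
      have h4 : x < p + r p := hx.2.trans_le (min_le_right _ _)
      refine ⟨?_, ?_, ?_, ?_⟩
      · rw [abs_lt]; constructor <;> linarith
      · rw [abs_lt]; constructor <;> linarith
      · linarith [(hT hp).1]
      · linarith [(hT hq).2]
    have hcast : ∀ x p : ℝ, dist (x:ℂ) p = |x - p| := by
      intro x p
      rw [Complex.dist_eq, ← Complex.ofReal_sub, Complex.norm_real, Real.norm_eq_abs]
    set c := (a + b) / 2
    have hc : c ∈ Ioo a b := ⟨by simp only [c]; linarith, by simp only [c]; linarith⟩
    have hA1 : AnalyticOnNhd ℂ (F p) (Metric.ball (p:ℂ) (r p) ∩ Metric.ball (q:ℂ) (r q)) :=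
      ((hd p hp).mono inter_subset_left).analyticOnNhd hO
    have hA2 : AnalyticOnNhd ℂ (F q) (Metric.ball (p:ℂ) (r p) ∩ Metric.ball (q:ℂ) (r q)) :=
      ((hd q hq).mono inter_subset_right).analyticOnNhd hO
    have hpre : IsPreconnected (Metric.ball (p:ℂ) (r p) ∩ Metric.ball (q:ℂ) (r q)) :=
      ((convex_ball _ _).inter (convex_ball _ _)).isPreconnected
    have hcm : (c:ℂ) ∈ Metric.ball (p:ℂ) (r p) ∩ Metric.ball (q:ℂ) (r q) := by
      obtain ⟨h1, h2, -⟩ := hin c hc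
      exact ⟨by rw [Metric.mem_ball, hcast]; exact h1, by rw [Metric.mem_ball, hcast]; exact h2⟩
    refine hA1.eqOn_of_preconnected_of_frequently_eq hA2 hpre hcm ?_ ⟨hzp, hzq⟩
    have hev : ∀ᶠ x : ℝ in 𝓝[≠] c, F p (x:ℂ) = F q (x:ℂ) := by
      filter_upwards [nhdsWithin_le_nhds (Ioo_mem_nhds hc.1 hc.2)] with x hx
      obtain ⟨h1, h2, h3⟩ := hin x hx
      rw [hu p hp x h3 h1, hu q hq x h3 h2]
    have hte : Tendsto (fun x : ℝ => (x:ℂ)) (𝓝[≠] c) (𝓝[≠] (c:ℂ)) := by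
      refine tendsto_nhdsWithin_of_tendsto_nhds_of_eventually_within _ ?_ ?_
      · exact (Complex.continuous_ofReal.tendsto c).mono_left nhdsWithin_le_nhds
      · filter_upwards [self_mem_nhdsWithin] with x hx
        simpa using hx
    exact hte.frequently hev.frequently
  classical
  refine ⟨fun z => if h : ∃ p ∈ T, z ∈ Metric.ball (p:ℂ) (r p) then F h.choose z else 0, ?_⟩
  intro p hp z hz
  have h : ∃ p ∈ T, z ∈ Metric.ball (p:ℂ) (r p) := ⟨p, hp, hz⟩
  simp only [h, dif_pos]
  obtain ⟨h1, h2⟩ := h.choose_spec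
  rcases lt_trichotomy h.choose p with hl | hl | hl
  · exact key _ h1 _ hp hl z h2 hz
  · rw [hl]
  · exact (key _ hp _ h1 hl z hz h2).symm

theorem ofReal_dist (x p : ℝ) : dist (x:ℂ) p = |x - p| := by
  rw [Complex.dist_eq, ← Complex.ofReal_sub, Complex.norm_real, Real.norm_eq_abs]

/-- real trace of a holomorphic function is real-analytic -/
theorem re_analyticAt {F : ℂ → ℂ} {x : ℝ} (hF : AnalyticAt ℂ F (x:ℂ)) :
    AnalyticAt ℝ (fun y : ℝ => (F (y:ℂ)).re) x := by
  have h1 : AnalyticAt ℝ F (x:ℂ) := hF.restrictScalars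
  have h2 : AnalyticAt ℝ (fun y : ℝ => (y:ℂ)) x := Complex.ofRealCLM.analyticAt x
  have h3 : AnalyticAt ℝ (fun y : ℝ => F (y:ℂ)) x := AnalyticAt.fun_comp h1 h2
  exact (Complex.reCLM.analyticAt _).fun_comp h3

/-- a ball version of the local extension -/
theorem ext_ball {g : ℝ → ℝ} {x : ℝ} (hg : AnalyticAt ℝ g x) :
    ∃ r : ℝ, 0 < r ∧ ∃ F : ℂ → ℂ, DifferentiableOn ℂ F (Metric.ball (x:ℂ) r) ∧
      ∀ y : ℝ, |y - x| < r → F (y:ℂ) = ((g y : ℝ) : ℂ) := by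
  obtain ⟨F, hF, hFg⟩ := ext_local hg
  obtain ⟨r1, hr1, h1⟩ := Metric.eventually_nhds_iff_ball.1 hF.eventually_analyticAt
  obtain ⟨r2, hr2, h2⟩ := Metric.eventually_nhds_iff_ball.1 hFg
  refine ⟨min r1 r2, lt_min hr1 hr2, F, ?_, ?_⟩
  · intro z hz
    exact (h1 z (Metric.ball_subset_ball (min_le_left _ _) hz)).differentiableAt.differentiableWithinAt
  · intro y hy
    apply h2
    rw [Metric.mem_ball, Real.dist_eq]
    exact hy.trans_le (min_le_right _ _)

/-- global complex extension -/
theorem ext_global {g : ℝ → ℝ} (hg : AnalyticOnNhd ℝ g (Icc (0:ℝ) 1)) :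
    ∃ U : Set ℂ, IsOpen U ∧ (Complex.ofReal '' Icc (0:ℝ) 1) ⊆ U ∧ ∃ G : ℂ → ℂ,
      DifferentiableOn ℂ G U ∧ ∀ x ∈ Icc (0:ℝ) 1, G (x:ℂ) = ((g x : ℝ):ℂ) := by
  have h : ∀ x : ℝ, ∃ r : ℝ, ∃ F : ℂ → ℂ, x ∈ Icc (0:ℝ) 1 → 0 < r ∧
      DifferentiableOn ℂ F (Metric.ball (x:ℂ) r) ∧
      ∀ y : ℝ, |y - x| < r → F (y:ℂ) = ((g y : ℝ) : ℂ) := by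
    intro x
    by_cases hx : x ∈ Icc (0:ℝ) 1
    · obtain ⟨r, hr, F, hF⟩ := ext_ball (hg x hx)
      exact ⟨r, F, fun _ => ⟨hr, hF⟩⟩
    · exact ⟨0, 0, fun h => absurd h hx⟩
  choose r F hF using h
  obtain ⟨G, hG⟩ := glue r F g (Icc (0:ℝ) 1) Subset.rfl (fun p hp => (hF p hp).2.1)
    (fun p hp x _ hx => (hF p hp).2.2 x hx)
  refine ⟨⋃ p ∈ Icc (0:ℝ) 1, Metric.ball (p:ℂ) (r p), ?_, ?_, G, ?_, ?_⟩
  · exact isOpen_biUnion fun _ _ => Metric.isOpen_ball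
  · rintro _ ⟨x, hx, rfl⟩
    exact mem_biUnion hx (Metric.mem_ball_self (hF x hx).1)
  · intro z hz
    simp only [mem_iUnion] at hz
    obtain ⟨p, hp, hz⟩ := hz
    have h1 : DifferentiableAt ℂ (F p) z :=
      (hF p hp).2.1.differentiableAt (Metric.isOpen_ball.mem_nhds hz)
    have h2 : G =ᶠ[𝓝 z] F p :=
      Filter.eventuallyEq_of_mem (Metric.isOpen_ball.mem_nhds hz) (hG p hp)
    exact (h1.congr_of_eventuallyEq h2).differentiableWithinAt
  · intro x hx
    rw [hG x hx (Metric.mem_ball_self (hF x hx).1)]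
    exact (hF x hx).2.2 x (by simpa using (hF x hx).1)

/-- lower Lipschitz bound from positivity of the real part of the derivative -/
theorem lower_lip {V : Set ℂ} (hV : IsOpen V) (hc : Convex ℝ V) {G : ℂ → ℂ}
    (hG : DifferentiableOn ℂ G V) {c : ℝ} (hre : ∀ z ∈ V, c ≤ (deriv G z).re) {z w : ℂ}
    (hz : z ∈ V) (hw : w ∈ V) : c * ‖z - w‖ ≤ ‖G z - G w‖ := by
  by_cases hzw : z = w
  · simp [hzw]
  have hpos : 0 < ‖z - w‖ := norm_pos_iff.2 (sub_ne_zero.2 hzw)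
  set k : ℝ → ℝ := fun t => ((starRingEnd ℂ) (z - w) * G (w + t * (z - w))).re with hk
  have hmem : ∀ t ∈ Icc (0:ℝ) 1, w + (t:ℂ) * (z - w) ∈ V := by
    intro t ht
    have := hc.add_smul_sub_mem hw hz ht
    simpa using this
  have hder : ∀ t ∈ Icc (0:ℝ) 1, HasDerivAt k
      (((starRingEnd ℂ) (z - w) * (deriv G (w + t * (z - w)) * (z - w))).re) t := by
    intro t ht
    have h1 : HasDerivAt G (deriv G (w + t * (z - w))) (w + t * (z - w)) :=
      (hG.differentiableAt (hV.mem_nhds (hmem t ht))).hasDerivAt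
    have h2 : HasDerivAt (fun s : ℂ => w + s * (z - w)) (z - w) (t:ℂ) := by
      simpa using ((hasDerivAt_id (t:ℂ)).mul_const (z - w)).const_add w
    have h3 : HasDerivAt (fun s : ℂ => (starRingEnd ℂ) (z - w) * G (w + s * (z - w)))
        ((starRingEnd ℂ) (z - w) * (deriv G (w + t * (z - w)) * (z - w))) (t:ℂ) :=
      (HasDerivAt.comp (t:ℂ) h1 h2).const_mul _
    exact h3.real_of_complex
  have hval : ∀ t : ℝ, ((starRingEnd ℂ) (z - w) * (deriv G (w + t * (z - w)) * (z - w))).re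
      = ‖z - w‖ ^ 2 * (deriv G (w + t * (z - w))).re := by
    intro t
    have : (starRingEnd ℂ) (z - w) * (deriv G (w + t * (z - w)) * (z - w))
      = ((‖z - w‖ ^ 2 : ℝ) : ℂ) * deriv G (w + t * (z - w)) := by
      rw [mul_comm (deriv G _) _, ← mul_assoc, Complex.conj_mul']; push_cast; ring
    rw [this, Complex.re_ofReal_mul]
  have hmv := (convex_Icc (0:ℝ) 1).mul_sub_le_image_sub_of_le_deriv
    (f := k) (C := c * ‖z - w‖ ^ 2)
    (fun t ht => (hder t ht).continuousAt.continuousWithinAt)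
    (fun t ht => (hder t (interior_subset ht)).differentiableAt.differentiableWithinAt)
    (fun t ht => by
      rw [(hder t (interior_subset ht)).deriv, hval]
      have := hre _ (hmem t (interior_subset ht))
      nlinarith [sq_nonneg ‖z - w‖])
    0 (by simp) 1 (by simp) (by norm_num)
  have h5 : k 1 - k 0 = ((starRingEnd ℂ) (z - w) * (G z - G w)).re := by
    simp only [hk, ← Complex.sub_re]; congr 1; simp; ring
  have h6 : ((starRingEnd ℂ) (z - w) * (G z - G w)).re ≤ ‖z - w‖ * ‖G z - G w‖ := by
    refine (Complex.re_le_norm _).trans ?_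
    rw [norm_mul, Complex.norm_conj]
  rw [h5] at hmv
  have : c * ‖z - w‖ * ‖z - w‖ ≤ ‖G z - G w‖ * ‖z - w‖ := by nlinarith
  exact le_of_mul_le_mul_right this hpos


/-- the unit interval inside ℂ -/
def KI : Set ℂ := Complex.ofReal '' Icc (0:ℝ) 1

theorem KI_compact : IsCompact KI := isCompact_Icc.image Complex.continuous_ofReal

theorem KI_convex : Convex ℝ KI := (convex_Icc (0:ℝ) 1).linear_image Complex.ofRealCLM.toLinearMap

theorem mem_KI {x : ℝ} (hx : x ∈ Icc (0:ℝ) 1) : (x:ℂ) ∈ KI := ⟨x, hx, rfl⟩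

/-- constructing a diffeomorphism from a pair of inverse analytic maps -/
def mkDiffeo (φ ψ : ℝ → ℝ) (hφ : AnalyticOnNhd ℝ φ (Icc (0:ℝ) 1))
    (hψ : AnalyticOnNhd ℝ ψ (Icc (0:ℝ) 1)) (mφ : MapsTo φ (Icc (0:ℝ) 1) (Icc (0:ℝ) 1))
    (mψ : MapsTo ψ (Icc (0:ℝ) 1) (Icc (0:ℝ) 1)) (mono : MonotoneOn φ (Icc (0:ℝ) 1))
    (h1 : ∀ x ∈ Icc (0:ℝ) 1, ψ (φ x) = x) (h2 : ∀ x ∈ Icc (0:ℝ) 1, φ (ψ x) = x) : AnDiffeo where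
  toFun := φ
  map_zero := by
    have h0 : (0:ℝ) ∈ Icc (0:ℝ) 1 := by simp
    have := mono h0 (mψ h0) (mψ h0).1
    rw [h2 0 h0] at this
    exact le_antisymm this (mφ h0).1
  map_one := by
    have h0 : (1:ℝ) ∈ Icc (0:ℝ) 1 := by simp
    have := mono (mψ h0) h0 (mψ h0).2
    rw [h2 1 h0] at this
    exact le_antisymm (mφ h0).2 this
  bijOn := ⟨mφ, fun x hx y hy h => by rw [← h1 x hx, h, h1 y hy], fun y hy => ⟨ψ y, mψ hy, h2 y hy⟩⟩
  analytic := hφ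
  deriv_pos := by
    intro x hx
    have hu : UniqueDiffWithinAt ℝ (Icc (0:ℝ) 1) x := uniqueDiffOn_Icc (by norm_num) x hx
    have d1 := (hφ x hx).differentiableAt.hasDerivAt
    have d2 := (hψ _ (mφ hx)).differentiableAt.hasDerivAt
    have d3 : HasDerivWithinAt (fun y => y) (deriv ψ (φ x) * deriv φ x) (Icc (0:ℝ) 1) x :=
      ((HasDerivAt.comp x d2 d1).hasDerivWithinAt).congr (fun y hy => (h1 y hy).symm) (h1 x hx).symm
    have d4 : deriv ψ (φ x) * deriv φ x = 1 := hu.eq_deriv _ d3 (hasDerivWithinAt_id x _)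
    have d5 : 0 ≤ deriv φ x := by
      rw [← d1.hasDerivWithinAt.derivWithin hu]
      exact mono.derivWithin_nonneg
    rcases d5.lt_or_eq with h | h
    · exact h
    · rw [← h] at d4; simp at d4

namespace AnDiffeo

theorem mapsTo (g : AnDiffeo) {x : ℝ} (hx : x ∈ Icc (0:ℝ) 1) : g.toFun x ∈ Icc (0:ℝ) 1 :=
  g.bijOn.mapsTo hx

theorem strictMono (g : AnDiffeo) : StrictMonoOn g.toFun (Icc (0:ℝ) 1) := by
  apply strictMonoOn_of_deriv_pos (convex_Icc 0 1)
  · intro x hx; exact (g.analytic x hx).continuousAt.continuousWithinAt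
  · intro x hx; exact g.deriv_pos x (interior_subset hx)

theorem continuousAt (g : AnDiffeo) {x : ℝ} (hx : x ∈ Icc (0:ℝ) 1) : ContinuousAt g.toFun x :=
  (g.analytic x hx).continuousAt

end AnDiffeo

/-- linear deformation to the identity -/
def lin (g : AnDiffeo) (s x : ℝ) : ℝ := (1 - s) * g.toFun x + s * x

theorem lin_mapsTo (g : AnDiffeo) {s : ℝ} (hs : s ∈ Icc (0:ℝ) 1) :
    MapsTo (lin g s) (Icc (0:ℝ) 1) (Icc (0:ℝ) 1) := by
  intro x hx
  have h := g.mapsTo hx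
  simp only [lin, mem_Icc] at *
  constructor <;> nlinarith

theorem lin_strictMono (g : AnDiffeo) {s : ℝ} (hs : s ∈ Icc (0:ℝ) 1) :
    StrictMonoOn (lin g s) (Icc (0:ℝ) 1) := by
  intro x hx y hy hxy
  have h := g.strictMono hx hy hxy
  simp only [lin]
  rcases hs.1.lt_or_eq with h0 | h0
  · nlinarith [hs.2]
  · rw [← h0]; linarith

theorem lin_analytic (g : AnDiffeo) (s : ℝ) : AnalyticOnNhd ℝ (lin g s) (Icc (0:ℝ) 1) := by
  intro x hx
  have := g.analytic x hx
  unfold lin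
  fun_prop

theorem lin_surj (g : AnDiffeo) {s : ℝ} (_hs : s ∈ Icc (0:ℝ) 1) {x : ℝ} (hx : x ∈ Icc (0:ℝ) 1) :
    ∃ y ∈ Icc (0:ℝ) 1, lin g s y = x := by
  have hc : ContinuousOn (lin g s) (Icc (0:ℝ) 1) :=
    fun x hx => (lin_analytic g s x hx).continuousAt.continuousWithinAt
  have := intermediate_value_Icc (zero_le_one) hc
  have h0 : lin g s 0 = 0 := by simp [lin, g.map_zero]
  have h1 : lin g s 1 = 1 := by simp [lin, g.map_one]
  rw [h0, h1] at this
  exact this hx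

theorem deriv_ext_re (g : AnDiffeo) {G : ℂ → ℂ} {x : ℝ} (hx : x ∈ Icc (0:ℝ) 1)
    (hG : DifferentiableAt ℂ G x) (he : ∀ x ∈ Icc (0:ℝ) 1, G (x:ℂ) = ((g.toFun x : ℝ):ℂ)) :
    (deriv G (x:ℂ)).re = deriv g.toFun x := by
  have hu : UniqueDiffWithinAt ℝ (Icc (0:ℝ) 1) x := uniqueDiffOn_Icc (by norm_num) x hx
  have h1 := (hG.hasDerivAt.real_of_complex).hasDerivWithinAt (s := Icc (0:ℝ) 1)
  have h2 := (g.analytic x hx).differentiableAt.hasDerivAt.hasDerivWithinAt (s := Icc (0:ℝ) 1)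
  refine hu.eq_deriv _ (h1.congr (fun y hy => ?_) ?_) h2
  · rw [he y hy]; simp
  · rw [he x hx]; simp

theorem invfam (g : AnDiffeo) : ∃ U : Set ℂ, IsOpen U ∧ KI ⊆ U ∧ ∃ L : ℝ, ∃ Ψ : ℝ → ℂ → ℂ,
    ∀ s ∈ Icc (0:ℝ) 1, DifferentiableOn ℂ (Ψ s) U ∧
      (∀ x ∈ Icc (0:ℝ) 1, ∃ y ∈ Icc (0:ℝ) 1, Ψ s x = y ∧ lin g s y = x) ∧
      ∀ s' ∈ Icc (0:ℝ) 1, ∀ z ∈ U, ‖Ψ s z - Ψ s' z‖ ≤ L * |s - s'| := by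
  obtain ⟨U₀, hU₀, hK₀, G, hG, hGe⟩ := ext_global g.analytic
  have hdc : ContinuousOn (fun z => (deriv G z).re) U₀ :=
    Complex.continuous_re.comp_continuousOn (hG.deriv hU₀).continuousOn
  have hne : KI.Nonempty := ⟨_, mem_KI (x := 0) (by simp)⟩
  obtain ⟨z₀, hz₀, hmin⟩ := KI_compact.exists_isMinOn hne (hdc.mono hK₀)
  have hm : 0 < (deriv G z₀).re := by
    obtain ⟨x, hx, rfl⟩ := hz₀
    rw [deriv_ext_re g hx (hG.differentiableAt (hU₀.mem_nhds (hK₀ (mem_KI hx)))) hGe]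
    exact g.deriv_pos x hx
  set c := min ((deriv G z₀).re / 2) 1 with hc
  have hc0 : 0 < c := lt_min (by linarith) one_pos
  have hc1 : c ≤ 1 := min_le_right _ _
  have hW : IsOpen (U₀ ∩ {z | c < (deriv G z).re}) :=
    hdc.isOpen_inter_preimage hU₀ isOpen_Ioi
  have hKW : KI ⊆ U₀ ∩ {z | c < (deriv G z).re} := by
    intro z hz
    refine ⟨hK₀ hz, ?_⟩
    have h1 : (deriv G z₀).re ≤ (deriv G z).re := hmin hz
    have h2 : c ≤ (deriv G z₀).re / 2 := min_le_left _ _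
    simp only [mem_setOf_eq]; linarith
  obtain ⟨δ, hδ, hsub⟩ := KI_compact.exists_cthickening_subset_open hW hKW
  set V := Metric.thickening δ KI with hV
  have hVo : IsOpen V := Metric.isOpen_thickening
  have hVc : Convex ℝ V := KI_convex.thickening δ
  have hVs : V ⊆ U₀ ∩ {z | c < (deriv G z).re} := (Metric.thickening_subset_cthickening _ _).trans hsub
  have hGV : DifferentiableOn ℂ G V := hG.mono (hVs.trans inter_subset_left)
  obtain ⟨M, hM⟩ := (KI_compact.cthickening (r := δ)).exists_bound_of_continuousOn
    (f := fun z => G z - z)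
    ((hG.continuousOn.mono (hsub.trans inter_subset_left)).sub continuousOn_id)
  set H : ℝ → ℂ → ℂ := fun s z => (1 - s) * G z + s * z with hH
  have hHd : ∀ s, DifferentiableOn ℂ (H s) V := by
    intro s
    exact (hGV.const_mul _).add (differentiableOn_id.const_mul _)
  have hHder : ∀ s ∈ Icc (0:ℝ) 1, ∀ z ∈ V, c ≤ (deriv (H s) z).re := by
    intro s hs z hz
    have h1 := (hGV.differentiableAt (hVo.mem_nhds hz)).hasDerivAt
    have h2 : HasDerivAt (H s) ((1 - s) * deriv G z + s * 1) z :=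
      (h1.const_mul _).add ((hasDerivAt_id z).const_mul _)
    rw [h2.deriv]
    have h3 : c < (deriv G z).re := (hVs hz).2
    have h4 : (((1:ℂ) - s) * deriv G z + s * 1).re = (1 - s) * (deriv G z).re + s := by
      simp
    rw [h4]
    nlinarith [hs.1, hs.2]
  have hlow : ∀ s ∈ Icc (0:ℝ) 1, ∀ z ∈ V, ∀ w ∈ V, c * ‖z - w‖ ≤ ‖H s z - H s w‖ :=
    fun s hs z hz w hw => lower_lip hVo hVc (hHd s) (hHder s hs) hz hw
  have hHe : ∀ s, ∀ x ∈ Icc (0:ℝ) 1, H s (x:ℂ) = ((lin g s x : ℝ):ℂ) := by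
    intro s x hx; simp [hH, lin, hGe x hx]
  have hKV : KI ⊆ V := Metric.self_subset_thickening hδ _
  have hsurj : ∀ s ∈ Icc (0:ℝ) 1, ∀ w ∈ Metric.thickening (c * (δ/2) / 2) KI, ∃ z ∈ V, H s z = w := by
    intro s hs w hw
    obtain ⟨k, hk, hwk⟩ := Metric.mem_thickening_iff.1 hw
    obtain ⟨x, hx, rfl⟩ := hk
    obtain ⟨y, hy, hyx⟩ := lin_surj g hs hx
    have hcb : Metric.closedBall (y:ℂ) (δ/2) ⊆ V := by
      intro z hz
      refine Metric.mem_thickening_iff.2 ⟨y, mem_KI hy, ?_⟩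
      rw [Metric.mem_closedBall] at hz; linarith
    have hdc : DiffContOnCl ℂ (H s) (Metric.ball (y:ℂ) (δ/2)) := by
      apply DifferentiableOn.diffContOnCl
      rw [closure_ball _ (by positivity)]
      exact (hHd s).mono hcb
    have := hdc.ball_subset_image_closedBall (ε := c * (δ/2)) (by positivity) ?_ ?_
    · rw [hHe s y hy, hyx] at this
      obtain ⟨z, hz, hzw⟩ := this (Metric.mem_ball.2 hwk)
      exact ⟨z, hcb hz, hzw⟩
    · intro z hz
      have hz' : ‖z - y‖ = δ/2 := by rw [← dist_eq_norm]; exact hz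
      rw [← hz']
      exact hlow s hs z (hcb (Metric.sphere_subset_closedBall hz)) y (hKV (mem_KI hy))
    · have hev : ∀ᶠ z in 𝓝[≠] (y:ℂ), H s z ≠ H s y := by
        filter_upwards [nhdsWithin_le_nhds (hVo.mem_nhds (hKV (mem_KI hy))), self_mem_nhdsWithin]
          with z hz hne h
        have := hlow s hs z hz y (hKV (mem_KI hy))
        rw [h, sub_self, norm_zero] at this
        have h3 : 0 < ‖z - y‖ := norm_pos_iff.2 (sub_ne_zero.2 hne)
        nlinarith
      exact hev.frequently.filter_mono nhdsWithin_le_nhds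
  have hex : ∀ s : ℝ, ∀ w : ℂ, ∃ z, s ∈ Icc (0:ℝ) 1 → w ∈ Metric.thickening (c * (δ/2) / 2) KI →
      z ∈ V ∧ H s z = w := by
    intro s w
    by_cases h : s ∈ Icc (0:ℝ) 1 ∧ w ∈ Metric.thickening (c * (δ/2) / 2) KI
    · obtain ⟨z, hz⟩ := hsurj s h.1 w h.2
      exact ⟨z, fun _ _ => hz⟩
    · exact ⟨0, fun h1 h2 => absurd ⟨h1, h2⟩ h⟩
  choose Ψ hΨ using hex
  have hδ' : 0 < c * (δ/2) / 2 := by positivity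
  refine ⟨Metric.thickening (c * (δ/2) / 2) KI, Metric.isOpen_thickening,
    Metric.self_subset_thickening hδ' _, M / c, Ψ, ?_⟩
  intro s hs
  refine ⟨?_, ?_, ?_⟩
  · intro w hw
    obtain ⟨hzV, hzw⟩ := hΨ s w hs hw
    have hnb : ∀ᶠ y in 𝓝 w, y ∈ Metric.thickening (c * (δ/2) / 2) KI :=
      Metric.isOpen_thickening.mem_nhds hw
    have hcont : ContinuousAt (Ψ s) w := by
      rw [ContinuousAt, tendsto_iff_dist_tendsto_zero]
      refine squeeze_zero' (Eventually.of_forall fun _ => dist_nonneg)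
        (g := fun y => dist y w / c) ?_ ?_
      · filter_upwards [hnb] with y hy
        obtain ⟨h1, h2⟩ := hΨ s y hs hy
        have := hlow s hs _ h1 _ hzV
        rw [h2, hzw] at this
        rw [dist_eq_norm, dist_eq_norm, le_div_iff₀ hc0]; linarith
      · have : Tendsto (fun y => dist y w / c) (𝓝 w) (𝓝 (dist w w / c)) :=
          ((continuous_id.dist continuous_const).div_const c).tendsto w
        simpa using this
    have hder := ((hHd s).differentiableAt (hVo.mem_nhds hzV)).hasDerivAt
    have hne : deriv (H s) (Ψ s w) ≠ 0 := by
      intro h0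
      have := hHder s hs _ hzV
      rw [h0] at this; simp at this; linarith
    exact (HasDerivAt.of_local_left_inverse hcont hder hne
      (hnb.mono fun y hy => (hΨ s y hs hy).2)).differentiableAt.differentiableWithinAt
  · intro x hx
    obtain ⟨y, hy, hyx⟩ := lin_surj g hs hx
    refine ⟨y, hy, ?_, hyx⟩
    obtain ⟨h1, h2⟩ := hΨ s x hs (Metric.self_subset_thickening hδ' _ (mem_KI hx))
    have := hlow s hs _ h1 y (hKV (mem_KI hy))
    rw [h2, hHe s y hy, hyx, sub_self, norm_zero] at this
    have h3 : ‖Ψ s x - y‖ ≤ 0 := by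
      by_contra hcon; push Not at hcon; nlinarith
    exact sub_eq_zero.1 (norm_le_zero_iff.1 h3)
  · intro s' hs' z hz
    obtain ⟨h1, h2⟩ := hΨ s z hs hz
    obtain ⟨h3, h4⟩ := hΨ s' z hs' hz
    have := hlow s hs _ h1 _ h3
    rw [h2, ← h4] at this
    have h5 : ‖H s' (Ψ s' z) - H s (Ψ s' z)‖ ≤ |s - s'| * M := by
      have : H s' (Ψ s' z) - H s (Ψ s' z) = ((s - s' : ℝ) : ℂ) * (G (Ψ s' z) - Ψ s' z) := by
        simp only [hH]; push_cast; ring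
      rw [this, norm_mul, Complex.norm_real, Real.norm_eq_abs]
      have := hM (Ψ s' z) (Metric.thickening_subset_cthickening _ _ h3)
      gcongr
    rw [h4] at this h5
    rw [div_mul_eq_mul_div, le_div_iff₀ hc0]
    linarith

/-- the deformed diffeomorphisms together with their inverses -/
theorem lin_diffeo (g : AnDiffeo) : ∃ A B : ℝ → AnDiffeo,
    (∀ s ∈ Icc (0:ℝ) 1, ∀ x ∈ Icc (0:ℝ) 1, (A s).toFun x = lin g s x ∧
      (A s).toFun ((B s).toFun x) = x ∧ (B s).toFun ((A s).toFun x) = x) ∧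
    ∃ U : Set ℂ, IsOpen U ∧ KI ⊆ U ∧ ∃ L : ℝ, ∃ Φ Ψ : ℝ → ℂ → ℂ, ∀ s ∈ Icc (0:ℝ) 1,
      DifferentiableOn ℂ (Φ s) U ∧ DifferentiableOn ℂ (Ψ s) U ∧
      (∀ x ∈ Icc (0:ℝ) 1, Φ s x = (A s).toFun x ∧ Ψ s x = (B s).toFun x) ∧
      ∀ s' ∈ Icc (0:ℝ) 1, ∀ z ∈ U, ‖Φ s z - Φ s' z‖ ≤ L * |s - s'| ∧
        ‖Ψ s z - Ψ s' z‖ ≤ L * |s - s'| := by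
  obtain ⟨U, hU, hKU, L, Ψ, hΨ⟩ := invfam g
  obtain ⟨U₀, hU₀, hK₀, G, hG, hGe⟩ := ext_global g.analytic
  obtain ⟨δ, hδ, hsub⟩ := KI_compact.exists_cthickening_subset_open hU₀ hK₀
  obtain ⟨M, hM⟩ := (KI_compact.cthickening (r := δ)).exists_bound_of_continuousOn
    (f := fun z => G z - z) ((hG.continuousOn.mono hsub).sub continuousOn_id)
  set φ : ℝ → ℝ → ℝ := fun s x => (Ψ s x).re
  have hφ : ∀ s ∈ Icc (0:ℝ) 1, ∀ x ∈ Icc (0:ℝ) 1, Ψ s x = φ s x ∧ φ s x ∈ Icc (0:ℝ) 1 ∧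
      lin g s (φ s x) = x := by
    intro s hs x hx
    obtain ⟨y, hy, h1, h2⟩ := (hΨ s hs).2.1 x hx
    have : φ s x = y := by simp [φ, h1]
    rw [this]; exact ⟨h1, hy, h2⟩
  have hφ2 : ∀ s ∈ Icc (0:ℝ) 1, ∀ x ∈ Icc (0:ℝ) 1, φ s (lin g s x) = x := by
    intro s hs x hx
    have h := hφ s hs _ (lin_mapsTo g hs hx)
    exact (lin_strictMono g hs).injOn h.2.1 hx h.2.2
  have hφm : ∀ s ∈ Icc (0:ℝ) 1, MonotoneOn (φ s) (Icc (0:ℝ) 1) := by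
    intro s hs x hx y hy hxy
    by_contra hcon
    push Not at hcon
    have := lin_strictMono g hs (hφ s hs y hy).2.1 (hφ s hs x hx).2.1 hcon
    rw [(hφ s hs y hy).2.2, (hφ s hs x hx).2.2] at this
    linarith
  have hφa : ∀ s ∈ Icc (0:ℝ) 1, AnalyticOnNhd ℝ (φ s) (Icc (0:ℝ) 1) := by
    intro s hs x hx
    exact re_analyticAt ((hΨ s hs).1.analyticAt (hU.mem_nhds (hKU (mem_KI hx))))
  classical
  set A : ℝ → AnDiffeo := fun s => if hs : s ∈ Icc (0:ℝ) 1 then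
    mkDiffeo (lin g s) (φ s) (lin_analytic g s) (hφa s hs) (lin_mapsTo g hs)
      (fun x hx => (hφ s hs x hx).2.1) (lin_strictMono g hs).monotoneOn (hφ2 s hs)
      (fun x hx => (hφ s hs x hx).2.2) else g with hA
  set B : ℝ → AnDiffeo := fun s => if hs : s ∈ Icc (0:ℝ) 1 then
    mkDiffeo (φ s) (lin g s) (hφa s hs) (lin_analytic g s)
      (fun x hx => (hφ s hs x hx).2.1) (lin_mapsTo g hs) (hφm s hs)
      (fun x hx => (hφ s hs x hx).2.2) (hφ2 s hs) else g with hB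
  have hAf : ∀ s ∈ Icc (0:ℝ) 1, (A s).toFun = lin g s := by
    intro s hs; simp only [hA, hs, dif_pos]; rfl
  have hBf : ∀ s ∈ Icc (0:ℝ) 1, (B s).toFun = φ s := by
    intro s hs; simp only [hB, hs, dif_pos]; rfl
  refine ⟨A, B, ?_, U ∩ Metric.thickening δ KI, hU.inter Metric.isOpen_thickening,
    subset_inter hKU (Metric.self_subset_thickening hδ _), max L M,
    fun s z => (1 - s) * G z + s * z, Ψ, ?_⟩
  · intro s hs x hx
    rw [hAf s hs, hBf s hs]
    exact ⟨rfl, (hφ s hs x hx).2.2, hφ2 s hs x hx⟩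
  · intro s hs
    refine ⟨?_, (hΨ s hs).1.mono inter_subset_left, ?_, ?_⟩
    · have : DifferentiableOn ℂ G (U ∩ Metric.thickening δ KI) :=
        hG.mono (inter_subset_right.trans ((Metric.thickening_subset_cthickening _ _).trans hsub))
      exact (this.const_mul _).add (differentiableOn_id.const_mul _)
    · intro x hx
      rw [hAf s hs, hBf s hs]
      exact ⟨by simp [lin, hGe x hx], (hφ s hs x hx).1⟩
    · intro s' hs' z hz
      refine ⟨?_, ((hΨ s hs).2.2 s' hs' z hz.1).trans ?_⟩
      · have : ((1 - s) * G z + s * z) - ((1 - s') * G z + s' * z)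
            = -(((s - s' : ℝ) : ℂ) * (G z - z)) := by
          push_cast; ring
        rw [this, norm_neg, norm_mul, Complex.norm_real, Real.norm_eq_abs, mul_comm]
        have h1 := hM z (Metric.thickening_subset_cthickening _ _ hz.2)
        have h2 := h1.trans (le_max_right L M)
        gcongr
      · gcongr; exact le_max_left _ _

/-- the identity -/
def AnDiffeo.one : AnDiffeo :=
  mkDiffeo id id (fun _ _ => analyticAt_id) (fun _ _ => analyticAt_id) (fun _ h => h) (fun _ h => h)
    (fun _ _ _ _ h => h) (fun _ _ => rfl) (fun _ _ => rfl)

theorem exists_inv (g : AnDiffeo) : ∃ h : AnDiffeo, ∀ x ∈ Icc (0:ℝ) 1,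
    g.toFun (h.toFun x) = x ∧ h.toFun (g.toFun x) = x := by
  obtain ⟨A, B, h, -⟩ := lin_diffeo g
  refine ⟨B 0, fun x hx => ?_⟩
  have h0 : (0:ℝ) ∈ Icc (0:ℝ) 1 := by simp
  have hA : ∀ x ∈ Icc (0:ℝ) 1, (A 0).toFun x = g.toFun x := by
    intro x hx; rw [(h 0 h0 x hx).1]; simp [lin]
  obtain ⟨-, h2, h3⟩ := h 0 h0 x hx
  rw [hA _ ((B 0).mapsTo hx)] at h2
  rw [hA _ hx] at h3
  exact ⟨h2, h3⟩

/-- inverse -/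
def AnDiffeo.inv (g : AnDiffeo) : AnDiffeo := (exists_inv g).choose

theorem AnDiffeo.mul_inv (g : AnDiffeo) {x : ℝ} (hx : x ∈ Icc (0:ℝ) 1) :
    g.toFun (g.inv.toFun x) = x := ((exists_inv g).choose_spec x hx).1

theorem AnDiffeo.inv_mul (g : AnDiffeo) {x : ℝ} (hx : x ∈ Icc (0:ℝ) 1) :
    g.inv.toFun (g.toFun x) = x := ((exists_inv g).choose_spec x hx).2

/-- composition -/
def AnDiffeo.mul (g h : AnDiffeo) : AnDiffeo :=
  mkDiffeo (fun x => g.toFun (h.toFun x)) (fun x => h.inv.toFun (g.inv.toFun x))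
    (fun x hx => (g.analytic _ (h.mapsTo hx)).fun_comp (h.analytic x hx))
    (fun x hx => (h.inv.analytic _ (g.inv.mapsTo hx)).fun_comp (g.inv.analytic x hx))
    (fun _ hx => g.mapsTo (h.mapsTo hx)) (fun _ hx => h.inv.mapsTo (g.inv.mapsTo hx))
    (fun _ hx _ hy hxy => g.strictMono.monotoneOn (h.mapsTo hx) (h.mapsTo hy)
      (h.strictMono.monotoneOn hx hy hxy))
    (fun x hx => by rw [g.inv_mul (h.mapsTo hx), h.inv_mul hx])
    (fun x hx => by rw [h.mul_inv (g.inv.mapsTo hx), g.mul_inv hx])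

theorem AnDiffeo.mul_toFun (g h : AnDiffeo) (x : ℝ) :
    (g.mul h).toFun x = g.toFun (h.toFun x) := rfl

/-- iterates -/
def AnDiffeo.pow (g : AnDiffeo) : ℕ → AnDiffeo
  | 0 => AnDiffeo.one
  | n + 1 => g.mul (g.pow n)

theorem AnDiffeo.pow_toFun (g : AnDiffeo) (n : ℕ) (x : ℝ) :
    (g.pow n).toFun x = g.toFun^[n] x := by
  induction n with
  | zero => rfl
  | succ n ih => rw [Function.iterate_succ_apply', ← ih]; rfl


/-- a family of functions on `[0,1]` depending continuously on `s ∈ [0,1]`, with complex extension -/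
def Fam (φ : ℝ → ℝ → ℝ) : Prop :=
  ∃ U : Set ℂ, IsOpen U ∧ KI ⊆ U ∧ ∃ Φ : ℝ → ℂ → ℂ,
    (∀ s ∈ Icc (0:ℝ) 1, DifferentiableOn ℂ (Φ s) U) ∧
    (∀ s ∈ Icc (0:ℝ) 1, ∀ x ∈ Icc (0:ℝ) 1, Φ s (x:ℂ) = ((φ s x : ℝ):ℂ)) ∧
    ContinuousOn (fun p : ℝ × ℂ => Φ p.1 p.2) (Icc (0:ℝ) 1 ×ˢ U)

theorem Fam.congr {φ ψ : ℝ → ℝ → ℝ} (h : Fam φ)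
    (he : ∀ s ∈ Icc (0:ℝ) 1, ∀ x ∈ Icc (0:ℝ) 1, φ s x = ψ s x) : Fam ψ := by
  obtain ⟨U, hU, hK, Φ, h1, h2, h3⟩ := h
  exact ⟨U, hU, hK, Φ, h1, fun s hs x hx => by rw [h2 s hs x hx, he s hs x hx], h3⟩

theorem Fam.tendsto {φ : ℝ → ℝ → ℝ} (h : Fam φ) {t₀ : ℝ} (ht₀ : t₀ ∈ Icc (0:ℝ) 1) {t : ℕ → ℝ}
    (ht : ∀ n, t n ∈ Icc (0:ℝ) 1) (hlim : Tendsto t atTop (𝓝 t₀)) :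
    AnTendsto (fun n => φ (t n)) (φ t₀) := by
  obtain ⟨U, hU, hK, Φ, h1, h2, h3⟩ := h
  obtain ⟨δ, hδ, hsub⟩ := KI_compact.exists_cthickening_subset_open hU hK
  have hcomp : IsCompact (Icc (0:ℝ) 1 ×ˢ Metric.cthickening δ KI) :=
    isCompact_Icc.prod (KI_compact.cthickening (r := δ))
  have huc := hcomp.uniformContinuousOn_of_continuous (h3.mono (prod_mono_right hsub))
  have hV : Metric.thickening δ KI ⊆ Metric.cthickening δ KI := Metric.thickening_subset_cthickening _ _
  refine ⟨Metric.thickening δ KI, Metric.isOpen_thickening, Metric.self_subset_thickening hδ _,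
    fun n => Φ (t n), Φ t₀, fun n => (h1 _ (ht n)).mono (hV.trans hsub),
    (h1 _ ht₀).mono (hV.trans hsub), fun n x hx => h2 _ (ht n) x hx, fun x hx => h2 _ ht₀ x hx, ?_⟩
  rw [Metric.tendstoUniformlyOn_iff]
  intro ε hε
  obtain ⟨η, hη, hh⟩ := Metric.uniformContinuousOn_iff.1 huc ε hε
  filter_upwards [Metric.tendsto_nhds.1 hlim η hη] with n hn z hz
  refine hh (t₀, z) ⟨ht₀, hV hz⟩ (t n, z) ⟨ht n, hV hz⟩ ?_
  rw [Prod.dist_eq]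
  simp only [dist_self]
  rw [dist_comm]
  exact max_lt hn hη

theorem Fam.of_lip {φ : ℝ → ℝ → ℝ} {U : Set ℂ} (hU : IsOpen U) (hK : KI ⊆ U) (L : ℝ)
    (Φ : ℝ → ℂ → ℂ) (h1 : ∀ s ∈ Icc (0:ℝ) 1, DifferentiableOn ℂ (Φ s) U)
    (h2 : ∀ s ∈ Icc (0:ℝ) 1, ∀ x ∈ Icc (0:ℝ) 1, Φ s (x:ℂ) = ((φ s x : ℝ):ℂ))
    (h3 : ∀ s ∈ Icc (0:ℝ) 1, ∀ s' ∈ Icc (0:ℝ) 1, ∀ z ∈ U, ‖Φ s z - Φ s' z‖ ≤ L * |s - s'|) :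
    Fam φ := by
  refine ⟨U, hU, hK, Φ, h1, h2, ?_⟩
  apply continuousOn_prod_of_continuousOn_lipschitzOnWith _ (Real.toNNReal L)
  · intro a ha
    exact (h1 a ha).continuousOn
  · intro b hb
    apply LipschitzOnWith.of_dist_le_mul
    intro x hx y hy
    rw [dist_eq_norm, Real.dist_eq]
    refine (h3 x hx y hy b hb).trans ?_
    gcongr
    exact Real.le_coe_toNNReal L

theorem Fam.comp {φ ψ : ℝ → ℝ → ℝ} (hφ : Fam φ) (hψ : Fam ψ)
    (hm : ∀ s ∈ Icc (0:ℝ) 1, ∀ x ∈ Icc (0:ℝ) 1, ψ s x ∈ Icc (0:ℝ) 1) :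
    Fam (fun s x => φ s (ψ s x)) := by
  obtain ⟨U, hU, hK, Φ, h1, h2, h3⟩ := hφ
  obtain ⟨V, hV, hKV, Ψ, k1, k2, k3⟩ := hψ
  have key : ∃ W : Set ℂ, IsOpen W ∧ KI ⊆ W ∧ W ⊆ V ∧ ∀ s ∈ Icc (0:ℝ) 1, ∀ z ∈ W, Ψ s z ∈ U := by
    obtain ⟨O, hO, hOeq⟩ := (continuousOn_iff'.1 k3) U hU
    have hsub : Icc (0:ℝ) 1 ×ˢ KI ⊆ O := by
      rintro ⟨s, z⟩ ⟨hs, x, hx, rfl⟩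
      have hs : s ∈ Icc (0:ℝ) 1 := hs
      have : ((s, (x:ℂ)) : ℝ × ℂ) ∈ (fun p : ℝ × ℂ => Ψ p.1 p.2) ⁻¹' U ∩ (Icc (0:ℝ) 1 ×ˢ V) := by
        refine ⟨?_, hs, hKV (mem_KI hx)⟩
        simp only [mem_preimage]
        rw [k2 s hs x hx]
        exact hK (mem_KI (hm s hs x hx))
      rw [hOeq] at this
      exact this.1
    obtain ⟨A, B, hA, hB, hsA, hKB, hAB⟩ := generalized_tube_lemma isCompact_Icc KI_compact hO hsub
    refine ⟨B ∩ V, hB.inter hV, subset_inter hKB hKV, inter_subset_right, ?_⟩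
    intro s hs z hz
    have : ((s, z) : ℝ × ℂ) ∈ O ∩ (Icc (0:ℝ) 1 ×ˢ V) := ⟨hAB ⟨hsA hs, hz.1⟩, hs, hz.2⟩
    rw [← hOeq] at this
    exact this.1
  obtain ⟨W, hW, hKW, hWV, hWU⟩ := key
  refine ⟨W, hW, hKW, fun s z => Φ s (Ψ s z), ?_, ?_, ?_⟩
  · intro s hs
    exact (h1 s hs).comp ((k1 s hs).mono hWV) (fun z hz => hWU s hs z hz)
  · intro s hs x hx
    simp only
    rw [k2 s hs x hx, h2 s hs _ (hm s hs x hx)]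
  · have : ContinuousOn (fun p : ℝ × ℂ => ((p.1, Ψ p.1 p.2) : ℝ × ℂ)) (Icc (0:ℝ) 1 ×ˢ W) :=
      continuousOn_fst.prodMk (k3.mono (prod_mono_right hWV))
    exact h3.comp this (fun p hp => ⟨hp.1, hWU _ hp.1 _ hp.2⟩)

theorem Fam.id : Fam (fun _ x => x) :=
  ⟨univ, isOpen_univ, subset_univ _, fun _ z => z, fun _ _ => differentiableOn_id,
    fun _ _ _ _ => rfl, continuousOn_snd⟩

theorem Fam.pow {g : ℝ → AnDiffeo} (h : Fam (fun s => (g s).toFun)) (n : ℕ) :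
    Fam (fun s => ((g s).pow n).toFun) := by
  induction n with
  | zero => exact Fam.id
  | succ n ih => exact h.comp ih (fun s _ x hx => ((g s).pow n).mapsTo hx)

theorem Fam.concat {φ ψ : ℝ → ℝ → ℝ} (hφ : Fam φ) (hψ : Fam ψ)
    (e1 : ∀ x ∈ Icc (0:ℝ) 1, φ 1 x = x) (e2 : ∀ x ∈ Icc (0:ℝ) 1, ψ 1 x = x) :
    Fam (fun s => if s ≤ 1 / 2 then φ (2 * s) else ψ (2 - 2 * s)) := by
  obtain ⟨U, hU, hK, Φ, h1, h2, h3⟩ := hφ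
  obtain ⟨V, hV, hKV, Ψ, k1, k2, k3⟩ := hψ
  have m1 : ∀ s ∈ Icc (0:ℝ) 1, min (2 * s) 1 ∈ Icc (0:ℝ) 1 := fun s hs =>
    ⟨le_min (by linarith [hs.1]) zero_le_one, min_le_right _ _⟩
  have m2 : ∀ s ∈ Icc (0:ℝ) 1, min (2 - 2 * s) 1 ∈ Icc (0:ℝ) 1 := fun s hs =>
    ⟨le_min (by linarith [hs.2]) zero_le_one, min_le_right _ _⟩
  refine ⟨U ∩ V, hU.inter hV, subset_inter hK hKV,
    fun s z => Φ (min (2 * s) 1) z + Ψ (min (2 - 2 * s) 1) z - z, ?_, ?_, ?_⟩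
  · intro s hs
    exact (((h1 _ (m1 s hs)).mono inter_subset_left).add ((k1 _ (m2 s hs)).mono
      inter_subset_right)).sub differentiableOn_id
  · intro s hs x hx
    simp only
    rw [h2 _ (m1 s hs) x hx, k2 _ (m2 s hs) x hx]
    split_ifs with h
    · rw [min_eq_left (by linarith), min_eq_right (by linarith), e2 x hx]; ring
    · push Not at h
      rw [min_eq_right (by linarith), min_eq_left (by linarith), e1 x hx]; ring
  · refine (ContinuousOn.add ?_ ?_).sub continuousOn_snd
    · have : ContinuousOn (fun p : ℝ × ℂ => ((min (2 * p.1) 1, p.2) : ℝ × ℂ))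
          (Icc (0:ℝ) 1 ×ˢ (U ∩ V)) := by fun_prop
      exact h3.comp this (fun p hp => ⟨m1 _ hp.1, hp.2.1⟩)
    · have : ContinuousOn (fun p : ℝ × ℂ => ((min (2 - 2 * p.1) 1, p.2) : ℝ × ℂ))
          (Icc (0:ℝ) 1 ×ˢ (U ∩ V)) := by fun_prop
      exact k3.comp this (fun p hp => ⟨m2 _ hp.1, hp.2.2⟩)

/-- a path from `ρ` (up to equality on `[0,1]`) to the trivial action -/
def Contr {d : ℕ} (ρ : AnAction d) : Prop :=
  ∃ γ : ℝ → AnAction d, (∀ i, Fam (fun s => ((γ s).gen i).toFun)) ∧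
    (∀ i, ∀ x ∈ Icc (0:ℝ) 1, ((γ 0).gen i).toFun x = (ρ.gen i).toFun x) ∧
    (∀ i, ∀ x ∈ Icc (0:ℝ) 1, ((γ 1).gen i).toFun x = x)

theorem final_of_contr {d : ℕ} (ρ₀ ρ₁ : AnAction d) (h0 : Contr ρ₀) (h1 : Contr ρ₁) :
    ∃ γ : ℝ → AnAction d, γ 0 = ρ₀ ∧ γ 1 = ρ₁ ∧ AnPathContinuous γ := by
  obtain ⟨γ, a1, a2, a3⟩ := h0
  obtain ⟨γ', b1, b2, b3⟩ := h1
  refine ⟨fun s => if s = 0 then ρ₀ else if s = 1 then ρ₁ else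
    if s ≤ 1 / 2 then γ (2 * s) else γ' (2 - 2 * s), by simp, by simp, ?_⟩
  intro t₀ ht₀ t ht hlim i
  have h := (a1 i).concat (b1 i) (a3 i) (b3 i)
  refine (h.congr (ψ := fun s => ((if s = 0 then ρ₀ else if s = 1 then ρ₁ else
    if s ≤ 1 / 2 then γ (2 * s) else γ' (2 - 2 * s) : AnAction d).gen i).toFun) ?_).tendsto ht₀ ht hlim
  intro s hs x hx
  by_cases e0 : s = 0
  · subst e0; simp [a2 i x hx]
  by_cases e1 : s = 1
  · subst e1
    have : ¬ ((1:ℝ) ≤ 1 / 2) := by norm_num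
    simp only [this, if_false]
    norm_num
    exact b2 i x hx
  simp only [e0, e1, if_false]
  split_ifs <;> rfl


theorem fin_unif {ι : Type*} [Finite ι] (P : ι → ℝ → ℝ → Prop)
    (mono : ∀ i K r K' r', P i K r → K ≤ K' → 0 < r' → r' ≤ r → P i K' r')
    (h : ∀ i, ∃ K r : ℝ, 0 < r ∧ P i K r) :
    ∃ K r : ℝ, 1 ≤ K ∧ 0 < r ∧ r ≤ 1 ∧ ∀ i, P i K r := by
  choose K r hr hP using h
  obtain ⟨M, hM⟩ := Finite.exists_le K
  obtain ⟨N, hN⟩ := Finite.exists_le (fun i => (r i)⁻¹)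
  have hN1 : 0 < max N 1 := lt_max_of_lt_right one_pos
  refine ⟨max M 1, (max N 1)⁻¹, le_max_right _ _, inv_pos.2 hN1, inv_le_one_of_one_le₀ (le_max_right _ _), ?_⟩
  intro i
  refine mono i _ _ _ _ (hP i) ((hM i).trans (le_max_left _ _)) (inv_pos.2 hN1) ?_
  rw [inv_le_comm₀ hN1 (hr i)]
  exact (hN i).trans (le_max_left _ _)

/-- the coordinate at infinity -/
def uu (k : ℕ) (z : ℂ) : ℂ := (z ^ k)⁻¹

/-- uniform estimates of a parabolic germ -/
def PEst (k : ℕ) (E : ℂ → ℂ) (t : ℝ) (K r : ℝ) : Prop :=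
  ∀ z : ℂ, ‖z‖ < r → ‖E z - z‖ ≤ K * ‖z‖ ^ (k + 1) ∧
    (z ≠ 0 → ‖uu k (E z) - uu k z + k * t‖ ≤ K * ‖z‖) ∧
    ∀ z' : ℂ, ‖z'‖ < r → z ≠ 0 → z' ≠ 0 →
      ‖(uu k (E z') - uu k z') - (uu k (E z) - uu k z)‖ ≤ K * ‖z' - z‖

theorem PEst.mono {k : ℕ} {E : ℂ → ℂ} {t K r K' r' : ℝ} (h : PEst k E t K r) (hK : K ≤ K')
    (hr : r' ≤ r) : PEst k E t K' r' := by
  intro z hz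
  obtain ⟨h1, h2, h3⟩ := h z (hz.trans_le hr)
  refine ⟨h1.trans (by gcongr), fun h0 => (h2 h0).trans (by gcongr), fun z' hz' h0 h0' => ?_⟩
  exact (h3 z' (hz'.trans_le hr) h0 h0').trans (by gcongr)

theorem pest_exists {k : ℕ} (hk : 1 ≤ k) {E B : ℂ → ℂ} {t : ℝ} (hB : AnalyticAt ℂ B 0)
    (hE : ∀ᶠ z in 𝓝 (0:ℂ), E z = z + z ^ (k + 1) * B z) (ht : B 0 = t) :
    ∃ K r : ℝ, 0 < r ∧ PEst k E t K r := by
  set δ : ℂ → ℂ := fun z => -(B z * (∑ j ∈ Finset.range k, (1 + z ^ k * B z) ^ j)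
    / (1 + z ^ k * B z) ^ k) with hδ
  have hk0 : k ≠ 0 := by omega
  have hδa : AnalyticAt ℂ δ 0 := by
    have h1 : AnalyticAt ℂ (fun z => 1 + z ^ k * B z) 0 := by fun_prop
    have h2 : AnalyticAt ℂ (fun z => ∑ j ∈ Finset.range k, (1 + z ^ k * B z) ^ j) 0 := by
      apply Finset.analyticAt_fun_sum
      intro j _
      exact h1.fun_pow j
    refine ((hB.fun_mul h2).fun_div (h1.fun_pow k) ?_).fun_neg
    simp [hk0]
  have hδ0 : δ 0 = -(k * t) := by
    simp [hδ, hk0, ht]; ring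
  obtain ⟨K1, s, hs, hlip⟩ := (hδa.contDiffAt (n := 1)).exists_lipschitzOnWith
  have hBb : ∀ᶠ z in 𝓝 (0:ℂ), ‖B z‖ < ‖B 0‖ + 1 :=
    hB.continuousAt.norm.eventually_lt_const (by linarith)
  have hne : ∀ᶠ z in 𝓝 (0:ℂ), 1 + z ^ k * B z ≠ 0 := by
    have h1 : ContinuousAt (fun z => 1 + z ^ k * B z) 0 := by
      have := hB.continuousAt; fun_prop
    apply h1.eventually_ne
    simp [hk0]
  obtain ⟨r, hr, hall⟩ := Metric.eventually_nhds_iff_ball.1 (hE.and (hBb.and (hne.and hs)))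
  refine ⟨max K1 (‖B 0‖ + 1), r, hr, ?_⟩
  have hform : ∀ z : ℂ, ‖z‖ < r → z ≠ 0 → uu k (E z) - uu k z = δ z := by
    intro z hz h0
    obtain ⟨e1, e2, e3, e4⟩ := hall z (by simpa using hz)
    have e5 : E z = z * (1 + z ^ k * B z) := by rw [e1]; ring
    have hg : (∑ j ∈ Finset.range k, (1 + z ^ k * B z) ^ j) * (z ^ k * B z)
        = (1 + z ^ k * B z) ^ k - 1 := by
      rw [← geom_sum_mul]; ring
    have hzk : z ^ k ≠ 0 := pow_ne_zero _ h0
    have hwk : (1 + z ^ k * B z) ^ k ≠ 0 := pow_ne_zero _ e3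
    simp only [uu, hδ, e5, mul_pow]
    field_simp
    linear_combination hg
  intro z hz
  obtain ⟨e1, e2, e3, e4⟩ := hall z (by simpa using hz)
  obtain ⟨-, -, -, e40⟩ := hall 0 (by simpa using hr)
  refine ⟨?_, ?_, ?_⟩
  · rw [e1, add_sub_cancel_left, norm_mul, norm_pow, mul_comm]
    gcongr
    exact e2.le.trans (le_max_right _ _)
  · intro h0
    rw [hform z hz h0]
    have := hlip.dist_le_mul z e4 0 e40
    rw [dist_eq_norm, dist_zero_right, hδ0, sub_neg_eq_add] at this
    refine this.trans ?_
    gcongr; exact le_max_left _ _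
  · intro z' hz' h0 h0'
    obtain ⟨-, -, -, e4'⟩ := hall z' (by simpa using hz')
    rw [hform z hz h0, hform z' hz' h0']
    have := hlip.dist_le_mul z' e4' z e4
    rw [dist_eq_norm, dist_eq_norm] at this
    refine this.trans ?_
    gcongr; exact le_max_left _ _

/-- comparison of `u`-distance and distance -/
theorem uu_compare (k : ℕ) (hk : 1 ≤ k) : ∃ η : ℝ, 0 < η ∧ η ≤ 1 / 2 ∧ ∀ z z' : ℂ, z ≠ 0 →
    ‖z' - z‖ ≤ η * ‖z‖ → z' ≠ 0 ∧ ‖z' - z‖ ≤ 2 * ‖z‖ ^ (k + 1) * ‖uu k z' - uu k z‖ := by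
  have hder : HasDerivAt (fun s : ℂ => ((1 + s) ^ k)⁻¹) (-(k:ℂ)) 0 := by
    have h1 : HasDerivAt (fun s : ℂ => (1 + s) ^ k) (k:ℂ) 0 := by
      have := ((hasDerivAt_id (0:ℂ)).const_add 1).fun_pow k
      simpa using this
    have := h1.fun_inv (by simp)
    simpa using this
  have h1 := (hasDerivAt_iff_isLittleO.1 hder).def (c := 1 / 2) (by norm_num)
  obtain ⟨η, hη, hall⟩ := Metric.eventually_nhds_iff_ball.1 h1
  refine ⟨min (η / 2) (1 / 2), lt_min (by linarith) (by norm_num), min_le_right _ _, ?_⟩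
  intro z z' h0 hz
  have hz0 : 0 < ‖z‖ := norm_pos_iff.2 h0
  set s := (z' - z) / z with hs
  have hz' : z' = z * (1 + s) := by rw [hs]; field_simp; ring
  have hsn : ‖s‖ ≤ min (η / 2) (1 / 2) := by
    rw [hs, norm_div, div_le_iff₀ hz0]; exact hz
  have hs1 : ‖s‖ ≤ 1 / 2 := hsn.trans (min_le_right _ _)
  have h1s : 1 + s ≠ 0 := by
    intro h
    have : s = -1 := by linear_combination h
    rw [this] at hs1; norm_num at hs1
  refine ⟨by rw [hz']; exact mul_ne_zero h0 h1s, ?_⟩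
  have hmem : s ∈ Metric.ball (0:ℂ) η := by
    rw [mem_ball_zero_iff]; exact hsn.trans_lt ((min_le_left _ _).trans_lt (by linarith))
  have h2 := hall s hmem
  simp only [sub_zero, add_zero, one_pow, inv_one, smul_eq_mul] at h2
  have h3 : ‖s‖ ≤ 2 * ‖((1 + s) ^ k)⁻¹ - 1‖ := by
    have h4 : ‖s * -(k:ℂ)‖ ≤ ‖((1 + s) ^ k)⁻¹ - 1‖ + ‖((1 + s) ^ k)⁻¹ - 1 - s * -(k:ℂ)‖ := by
      have := norm_sub_le (((1 + s) ^ k)⁻¹ - 1) (((1 + s) ^ k)⁻¹ - 1 - s * -(k:ℂ))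
      simpa using this
    rw [norm_mul, norm_neg, Complex.norm_natCast] at h4
    have hk1 : (1:ℝ) ≤ k := by exact_mod_cast hk
    nlinarith [norm_nonneg s]
  have h5 : uu k z' - uu k z = (z ^ k)⁻¹ * (((1 + s) ^ k)⁻¹ - 1) := by
    rw [uu, uu, hz', mul_pow, mul_inv]; ring
  have h6 : z' - z = z * s := by rw [hz']; ring
  rw [h5, h6, norm_mul, norm_mul, norm_inv, norm_pow]
  have hzk : ‖z‖ ^ k ≠ 0 := pow_ne_zero _ hz0.ne'
  have : 2 * ‖z‖ ^ (k + 1) * ((‖z‖ ^ k)⁻¹ * ‖((1 + s) ^ k)⁻¹ - 1‖)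
      = ‖z‖ * (2 * ‖((1 + s) ^ k)⁻¹ - 1‖) := by
    field_simp
    ring
  rw [this]
  gcongr


theorem pow_tele {k : ℕ} (hk : 1 ≤ k) {x y α : ℝ} (hy : 0 < y) (hyx : y ≤ x)
    (h : x ^ k - y ^ k = α * x ^ k * y ^ k) (h2 : x ^ k ≤ 2 * y ^ k) (hα : 0 < α) :
    α * x ^ (k + 1) ≤ 2 * k * (x - y) := by
  have hx : 0 < x := hy.trans_le hyx
  have hb := one_add_mul_le_pow (a := -((x - y) / x)) (by
    have : (x - y) / x ≤ 1 := by rw [div_le_one hx]; linarith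
    linarith) k
  have e : 1 + -((x - y) / x) = y / x := by field_simp; ring
  rw [e, div_pow] at hb
  have hxk : 0 < x ^ k := pow_pos hx k
  have h3 : x ^ k - k * ((x - y) / x) * x ^ k ≤ y ^ k := by
    rw [le_div_iff₀ hxk] at hb; linarith
  have h4 : α * y ^ k ≤ k * ((x - y) / x) := by
    have : α * y ^ k * x ^ k ≤ k * ((x - y) / x) * x ^ k := by linarith
    exact le_of_mul_le_mul_right this hxk
  have h5 : α * x ^ k ≤ 2 * (k * ((x - y) / x)) := by nlinarith
  have h6 : α * x ^ k * x ≤ 2 * (k * ((x - y) / x)) * x := by gcongr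
  have e2 : 2 * (k * ((x - y) / x)) * x = 2 * k * (x - y) := by field_simp
  rw [e2] at h6
  rw [pow_succ]; linarith

theorem uu_norm (k : ℕ) (z : ℂ) : ‖uu k z‖ = (‖z‖ ^ k)⁻¹ := by
  rw [uu, norm_inv, norm_pow]

theorem PEst.near {k : ℕ} (hk : 1 ≤ k) {E : ℂ → ℂ} {t K r : ℝ} (hP : PEst k E t K r) (hK : 1 ≤ K)
    {w : ℂ} (h1 : ‖w‖ < r) (h2 : 2 * K * ‖w‖ ≤ 1) (h0 : w ≠ 0) :
    E w ≠ 0 ∧ ‖w‖ ≤ 2 * ‖E w‖ ∧ ‖E w‖ ≤ 2 * ‖w‖ := by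
  have hw : 0 < ‖w‖ := norm_pos_iff.2 h0
  have hw1 : ‖w‖ ≤ 1 := by nlinarith
  have h3 := (hP w h1).1
  have h4 : K * ‖w‖ ^ (k + 1) ≤ ‖w‖ / 2 := by
    have : ‖w‖ ^ k ≤ ‖w‖ := by
      calc ‖w‖ ^ k ≤ ‖w‖ ^ 1 := pow_le_pow_of_le_one hw.le hw1 hk
        _ = ‖w‖ := pow_one _
    rw [pow_succ]
    have : K * (‖w‖ ^ k * ‖w‖) ≤ K * (‖w‖ * ‖w‖) := by gcongr
    nlinarith
  have h5 : ‖w‖ ≤ ‖E w‖ + ‖E w - w‖ := by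
    have := norm_sub_le (E w) (E w - w); simpa using this
  have h6 : ‖E w‖ ≤ ‖w‖ + ‖E w - w‖ := by
    have := norm_add_le w (E w - w); simpa using this
  refine ⟨?_, by linarith, by linarith⟩
  rw [← norm_pos_iff]; linarith

theorem quad_bound {x y a N : ℝ} (hN : 0 ≤ N) (ha : 0 < a)
    {A : ℝ} (hA : |A| = a) (hdir : -(1 / 4) * √(x ^ 2 + y ^ 2) * a ≤ x * A) :
    (3 / 5) * (√(x ^ 2 + y ^ 2) + N * a) ≤ √((x + N * A) ^ 2 + y ^ 2) := by
  set V := √(x ^ 2 + y ^ 2) with hV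
  have hV0 : 0 ≤ V := Real.sqrt_nonneg _
  have hV2 : V ^ 2 = x ^ 2 + y ^ 2 := Real.sq_sqrt (by positivity)
  apply Real.le_sqrt_of_sq_le
  have hA2 : A ^ 2 = a ^ 2 := by rw [← hA, sq_abs]
  have e : (x + N * A) ^ 2 + y ^ 2 = V ^ 2 + 2 * N * (x * A) + N ^ 2 * a ^ 2 := by
    rw [hV2, ← hA2]; ring
  rw [e]
  have : 2 * N * (-(1 / 4) * V * a) ≤ 2 * N * (x * A) := by gcongr
  nlinarith [sq_nonneg (V - N * a)]

theorem orbit_core {k : ℕ} (hk : 1 ≤ k) {E : ℂ → ℂ} {t K r a A : ℝ} (hP : PEst k E t K r)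
    (hK : 1 ≤ K) (hA : A = -(k * t)) (ha : a = |A|) (ha0 : 0 < a) {z : ℂ} (h0 : z ≠ 0)
    (c1 : 2 * ‖z‖ < r) (c2 : 4 * K * ‖z‖ ≤ 1) (c3 : 20 * K * ‖z‖ ≤ a) 
    (hdir : -(1 / 4) * ‖uu k z‖ * a ≤ (uu k z).re * A) (n : ℕ) :
    E^[n] z ≠ 0 ∧ ‖E^[n] z‖ ≤ 2 * ‖z‖ ∧ ‖E^[n] z‖ ^ k ≤ 2 / (‖uu k z‖ + n * a) := by
  have hz : 0 < ‖z‖ := norm_pos_iff.2 h0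
  have hU : 0 < ‖uu k z‖ := by rw [uu_norm]; positivity
  have step : ∀ n : ℕ, E^[n] z ≠ 0 → ‖uu k (E^[n] z) - uu k z - n * A‖ ≤ n * (a / 10) →
      ‖E^[n] z‖ ≤ 2 * ‖z‖ ∧ ‖E^[n] z‖ ^ k ≤ 2 / (‖uu k z‖ + n * a) := by
    intro n hn0 hn
    have hpos : 0 < ‖uu k z‖ + n * a := by positivity
    have hq := quad_bound (x := (uu k z).re) (y := (uu k z).im) (N := n) (by positivity) ha0 ha.symm (by
      rw [Complex.norm_eq_sqrt_sq_add_sq] at hdir; exact hdir)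
    have e1 : √(((uu k z).re + n * A) ^ 2 + (uu k z).im ^ 2) = ‖uu k z + n * A‖ := by
      rw [Complex.norm_eq_sqrt_sq_add_sq]
      simp
    rw [e1, ← Complex.norm_eq_sqrt_sq_add_sq] at hq
    have h2 : ‖uu k z + n * A‖ ≤ ‖uu k (E^[n] z)‖ + ‖uu k (E^[n] z) - uu k z - n * A‖ := by
      have := norm_sub_le (uu k (E^[n] z)) (uu k (E^[n] z) - uu k z - n * A)
      rwa [show uu k (E^[n] z) - (uu k (E^[n] z) - uu k z - n * A) = uu k z + n * A by ring] at this
    have h3 : (‖uu k z‖ + n * a) / 2 ≤ ‖uu k (E^[n] z)‖ := by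
      have : (0:ℝ) ≤ n * a := by positivity
      nlinarith
    have h4 : ‖E^[n] z‖ ^ k ≤ 2 / (‖uu k z‖ + n * a) := by
      rw [uu_norm k (E^[n] z)] at h3
      rw [show 2 / (‖uu k z‖ + n * a) = ((‖uu k z‖ + n * a) / 2)⁻¹ by rw [inv_div]]
      exact le_inv_of_le_inv₀ (by positivity) h3
    refine ⟨?_, h4⟩
    have h5 : ‖E^[n] z‖ ^ k ≤ (2 * ‖z‖) ^ k := by
      calc ‖E^[n] z‖ ^ k ≤ 2 / (‖uu k z‖ + n * a) := h4
        _ ≤ 2 / ‖uu k z‖ := by gcongr; have : (0:ℝ) ≤ n * a := by positivity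
                               linarith
        _ = 2 * ‖z‖ ^ k := by rw [uu_norm, div_inv_eq_mul]
        _ ≤ 2 ^ k * ‖z‖ ^ k := by
          gcongr
          calc (2:ℝ) = 2 ^ 1 := by norm_num
            _ ≤ 2 ^ k := pow_le_pow_right₀ (by norm_num) hk
        _ = _ := by rw [mul_pow]
    exact le_of_pow_le_pow_left₀ (by omega) (by positivity) h5
  have main : ∀ n : ℕ, E^[n] z ≠ 0 ∧ ‖uu k (E^[n] z) - uu k z - n * A‖ ≤ n * (a / 10) := by
    intro n
    induction n with
    | zero => simp [h0]
    | succ n ih =>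
      obtain ⟨i1, i2⟩ := ih
      obtain ⟨j1, j2⟩ := step n i1 i2
      rw [Function.iterate_succ_apply']
      set w := E^[n] z
      have hw : ‖w‖ < r := j1.trans_lt c1
      refine ⟨(hP.near hk hK hw (by nlinarith) i1).1, ?_⟩
      have h2 := (hP w hw).2.1 i1
      have e : uu k (E w) - uu k z - ((n + 1 : ℕ):ℂ) * A
          = (uu k w - uu k z - n * A) + (uu k (E w) - uu k w + k * t) := by
        rw [hA]; push_cast; ring
      rw [e]
      refine (norm_add_le _ _).trans ?_
      push_cast
      nlinarith
  exact ⟨(main n).1, step n (main n).1 (main n).2⟩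

theorem orbit {k : ℕ} (hk : 1 ≤ k) {E : ℂ → ℂ} {t K r a A : ℝ} (hP : PEst k E t K r)
    (hK : 1 ≤ K) (hA : A = -(k * t)) (ha : a = |A|) (ha0 : 0 < a) {z : ℂ} (h0 : z ≠ 0)
    (c1 : 2 * ‖z‖ < r) (c2 : 4 * K * ‖z‖ ≤ 1) (c3 : 20 * K * ‖z‖ ≤ a) (c4 : a * ‖z‖ ≤ 1)
    (hdir : -(1 / 4) * ‖uu k z‖ * a ≤ (uu k z).re * A) :
    (∀ n, a * ∑ i ∈ Finset.range n, ‖E^[i] z‖ ^ (k + 1) ≤ 8 * k * ‖z‖) ∧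
      Tendsto (fun n => E^[n] z) atTop (𝓝 0) := by
  have core := orbit_core hk hP hK hA ha ha0 h0 c1 c2 c3 hdir
  have hz : 0 < ‖z‖ := norm_pos_iff.2 h0
  have hU : 0 < ‖uu k z‖ := by rw [uu_norm]; positivity
  have hz1 : ‖z‖ ≤ 1 := by nlinarith
  have hUa : a ≤ ‖uu k z‖ := by
    rw [uu_norm]
    have h1 : ‖z‖ ^ k ≤ ‖z‖ := by
      calc ‖z‖ ^ k ≤ ‖z‖ ^ 1 := pow_le_pow_of_le_one hz.le hz1 hk
        _ = ‖z‖ := pow_one _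
    rw [← one_div, le_div_iff₀ (by positivity)]
    nlinarith
  set m : ℕ → ℝ := fun n => (2 / (‖uu k z‖ + n * a)) ^ ((k:ℝ)⁻¹) with hm
  have hden : ∀ n : ℕ, 0 < ‖uu k z‖ + n * a := fun n => by positivity
  have hmpos : ∀ n, 0 < m n := fun n => Real.rpow_pos_of_pos (div_pos two_pos (hden n)) _
  have hmk : ∀ n, m n ^ k = 2 / (‖uu k z‖ + n * a) := fun n =>
    Real.rpow_inv_natCast_pow (div_pos two_pos (hden n)).le (by omega)
  have hle : ∀ n, ‖E^[n] z‖ ≤ m n := fun n => by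
    apply le_of_pow_le_pow_left₀ (n := k) (by omega) (hmpos n).le
    rw [hmk]; exact (core n).2.2
  have htele : ∀ n, (a / 2) * m n ^ (k + 1) ≤ 2 * k * (m n - m (n + 1)) := by
    intro n
    have d1 := hden n
    have d2 := hden (n + 1)
    have hmon : m (n + 1) ≤ m n := by
      apply le_of_pow_le_pow_left₀ (n := k) (by omega) (hmpos n).le
      rw [hmk, hmk]
      gcongr
      linarith
    refine pow_tele hk (hmpos (n + 1)) hmon ?_ ?_ (by positivity)
    · rw [hmk, hmk]
      field_simp
      push_cast
      ring
    · rw [hmk, hmk]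
      rw [← mul_div_assoc, div_le_div_iff₀ d1 d2]
      push_cast
      have : (0:ℝ) ≤ n * a := by positivity
      nlinarith
  have hm0 : m 0 ≤ 2 * ‖z‖ := by
    apply le_of_pow_le_pow_left₀ (n := k) (by omega) (by positivity)
    rw [hmk, uu_norm]
    simp only [Nat.cast_zero, zero_mul, add_zero, div_inv_eq_mul, mul_pow]
    gcongr
    calc (2:ℝ) = 2 ^ 1 := by norm_num
      _ ≤ 2 ^ k := pow_le_pow_right₀ (by norm_num) hk
  refine ⟨?_, ?_⟩
  · intro n
    have hs : (a / 2) * ∑ i ∈ Finset.range n, ‖E^[i] z‖ ^ (k + 1) ≤ 2 * k * (m 0 - m n) := by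
      induction n with
      | zero => simp
      | succ n ih =>
        rw [Finset.sum_range_succ, mul_add]
        have h1 := htele n
        have h2 : (a / 2) * ‖E^[n] z‖ ^ (k + 1) ≤ (a / 2) * m n ^ (k + 1) := by
          gcongr; exact hle n
        linarith
    have hk0 : (0:ℝ) ≤ k := by positivity
    have := (hmpos n).le
    nlinarith [mul_nonneg hk0 this]
  · rw [tendsto_zero_iff_norm_tendsto_zero]
    refine squeeze_zero (fun n => norm_nonneg _) hle ?_
    have h1 : Tendsto (fun n : ℕ => 2 / (‖uu k z‖ + n * a)) atTop (𝓝 0) := by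
      apply Tendsto.const_div_atTop
      exact tendsto_atTop_add_const_left _ _ (tendsto_natCast_atTop_atTop.atTop_mul_const ha0)
    have h2 := h1.rpow_const (p := ((k:ℝ)⁻¹)) (Or.inr (by positivity))
    rw [Real.zero_rpow (by positivity)] at h2
    exact h2


theorem ev_small (c : ℝ) {d : ℝ} (hd : 0 < d) : ∀ᶠ x in 𝓝 (0:ℝ), c * x < d := by
  have : ContinuousAt (fun x : ℝ => c * x) 0 := by fun_prop
  exact this.eventually_lt_const (by simpa using hd)

theorem ev_small_exists {P : ℝ → Prop} (h : ∀ᶠ x in 𝓝 (0:ℝ), P x) :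
    ∃ r > 0, ∀ x, 0 ≤ x → x < r → P x := by
  obtain ⟨r, hr, hh⟩ := Metric.eventually_nhds_iff_ball.1 h
  refine ⟨r, hr, fun x hx hxr => hh x ?_⟩
  rw [mem_ball_zero_iff, Real.norm_eq_abs, abs_of_nonneg hx]; exact hxr

/-- conclusion of the pair lemma -/
def PairConc (k : ℕ) (η : ℝ) (E : ℂ → ℂ) (a A D r2 : ℝ) : Prop :=
  ∀ z z' : ℂ, z ≠ 0 → ‖z‖ < r2 → -(1 / 4) * ‖uu k z‖ * a ≤ (uu k z).re * A →
      ‖z' - z‖ ≤ η * ‖z‖ → ‖uu k z' - uu k z‖ ≤ D →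
      (∀ n, E^[n] z ≠ 0 ∧ E^[n] z' ≠ 0 ∧ ‖E^[n] z‖ ≤ 2 * ‖z‖ ∧ ‖E^[n] z'‖ ≤ 4 * ‖z‖ ∧
        ‖(uu k (E^[n] z') - uu k (E^[n] z)) - (uu k z' - uu k z)‖ ≤ 1 / 2 * ‖uu k z' - uu k z‖) ∧
      Tendsto (fun n => E^[n] z) atTop (𝓝 0) ∧ Tendsto (fun n => E^[n] z') atTop (𝓝 0)

set_option maxHeartbeats 1000000 in
theorem pair {k : ℕ} (hk : 1 ≤ k) {η : ℝ} (hη0 : 0 < η) (hη : η ≤ 1 / 2)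
    (hcmp : ∀ z z' : ℂ, z ≠ 0 →
      ‖z' - z‖ ≤ η * ‖z‖ → z' ≠ 0 ∧ ‖z' - z‖ ≤ 2 * ‖z‖ ^ (k + 1) * ‖uu k z' - uu k z‖)
    {E : ℂ → ℂ} {t K r a A : ℝ} (hP : PEst k E t K r) (hr : 0 < r)
    (hK : 1 ≤ K) (hA : A = -(k * t)) (ha : a = |A|) (ha0 : 0 < a) (D : ℝ) (hD : 0 ≤ D) :
    ∃ r2 > 0, PairConc k η E a A D r2 := by
  set Q := 3 * D + K * 2 ^ (k + 1) + K with hQ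
  have hQ0 : 0 ≤ Q := by positivity
  obtain ⟨r2, hr2, hs⟩ := ev_small_exists ((ev_small 4 hr).and ((ev_small (8 * K) one_pos).and
    ((ev_small (20 * K) ha0).and ((ev_small a one_pos).and ((ev_small (48 * K * k) ha0).and
      (ev_small (4 * Q) hη0))))))
  refine ⟨r2, hr2, ?_⟩
  intro z z' h0 hz hdir hzz hDD
  obtain ⟨s1, s2, s3, s4, s5, s6⟩ := hs ‖z‖ (norm_nonneg _) hz
  have hz0 : 0 < ‖z‖ := norm_pos_iff.2 h0
  have core := orbit_core hk hP hK hA ha ha0 h0 (by linarith) (by nlinarith) s3.le hdir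
  obtain ⟨hsum, hten⟩ := orbit hk hP hK hA ha ha0 h0 (by linarith) (by nlinarith) s3.le s4.le hdir
  set Δ : ℕ → ℂ := fun n => uu k (E^[n] z') - uu k (E^[n] z) with hΔ
  have hΔ0 : Δ 0 = uu k z' - uu k z := rfl
  have hsm : ∀ n, 3 * K * (∑ i ∈ Finset.range n, ‖E^[i] z‖ ^ (k + 1)) ≤ 1 / 2 := by
    intro n
    have h1 := hsum n
    have h2 : a * (3 * K * (∑ i ∈ Finset.range n, ‖E^[i] z‖ ^ (k + 1))) ≤ a * (1 / 2) := by
      have : 3 * K * (a * (∑ i ∈ Finset.range n, ‖E^[i] z‖ ^ (k + 1))) ≤ 3 * K * (8 * k * ‖z‖) := by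
        gcongr
      nlinarith
    exact le_of_mul_le_mul_left h2 ha0
  have main : ∀ n, ‖E^[n] z' - E^[n] z‖ ≤ η * ‖E^[n] z‖ ∧
      ‖Δ n - Δ 0‖ ≤ 3 * K * (∑ i ∈ Finset.range n, ‖E^[i] z‖ ^ (k + 1)) * ‖Δ 0‖ := by
    intro n
    induction n with
    | zero => simpa using hzz
    | succ n ih =>
      obtain ⟨i1, i2⟩ := ih
      obtain ⟨c1, c2, -⟩ := core n
      obtain ⟨n1, n2⟩ := hcmp _ _ c1 i1
      have hΔn : ‖Δ n‖ ≤ 3 / 2 * ‖Δ 0‖ := by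
        have h1 : ‖Δ n - Δ 0‖ ≤ 1 / 2 * ‖Δ 0‖ := i2.trans (by gcongr; exact hsm n)
        have h2 : ‖Δ n‖ ≤ ‖Δ n - Δ 0‖ + ‖Δ 0‖ := by
          have := norm_add_le (Δ n - Δ 0) (Δ 0); simpa using this
        linarith
      have eΔ : Δ (n + 1) - Δ 0 = (Δ n - Δ 0) + ((uu k (E (E^[n] z')) - uu k (E^[n] z'))
          - (uu k (E (E^[n] z)) - uu k (E^[n] z))) := by
        simp only [hΔ, Function.iterate_succ_apply']; ring
      rw [eΔ, Function.iterate_succ_apply', Function.iterate_succ_apply']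
      change ‖E^[n] z' - E^[n] z‖ ≤ 2 * ‖E^[n] z‖ ^ (k + 1) * ‖Δ n‖ at n2
      set w := E^[n] z with hw
      set w' := E^[n] z' with hw'
      have hw0 : 0 < ‖w‖ := norm_pos_iff.2 c1
      have hwr : ‖w‖ < r := by linarith
      have hw2 : ‖w'‖ ≤ 2 * ‖w‖ := by
        have : ‖w'‖ ≤ ‖w' - w‖ + ‖w‖ := by
          have := norm_add_le (w' - w) w; simpa using this
        nlinarith
      have hwr' : ‖w'‖ < r := by linarith
      have hd : ‖w' - w‖ ≤ 3 * ‖w‖ ^ (k + 1) * ‖Δ 0‖ := by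
        have : 2 * ‖w‖ ^ (k + 1) * ‖Δ n‖ ≤ 2 * ‖w‖ ^ (k + 1) * (3 / 2 * ‖Δ 0‖) := by gcongr
        linarith
      constructor
      · have e : E w' - E w = (w' - w) + (E w' - w') - (E w - w) := by ring
        have h1 := (hP w hwr).1
        have h2 := (hP w' hwr').1
        have h3 : K * ‖w'‖ ^ (k + 1) ≤ K * (2 ^ (k + 1) * ‖w‖ ^ (k + 1)) := by
          rw [← mul_pow]; gcongr
        have h4 : 3 * ‖w‖ ^ (k + 1) * ‖Δ 0‖ ≤ 3 * ‖w‖ ^ (k + 1) * D := by rw [hΔ0]; gcongr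
        have h5 : ‖E w' - E w‖ ≤ Q * ‖w‖ ^ (k + 1) := by
          rw [e]
          refine ((norm_sub_le _ _).trans (add_le_add (norm_add_le _ _) le_rfl)).trans ?_
          rw [hQ]; linarith
        have hKw : 2 * K * ‖w‖ ≤ 1 := by
          have : 2 * K * ‖w‖ ≤ 2 * K * (2 * ‖z‖) := by gcongr
          nlinarith
        have hw1 : ‖w‖ ≤ 1 := by
          have : 1 * ‖w‖ ≤ K * ‖w‖ := by gcongr
          linarith
        have h6 : ‖w‖ ^ (k + 1) ≤ ‖w‖ * ‖w‖ := by
          rw [pow_succ]; gcongr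
          calc ‖w‖ ^ k ≤ ‖w‖ ^ 1 := pow_le_pow_of_le_one hw0.le hw1 hk
            _ = ‖w‖ := pow_one _
        have h7 := (hP.near hk hK hwr hKw c1).2.1
        have h8 : Q * ‖w‖ ^ (k + 1) ≤ Q * (2 * ‖z‖) * (2 * ‖E w‖) := by
          calc Q * ‖w‖ ^ (k + 1) ≤ Q * (‖w‖ * ‖w‖) := by gcongr
            _ ≤ Q * ((2 * ‖z‖) * (2 * ‖E w‖)) := by gcongr
            _ = _ := by ring
        have h9 : Q * (2 * ‖z‖) * (2 * ‖E w‖) = (4 * Q * ‖z‖) * ‖E w‖ := by ring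
        have h10 : (4 * Q * ‖z‖) * ‖E w‖ ≤ η * ‖E w‖ := by gcongr
        linarith
      · have h1 := (hP w hwr).2.2 w' hwr' c1 n1
        refine (norm_add_le _ _).trans ?_
        rw [Finset.sum_range_succ]
        have h2 : K * ‖w' - w‖ ≤ K * (3 * ‖w‖ ^ (k + 1) * ‖Δ 0‖) := by gcongr
        nlinarith
  refine ⟨fun n => ⟨(core n).1, (hcmp _ _ (core n).1 (main n).1).1, (core n).2.1, ?_, ?_⟩, hten, ?_⟩
  · have h1 := (main n).1
    have h2 := (core n).2.1
    have : ‖E^[n] z'‖ ≤ ‖E^[n] z' - E^[n] z‖ + ‖E^[n] z‖ := by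
      have := norm_add_le (E^[n] z' - E^[n] z) (E^[n] z); simpa using this
    nlinarith [norm_nonneg (E^[n] z)]
  · exact (main n).2.trans (by rw [← hΔ0]; gcongr; exact hsm n)
  · have h1 : Tendsto (fun n => E^[n] z' - E^[n] z) atTop (𝓝 0) := by
      rw [tendsto_zero_iff_norm_tendsto_zero]
      refine squeeze_zero (fun n => norm_nonneg _) (fun n => (main n).1) ?_
      have := hten.norm.const_mul η
      simpa using this
    have := h1.add hten
    simpa using this


/-- composition along a word -/
def cw {ι : Type*} (E : ι → ℂ → ℂ) : List ι → ℂ → ℂ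
  | [], z => z
  | ℓ :: l, z => E ℓ (cw E l z)

/-- weight of a word -/
def wsum {ι : Type*} (τ : ι → ℝ) (l : List ι) : ℝ := (l.map τ).sum

theorem wsum_nil {ι : Type*} (τ : ι → ℝ) : wsum τ [] = 0 := rfl
theorem wsum_cons {ι : Type*} (τ : ι → ℝ) (ℓ : ι) (l : List ι) :
    wsum τ (ℓ :: l) = τ ℓ + wsum τ l := by simp [wsum]

/-- all partial weights are bounded by `C` -/
def BW {ι : Type*} (τ : ι → ℝ) (C : ℝ) : List ι → Prop
  | [] => True
  | ℓ :: l => BW τ C l ∧ |wsum τ (ℓ :: l)| ≤ C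

theorem BW.le {ι : Type*} {τ : ι → ℝ} {C : ℝ} (hC : 0 ≤ C) {l : List ι} (h : BW τ C l) :
    |wsum τ l| ≤ C := by
  cases l with
  | nil => simpa [wsum_nil] using hC
  | cons ℓ l => exact h.2

/-- uniform control of words of bounded weight -/
def WordConc {ι : Type*} (E : ι → ℂ → ℂ) (τ : ι → ℝ) : Prop :=
  ∀ C ≥ 0, ∀ ρ > 0, ∃ r > 0, ∃ L, ∀ l, BW τ C l → ∀ z, ‖z‖ < r → ‖cw E l z‖ < ρ ∧
    ∀ l', BW τ C l' → ‖cw E l z - cw E l' z‖ ≤ L * |wsum τ l - wsum τ l'|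

theorem iter_comm {E F : ℂ → ℂ} {r : ℝ} (hc : ∀ z, ‖z‖ < r → E (F z) = F (E z)) {z : ℂ}
    (h : ∀ n, ‖E^[n] z‖ < r) (n : ℕ) : E^[n] (F z) = F (E^[n] z) := by
  induction n with
  | zero => rfl
  | succ n ih => rw [Function.iterate_succ_apply', ih, hc _ (h n), Function.iterate_succ_apply']

theorem word_dir {ι : Type*} {k : ℕ} (hk : 1 ≤ k) {η : ℝ} (_hη0 : 0 < η) (hη : η ≤ 1 / 2)
    (hcmp : ∀ z z' : ℂ, z ≠ 0 →
      ‖z' - z‖ ≤ η * ‖z‖ → z' ≠ 0 ∧ ‖z' - z‖ ≤ 2 * ‖z‖ ^ (k + 1) * ‖uu k z' - uu k z‖)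
    {E : ι → ℂ → ℂ} {τ : ι → ℝ} {K r b : ℝ} (hP : ∀ ℓ, PEst k (E ℓ) (τ ℓ) K r)
    (hK : 1 ≤ K) (hb : ∀ ℓ, |τ ℓ| ≤ b) {e : ι}
    (hcom : ∀ ℓ z, ‖z‖ < r → E e (E ℓ z) = E ℓ (E e z))
    {a A C D r2 : ℝ} (hC : 0 ≤ C) (ha0 : 0 < a) (hD : D = 4 * k * C + k * b + 1)
    (hpair : PairConc k η (E e) a A D r2) {z : ℂ} (h0 : z ≠ 0) (hdir : 0 ≤ (uu k z).re * A)
    (s1 : ‖z‖ < r2) (s2 : 4 * ‖z‖ < r) (s3 : 2 * K * ‖z‖ ≤ 1)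
    (s4 : (4 * k * C + K * 2 ^ (k + 1)) * ‖z‖ ≤ η) {l : List ι} (hl : BW τ C l) :
    ‖cw E l z - z‖ ≤ η * ‖z‖ ∧ ‖uu k (cw E l z) - uu k z‖ ≤ 2 * k * |wsum τ l| ∧
      Tendsto (fun n => uu k ((E e)^[n] (cw E l z)) - uu k ((E e)^[n] z)) atTop
        (𝓝 (-(k * wsum τ l : ℝ) : ℂ)) := by
  have hz0 : 0 < ‖z‖ := norm_pos_iff.2 h0
  have hz1 : ‖z‖ ≤ 1 := by nlinarith
  have hzk : ‖z‖ ^ (k + 1) ≤ ‖z‖ * ‖z‖ := by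
    rw [pow_succ]; gcongr
    calc ‖z‖ ^ k ≤ ‖z‖ ^ 1 := pow_le_pow_of_le_one hz0.le hz1 hk
      _ = ‖z‖ := pow_one _
  have hdir' : -(1 / 4) * ‖uu k z‖ * a ≤ (uu k z).re * A := by
    have : 0 ≤ ‖uu k z‖ * a := by positivity
    linarith
  have hb0 : ∀ ℓ : ι, 0 ≤ b := fun ℓ => (abs_nonneg _).trans (hb ℓ)
  induction l with
  | nil => 
    simp only [cw, sub_self, norm_zero, wsum_nil, abs_zero, mul_zero, le_refl, true_and]
    refine ⟨by positivity, ?_⟩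
    simp
  | cons ℓ l ih =>
    obtain ⟨i1, i2, i3⟩ := ih hl.1
    have hwl := hl.1.le hC
    have hbb := hb0 ℓ
    set ζ := cw E l z with hζ
    have hcw : cw E (ℓ :: l) z = E ℓ ζ := rfl
    rw [hcw]
    have hk0 : (0:ℝ) ≤ k := by positivity
    have i2' : ‖uu k ζ - uu k z‖ ≤ 2 * k * C := i2.trans (by gcongr)
    obtain ⟨ζ0, hζz⟩ := hcmp z ζ h0 i1
    have hζ2 : ‖ζ‖ ≤ 2 * ‖z‖ := by
      have : ‖ζ‖ ≤ ‖ζ - z‖ + ‖z‖ := by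
        have := norm_add_le (ζ - z) z; simpa using this
      nlinarith
    have hζr : ‖ζ‖ < r := by linarith
    have hDle : 2 * k * C ≤ D := by
      rw [hD]; nlinarith [mul_nonneg hk0 hC, mul_nonneg hk0 hbb]
    obtain ⟨p1, p2, p3⟩ := hpair z ζ h0 s1 hdir' i1 (i2'.trans hDle)
    have horb : ∀ n, ‖(E e)^[n] ζ‖ < r := fun n => (p1 n).2.2.2.1.trans_lt s2
    have hEz : ‖E ℓ ζ - z‖ ≤ η * ‖z‖ := by
      have h1 := (hP ℓ ζ hζr).1
      have h2 : K * ‖ζ‖ ^ (k + 1) ≤ K * (2 ^ (k + 1) * (‖z‖ * ‖z‖)) := by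
        calc K * ‖ζ‖ ^ (k + 1) ≤ K * (2 * ‖z‖) ^ (k + 1) := by gcongr
          _ = K * (2 ^ (k + 1) * ‖z‖ ^ (k + 1)) := by rw [mul_pow]
          _ ≤ _ := by gcongr
      have h3 : 2 * ‖z‖ ^ (k + 1) * ‖uu k ζ - uu k z‖ ≤ 2 * (‖z‖ * ‖z‖) * (2 * k * C) := by gcongr
      have h4 : ‖E ℓ ζ - z‖ ≤ ‖E ℓ ζ - ζ‖ + ‖ζ - z‖ := norm_sub_le_norm_sub_add_norm_sub _ _ _
      have h5 : (4 * k * C + K * 2 ^ (k + 1)) * ‖z‖ * ‖z‖ ≤ η * ‖z‖ := by gcongr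
      linarith
    have hu : ‖uu k (E ℓ ζ) - uu k z‖ ≤ D := by
      have h1 := (hP ℓ ζ hζr).2.1 ζ0
      have h2 : ‖uu k (E ℓ ζ) - uu k ζ‖ ≤ ‖uu k (E ℓ ζ) - uu k ζ + k * τ ℓ‖ + ‖(k * τ ℓ : ℂ)‖ := by
        have := norm_sub_le (uu k (E ℓ ζ) - uu k ζ + k * τ ℓ) (k * τ ℓ : ℂ)
        simpa using this
      have h3 : ‖(k * τ ℓ : ℂ)‖ ≤ k * b := by
        rw [norm_mul, Complex.norm_natCast, Complex.norm_real, Real.norm_eq_abs]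
        gcongr; exact hb ℓ
      have h4 : K * ‖ζ‖ ≤ 1 := by
        have : K * ‖ζ‖ ≤ K * (2 * ‖z‖) := by gcongr
        linarith
      have h5 : ‖uu k (E ℓ ζ) - uu k z‖ ≤ ‖uu k (E ℓ ζ) - uu k ζ‖ + ‖uu k ζ - uu k z‖ :=
        norm_sub_le_norm_sub_add_norm_sub _ _ _
      rw [hD]
      nlinarith [mul_nonneg hk0 hC]
    obtain ⟨q1, q2, q3⟩ := hpair z (E ℓ ζ) h0 s1 hdir' hEz hu
    have hlim : Tendsto (fun n => uu k ((E e)^[n] (E ℓ ζ)) - uu k ((E e)^[n] z)) atTop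
        (𝓝 (-(k * wsum τ (ℓ :: l) : ℝ) : ℂ)) := by
      have h1 : Tendsto (fun n => uu k (E ℓ ((E e)^[n] ζ)) - uu k ((E e)^[n] ζ) + k * τ ℓ) atTop
          (𝓝 0) := by
        rw [tendsto_zero_iff_norm_tendsto_zero]
        refine squeeze_zero (fun n => norm_nonneg _)
          (fun n => (hP ℓ _ (horb n)).2.1 (p1 n).2.1) ?_
        have := p3.norm.const_mul K
        simpa using this
      have h2 := (h1.add i3).sub_const (k * τ ℓ : ℂ)
      convert h2 using 1
      · ext n
        rw [iter_comm (hcom ℓ) horb n]; ring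
      · rw [wsum_cons]; push_cast; congr 1; ring
    refine ⟨hEz, ?_, hlim⟩
    have h1 := (hlim.sub_const (uu k (E ℓ ζ) - uu k z)).norm
    have h2 := le_of_tendsto' h1 (fun n => (q1 n).2.2.2.2)
    have h3 : ‖uu k (E ℓ ζ) - uu k z‖ ≤ ‖(-(k * wsum τ (ℓ :: l) : ℝ) : ℂ)‖
        + ‖(-(k * wsum τ (ℓ :: l) : ℝ) : ℂ) - (uu k (E ℓ ζ) - uu k z)‖ := by
      have := norm_sub_le (-(k * wsum τ (ℓ :: l) : ℝ) : ℂ)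
        ((-(k * wsum τ (ℓ :: l) : ℝ) : ℂ) - (uu k (E ℓ ζ) - uu k z))
      simpa using this
    have h4 : ‖(-(k * wsum τ (ℓ :: l) : ℝ) : ℂ)‖ = k * |wsum τ (ℓ :: l)| := by
      rw [norm_neg, Complex.norm_real, Real.norm_eq_abs, abs_mul, Nat.abs_cast]
    linarith


theorem word_lip {ι : Type*} {k : ℕ} (hk : 1 ≤ k) {η : ℝ} (hη0 : 0 < η) (hη : η ≤ 1 / 2)
    (hcmp : ∀ z z' : ℂ, z ≠ 0 →
      ‖z' - z‖ ≤ η * ‖z‖ → z' ≠ 0 ∧ ‖z' - z‖ ≤ 2 * ‖z‖ ^ (k + 1) * ‖uu k z' - uu k z‖)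
    {E : ι → ℂ → ℂ} {τ : ι → ℝ} {K r b : ℝ} (hP : ∀ ℓ, PEst k (E ℓ) (τ ℓ) K r)
    (hK : 1 ≤ K) (hb : ∀ ℓ, |τ ℓ| ≤ b) {e : ι}
    (hcom : ∀ ℓ z, ‖z‖ < r → E e (E ℓ z) = E ℓ (E e z))
    {a A C D r2 : ℝ} (hC : 0 ≤ C) (haA : a = |A|) (ha0 : 0 < a) (hD : D = 4 * k * C + k * b + 1)
    (hpair : PairConc k η (E e) a A D r2) {z : ℂ} (h0 : z ≠ 0) (hdir : 0 ≤ (uu k z).re * A)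
    (s1 : 2 * ‖z‖ < r2) (s2 : 4 * ‖z‖ < r) (s3 : 2 * K * ‖z‖ ≤ 1)
    (s4 : (4 * k * C + K * 2 ^ (k + 1)) * ‖z‖ ≤ η) (s5 : 16 * k * C * ‖z‖ ≤ η)
    {l l' : List ι} (hl : BW τ C l) (hl' : BW τ C l') :
    ‖cw E l z - cw E l' z‖ ≤ 4 * k * |wsum τ l - wsum τ l'| := by
  have hz0 : 0 < ‖z‖ := norm_pos_iff.2 h0
  have hz1 : 2 * ‖z‖ ≤ 1 := by nlinarith
  have hk0 : (0:ℝ) ≤ k := by positivity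
  have hpw : ∀ x : ℝ, 0 < x → x ≤ 1 → x ^ k ≤ x := fun x hx hx1 => by
    calc x ^ k ≤ x ^ 1 := pow_le_pow_of_le_one hx.le hx1 hk
      _ = x := pow_one _
  have W := fun (m : List ι) (hm : BW τ C m) => word_dir hk hη0 hη hcmp hP hK hb hcom hC ha0 hD hpair h0 hdir
    (by linarith) s2 s3 s4 hm
  have W2 : ∀ m, BW τ C m → ‖uu k (cw E m z) - uu k z‖ ≤ 2 * k * C := fun m hm =>
    (W m hm).2.1.trans (by gcongr; exact hm.le hC)
  have W3 : ∀ m, BW τ C m → ‖cw E m z - z‖ ≤ η / 4 * ‖z‖ := fun m hm => by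
    obtain ⟨h1, -, -⟩ := W m hm
    have h3 := (hcmp _ _ h0 h1).2
    have h4 : 2 * ‖z‖ ^ (k + 1) * ‖uu k (cw E m z) - uu k z‖ ≤ 2 * (‖z‖ * ‖z‖) * (2 * k * C) := by
      gcongr
      · rw [pow_succ]; gcongr; exact hpw _ hz0 (by linarith)
      · exact W2 m hm
    have h5 : 16 * k * C * ‖z‖ * ‖z‖ ≤ η * ‖z‖ := by gcongr
    linarith
  obtain ⟨i1, -, i3⟩ := W l hl
  obtain ⟨j1, -, j3⟩ := W l' hl'
  have i2 := W2 l hl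
  have j2 := W2 l' hl'
  have i4 := W3 l hl
  have j4 := W3 l' hl'
  set ζ := cw E l z with hζ
  set ζ' := cw E l' z with hζ'
  have ζ0 : ζ ≠ 0 := (hcmp _ _ h0 i1).1
  have hζp : 0 < ‖ζ‖ := norm_pos_iff.2 ζ0
  have n1 : ‖ζ‖ ≤ ‖ζ - z‖ + ‖z‖ := by
    have := norm_add_le (ζ - z) z; simpa using this
  have n2 : ‖z‖ ≤ ‖ζ‖ + ‖ζ - z‖ := by
    have := norm_sub_le ζ (ζ - z); simpa using this
  have m1 : ‖ζ‖ ≤ 2 * ‖z‖ := by nlinarith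
  have m2 : ‖z‖ ≤ 2 * ‖ζ‖ := by nlinarith
  have hd : ‖ζ' - ζ‖ ≤ η * ‖ζ‖ := by
    have h1 : ‖ζ' - ζ‖ ≤ ‖ζ' - z‖ + ‖z - ζ‖ := norm_sub_le_norm_sub_add_norm_sub _ _ _
    rw [norm_sub_rev z ζ] at h1
    have : η / 4 * ‖z‖ ≤ η / 4 * (2 * ‖ζ‖) := by gcongr
    linarith
  have hu : ‖uu k ζ' - uu k ζ‖ ≤ D := by
    have h1 : ‖uu k ζ' - uu k ζ‖ ≤ ‖uu k ζ' - uu k z‖ + ‖uu k z - uu k ζ‖ :=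
      norm_sub_le_norm_sub_add_norm_sub _ _ _
    rw [norm_sub_rev (uu k z)] at h1
    have hb0 : 0 ≤ b := (abs_nonneg _).trans (hb e)
    rw [hD]; nlinarith [mul_nonneg hk0 hb0]
  have hζ1 : ‖ζ‖ ≤ 1 := by linarith
  have hdirζ : -(1 / 4) * ‖uu k ζ‖ * a ≤ (uu k ζ).re * A := by
    have h1 : 8 * k * C ≤ ‖uu k ζ‖ := by
      rw [uu_norm, ← one_div, le_div_iff₀ (by positivity)]
      have h2 : ‖ζ‖ ^ k ≤ 2 * ‖z‖ := (hpw _ hζp hζ1).trans m1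
      have : 8 * k * C * ‖ζ‖ ^ k ≤ 8 * k * C * (2 * ‖z‖) := by gcongr
      linarith
    have h2 : |((uu k ζ).re - (uu k z).re) * A| ≤ 2 * k * C * a := by
      rw [abs_mul, ← haA]
      gcongr
      have := Complex.abs_re_le_norm (uu k ζ - uu k z)
      rw [Complex.sub_re] at this
      exact this.trans i2
    have h3 := neg_le_of_abs_le h2
    have h4 : 8 * k * C * a ≤ ‖uu k ζ‖ * a := by gcongr
    nlinarith
  obtain ⟨q1, -, -⟩ := hpair ζ ζ' ζ0 (by linarith) hdirζ hd hu
  have hlim := ((j3.sub i3).sub_const (uu k ζ' - uu k ζ)).norm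
  have hle := le_of_tendsto' hlim (fun n => by
    have := (q1 n).2.2.2.2
    rwa [show uu k ((E e)^[n] ζ') - uu k ((E e)^[n] z) - (uu k ((E e)^[n] ζ) - uu k ((E e)^[n] z))
      - (uu k ζ' - uu k ζ) = uu k ((E e)^[n] ζ') - uu k ((E e)^[n] ζ) - (uu k ζ' - uu k ζ) by ring])
  set v : ℂ := -(k * wsum τ l' : ℝ) - -(k * wsum τ l : ℝ) with hv
  have hvn : ‖v‖ = k * |wsum τ l - wsum τ l'| := by
    have : v = ((k * (wsum τ l - wsum τ l') : ℝ) : ℂ) := by rw [hv]; push_cast; ring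
    rw [this, Complex.norm_real, Real.norm_eq_abs, abs_mul, Nat.abs_cast]
  have h3 : ‖uu k ζ' - uu k ζ‖ ≤ ‖v‖ + ‖v - (uu k ζ' - uu k ζ)‖ := by
    have := norm_sub_le v (v - (uu k ζ' - uu k ζ))
    simpa using this
  have h4 := (hcmp _ _ ζ0 hd).2
  have h5 : ‖ζ‖ ^ (k + 1) ≤ 1 := pow_le_one₀ hζp.le hζ1
  have h6 : 2 * ‖ζ‖ ^ (k + 1) * ‖uu k ζ' - uu k ζ‖ ≤ 2 * 1 * ‖uu k ζ' - uu k ζ‖ := by gcongr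
  rw [norm_sub_rev]
  linarith

theorem parabolic {ι : Type*} [Finite ι] {k : ℕ} (hk : 1 ≤ k) {E B : ι → ℂ → ℂ} {τ : ι → ℝ}
    (hB : ∀ ℓ, AnalyticAt ℂ (B ℓ) 0)
    (hE : ∀ ℓ, ∀ᶠ z in 𝓝 (0:ℂ), E ℓ z = z + z ^ (k + 1) * B ℓ z) (hτ : ∀ ℓ, B ℓ 0 = τ ℓ)
    {e e' : ι} (he : τ e ≠ 0) (he' : τ e' = - τ e)
    (hcom : ∀ ℓ, ∀ᶠ z in 𝓝 (0:ℂ), E e (E ℓ z) = E ℓ (E e z))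
    (hcom' : ∀ ℓ, ∀ᶠ z in 𝓝 (0:ℂ), E e' (E ℓ z) = E ℓ (E e' z)) : WordConc E τ := by
  obtain ⟨K, r, hK, hr, -, hall⟩ := fin_unif (fun ℓ K r => PEst k (E ℓ) (τ ℓ) K r ∧
      ∀ z, ‖z‖ < r → E e (E ℓ z) = E ℓ (E e z) ∧ E e' (E ℓ z) = E ℓ (E e' z))
    (fun ℓ K r K' r' h hK _ hr => ⟨h.1.mono hK hr, fun z hz => h.2 z (hz.trans_le hr)⟩)
    (fun ℓ => by
      obtain ⟨K, r, hr, h⟩ := pest_exists hk (hB ℓ) (hE ℓ) (hτ ℓ)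
      obtain ⟨r', hr', h'⟩ := Metric.eventually_nhds_iff_ball.1 ((hcom ℓ).and (hcom' ℓ))
      exact ⟨K, min r r', lt_min hr hr', h.mono le_rfl (min_le_left _ _), fun z hz =>
        h' z (by rw [mem_ball_zero_iff]; exact hz.trans_le (min_le_right _ _))⟩)
  have hP : ∀ ℓ, PEst k (E ℓ) (τ ℓ) K r := fun ℓ => (hall ℓ).1
  obtain ⟨b, hb⟩ := Finite.exists_le (fun ℓ => |τ ℓ|)
  have hb0 : 0 ≤ b := (abs_nonneg _).trans (hb e)
  obtain ⟨η, hη0, hη, hcmp⟩ := uu_compare k hk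
  have hkp : (0:ℝ) < k := by exact_mod_cast hk
  intro C hC ρ hρ
  set D := 4 * k * C + k * b + 1 with hD
  have hD0 : 0 ≤ D := by positivity
  have ha0 : 0 < |-(k * τ e)| := abs_pos.2 (neg_ne_zero.2 (mul_ne_zero hkp.ne' he))
  have ha0' : 0 < |-(k * τ e')| := abs_pos.2 (neg_ne_zero.2 (mul_ne_zero hkp.ne' (by
    rw [he']; exact neg_ne_zero.2 he)))
  obtain ⟨r2, hr2, hp⟩ := pair hk hη0 hη hcmp (hP e) hr hK rfl rfl ha0 D hD0
  obtain ⟨r2', hr2', hp'⟩ := pair hk hη0 hη hcmp (hP e') hr hK rfl rfl ha0' D hD0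
  obtain ⟨r3, hr3, hs⟩ := ev_small_exists ((ev_small 2 hr2).and ((ev_small 2 hr2').and
    ((ev_small 4 hr).and ((ev_small (2 * K) one_pos).and
    ((ev_small (4 * k * C + K * 2 ^ (k + 1)) hη0).and ((ev_small (16 * k * C) hη0).and
      (ev_small 2 hρ)))))))
  refine ⟨r3, hr3, 4 * k, ?_⟩
  intro l hl z hz
  by_cases h0 : z = 0
  · have hz0 : ∀ m : List ι, cw E m 0 = 0 := by
      intro m
      induction m with
      | nil => rfl
      | cons ℓ m ih =>
        have := (hP ℓ 0 (by simpa using hr)).1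
        simp only [cw, ih]
        simpa using this
    subst h0
    refine ⟨by rw [hz0]; simpa using hρ, fun l' _ => ?_⟩
    rw [hz0, hz0]; simp; positivity
  obtain ⟨s1, s1', s2, s3, s4, s5, s6⟩ := hs ‖z‖ (norm_nonneg _) hz
  have hz0 : 0 < ‖z‖ := norm_pos_iff.2 h0
  have fin : ‖cw E l z - z‖ ≤ η * ‖z‖ → ‖cw E l z‖ < ρ := by
    intro h
    have n1 : ‖cw E l z‖ ≤ ‖cw E l z - z‖ + ‖z‖ := by
      have := norm_add_le (cw E l z - z) z; simpa using this
    nlinarith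
  by_cases hdir : 0 ≤ (uu k z).re * (-(k * τ e))
  · refine ⟨fin (word_dir hk hη0 hη hcmp hP hK hb (fun ℓ z hz => ((hall ℓ).2 z hz).1) hC ha0 hD hp h0 hdir
      (by linarith) s2 s3.le s4.le hl).1, fun l' hl' => ?_⟩
    exact word_lip hk hη0 hη hcmp hP hK hb (fun ℓ z hz => ((hall ℓ).2 z hz).1) hC rfl ha0 hD hp h0 hdir
      s1 s2 s3.le s4.le s5.le hl hl'
  · have hdir' : 0 ≤ (uu k z).re * (-(k * τ e')) := by
      rw [he']; push Not at hdir; nlinarith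
    refine ⟨fin (word_dir hk hη0 hη hcmp hP hK hb (fun ℓ z hz => ((hall ℓ).2 z hz).2) hC ha0' hD hp' h0 hdir'
      (by linarith) s2 s3.le s4.le hl).1, fun l' hl' => ?_⟩
    exact word_lip hk hη0 hη hcmp hP hK hb (fun ℓ z hz => ((hall ℓ).2 z hz).2) hC rfl ha0' hD hp' h0 hdir'
      s1' s2 s3.le s4.le s5.le hl hl'


/-- uniform estimates of a hyperbolic germ -/
def HEst (E : ℂ → ℂ) (μ K r : ℝ) : Prop :=
  E 0 = 0 ∧ ∀ R ≤ r, ∀ z z' : ℂ, ‖z‖ < R → ‖z'‖ < R →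
    ‖(E z - μ * z) - (E z' - μ * z')‖ ≤ K * R * ‖z - z'‖

theorem HEst.mono {E : ℂ → ℂ} {μ K r K' r' : ℝ} (h : HEst E μ K r) (hK : K ≤ K') 
    (hr : r' ≤ r) : HEst E μ K' r' := by
  refine ⟨h.1, fun R hR z z' hz hz' => (h.2 R (hR.trans hr) z z' hz hz').trans ?_⟩
  have : 0 ≤ R := (norm_nonneg z).trans hz.le
  gcongr

theorem hest_exists {E B : ℂ → ℂ} {μ : ℝ} (hB : AnalyticAt ℂ B 0)
    (hE : ∀ᶠ z in 𝓝 (0:ℂ), E z = z + z * B z) (ht : B 0 = μ - 1) :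
    ∃ K r : ℝ, 0 < r ∧ HEst E μ K r := by
  obtain ⟨K1, s, hs, hlip⟩ := (hB.contDiffAt (n := 1)).exists_lipschitzOnWith
  obtain ⟨r, hr, hall⟩ := Metric.eventually_nhds_iff_ball.1 (hE.and hs)
  refine ⟨2 * K1, r, hr, ?_, ?_⟩
  · have := (hall 0 (by simpa using hr)).1; simpa using this
  intro R hR z z' hz hz'
  have a1 := hall z (by simpa using hz.trans_le hR)
  have a2 := hall z' (by simpa using hz'.trans_le hR)
  have a0 := hall 0 (by simpa using hr)
  have l1 := hlip.dist_le_mul z a1.2 0 a0.2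
  have l2 := hlip.dist_le_mul z a1.2 z' a2.2
  rw [dist_eq_norm, dist_zero_right] at l1
  rw [dist_eq_norm, dist_eq_norm] at l2
  have e : (E z - μ * z) - (E z' - μ * z') = (z - z') * (B z - B 0) + z' * (B z - B z') := by
    rw [a1.1, a2.1, ht]; ring
  rw [e]
  refine (norm_add_le _ _).trans ?_
  rw [norm_mul, norm_mul]
  have h1 : ‖z - z'‖ * ‖B z - B 0‖ ≤ ‖z - z'‖ * (K1 * R) := by
    gcongr; exact l1.trans (by gcongr)
  have hR0 : 0 ≤ R := (norm_nonneg z).trans hz.le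
  have h2 : ‖z'‖ * ‖B z - B z'‖ ≤ R * (K1 * ‖z - z'‖) := by gcongr
  linarith

/-- pair estimate, hyperbolic case -/
def HPair (E : ℂ → ℂ) (lam r2 : ℝ) : Prop :=
  ∀ z z' : ℂ, ‖z‖ < r2 → ‖z'‖ < r2 → ∀ n, ‖E^[n] z‖ < r2 ∧
    ‖E^[n] z - E^[n] z'‖ ≤ 2 * lam ^ n * ‖z - z'‖ ∧
    lam ^ n * ‖z - z'‖ ≤ 2 * ‖E^[n] z - E^[n] z'‖

theorem hpair {E : ℂ → ℂ} {lam K r : ℝ} (hP : HEst E lam K r) (hr : 0 < r) (hK : 1 ≤ K)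
    (h0 : 0 < lam) (h1 : lam < 1) : ∃ r2 > 0, r2 ≤ r ∧ HPair E lam r2 := by
  set q := (1 + lam) / 2 with hq
  have hq0 : 0 < q := by rw [hq]; linarith
  have hq1 : q < 1 := by rw [hq]; linarith
  obtain ⟨r3, hr3, hs⟩ := ev_small_exists ((ev_small 1 hr).and ((ev_small K (d := (1 - lam) / 2) (by linarith)).and
    (ev_small (3 * K) (d := lam * (1 - q)) (mul_pos h0 (by linarith)))))
  obtain ⟨s1, s2, s3⟩ := hs (r3 / 2) (by linarith) (by linarith)
  set r2 := r3 / 2 with hr2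
  have hr20 : 0 < r2 := by rw [hr2]; linarith
  refine ⟨r2, hr20, by linarith, ?_⟩
  have contr : ∀ R, 0 < R → R ≤ r2 → ∀ z, ‖z‖ < R → ‖E z‖ < q * R := by
    intro R hR hRr z hz
    have h2 := hP.2 R (by linarith) z 0 hz (by simpa using hR)
    simp only [hP.1, mul_zero, sub_zero] at h2
    have h3 : ‖E z‖ ≤ ‖E z - lam * z‖ + ‖(lam * z : ℂ)‖ := by
      have := norm_add_le (E z - lam * z) (lam * z); simpa using this
    rw [norm_mul, Complex.norm_real, Real.norm_eq_abs, abs_of_pos h0] at h3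
    have h4 : K * R * ‖z‖ ≤ (1 - lam) / 2 * ‖z‖ := by
      have : K * R ≤ K * r2 := by gcongr
      gcongr; linarith
    have h5 : ‖E z‖ ≤ q * ‖z‖ := by rw [hq]; linarith
    exact h5.trans_lt (by gcongr)
  have orb : ∀ z, ‖z‖ < r2 → ∀ n, ‖E^[n] z‖ < q ^ n * r2 := by
    intro z hz n
    induction n with
    | zero => simpa using hz
    | succ n ih =>
      rw [Function.iterate_succ_apply']
      have hle : q ^ n * r2 ≤ r2 := by
        have := pow_le_one₀ (n := n) hq0.le hq1.le
        nlinarith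
      have := contr _ (by positivity) hle _ ih
      rw [pow_succ]; linarith
  intro z z' hz hz'
  have main : ∀ n, ‖(E^[n] z - E^[n] z') - lam ^ n * (z - z')‖
      ≤ lam ^ n * (3 * K * r2 / (2 * lam) * (∑ i ∈ Finset.range n, q ^ i)) * ‖z - z'‖ ∧
      ‖(E^[n] z - E^[n] z') - lam ^ n * (z - z')‖ ≤ lam ^ n * (1 / 2) * ‖z - z'‖ := by
    have sm : ∀ n, 3 * K * r2 / (2 * lam) * (∑ i ∈ Finset.range n, q ^ i) ≤ 1 / 2 := by
      intro n
      have h3 : (∑ i ∈ Finset.range n, q ^ i) * (1 - q) ≤ 1 := by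
        rw [geom_sum_mul_neg]
        have : 0 ≤ q ^ n := by positivity
        linarith
      have h4 : 3 * K * r2 / (2 * lam) ≤ (1 - q) / 2 := by
        rw [div_le_div_iff₀ (by positivity) (by norm_num)]
        nlinarith
      have h5 : 0 ≤ ∑ i ∈ Finset.range n, q ^ i := Finset.sum_nonneg (fun i _ => by positivity)
      have : 3 * K * r2 / (2 * lam) * (∑ i ∈ Finset.range n, q ^ i) ≤ (1 - q) / 2 * (∑ i ∈ Finset.range n, q ^ i) := by gcongr
      linarith
    have sm' : ∀ n, lam ^ n * (3 * K * r2 / (2 * lam) * (∑ i ∈ Finset.range n, q ^ i)) * ‖z - z'‖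
        ≤ lam ^ n * (1 / 2) * ‖z - z'‖ := fun n => by gcongr; exact sm n
    intro n
    refine (fun h => ⟨h, h.trans (sm' n)⟩) ?_
    induction n with
    | zero => simp
    | succ n ih =>
      rw [Function.iterate_succ_apply', Function.iterate_succ_apply']
      have o1 := orb z hz n
      have o2 := orb z' hz' n
      set w := E^[n] z
      set w' := E^[n] z'
      have hle : q ^ n * r2 ≤ r2 := by
        have := pow_le_one₀ (n := n) hq0.le hq1.le
        nlinarith
      have h3 := hP.2 (q ^ n * r2) (by linarith) w w' o1 o2
      have ih' := ih.trans (sm' n)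
      have h4 : ‖w - w'‖ ≤ 3 / 2 * (lam ^ n * ‖z - z'‖) := by
        have : ‖w - w'‖ ≤ ‖w - w' - lam ^ n * (z - z')‖ + ‖(lam ^ n * (z - z') : ℂ)‖ := by
          have := norm_add_le (w - w' - lam ^ n * (z - z')) (lam ^ n * (z - z') : ℂ); simpa using this
        rw [norm_mul, norm_pow, Complex.norm_real, Real.norm_eq_abs, abs_of_pos h0] at this
        linarith
      have e : E w - E w' - lam ^ (n + 1) * (z - z') = lam * (w - w' - lam ^ n * (z - z'))
          + ((E w - lam * w) - (E w' - lam * w')) := by ring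
      rw [e]
      refine (norm_add_le _ _).trans ?_
      rw [norm_mul, Complex.norm_real, Real.norm_eq_abs, abs_of_pos h0, Finset.sum_range_succ]
      have h5 : K * (q ^ n * r2) * ‖w - w'‖ ≤ K * (q ^ n * r2) * (3 / 2 * (lam ^ n * ‖z - z'‖)) := by gcongr
      have h6 : lam * ‖w - w' - lam ^ n * (z - z')‖ ≤ lam * (lam ^ n * (3 * K * r2 / (2 * lam) * (∑ i ∈ Finset.range n, q ^ i)) * ‖z - z'‖) := by gcongr
      have e2 : lam ^ (n + 1) * (3 * K * r2 / (2 * lam) * (∑ i ∈ Finset.range n, q ^ i + q ^ n)) * ‖z - z'‖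
          = lam * (lam ^ n * (3 * K * r2 / (2 * lam) * (∑ i ∈ Finset.range n, q ^ i)) * ‖z - z'‖)
          + K * (q ^ n * r2) * (3 / 2 * (lam ^ n * ‖z - z'‖)) := by
        field_simp
        ring
      linarith
  intro n
  have hm := (main n).2
  have hle : q ^ n * r2 ≤ r2 := by
    have := pow_le_one₀ (n := n) hq0.le hq1.le
    nlinarith
  have hnn : ‖(lam ^ n * (z - z') : ℂ)‖ = lam ^ n * ‖z - z'‖ := by
    rw [norm_mul, norm_pow, Complex.norm_real, Real.norm_eq_abs, abs_of_pos h0]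
  set X := E^[n] z - E^[n] z'
  have a1 : ‖X‖ ≤ ‖X - lam ^ n * (z - z')‖ + ‖(lam ^ n * (z - z') : ℂ)‖ := by
    have := norm_add_le (X - lam ^ n * (z - z')) (lam ^ n * (z - z') : ℂ); simpa using this
  have a2 : ‖(lam ^ n * (z - z') : ℂ)‖ ≤ ‖X‖ + ‖X - lam ^ n * (z - z')‖ := by
    have := norm_sub_le X (X - lam ^ n * (z - z')); simpa using this
  have : 0 ≤ lam ^ n * ‖z - z'‖ := by positivity
  refine ⟨(orb z hz n).trans_le hle, by linarith, by linarith⟩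


theorem HEst.quad {E : ℂ → ℂ} {μ K r : ℝ} (h : HEst E μ K r) {w : ℂ}
    (hw : ‖w‖ < r / 2) : ‖E w - μ * w‖ ≤ 2 * K * ‖w‖ ^ 2 := by
  by_cases h0 : w = 0
  · subst h0; simp [h.1]
  have hp : 0 < ‖w‖ := norm_pos_iff.2 h0
  have := h.2 (2 * ‖w‖) (by linarith) w 0 (by linarith) (by simpa using hp)
  simp only [h.1, mul_zero, sub_zero] at this
  nlinarith

theorem exp_lip {C a b : ℝ} (ha : |a| ≤ C) (hb : |b| ≤ C) :
    |Real.exp a - Real.exp b| ≤ Real.exp C * |a - b| := by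
  have := Convex.norm_image_sub_le_of_norm_deriv_le (𝕜 := ℝ) (f := Real.exp) (s := Icc (-C) C) (C := Real.exp C)
    (fun x _ => Real.differentiableAt_exp)
    (fun x hx => by rw [Real.deriv_exp, Real.norm_eq_abs, abs_of_pos (Real.exp_pos _)]; exact Real.exp_le_exp.2 hx.2)
    (convex_Icc _ _) (abs_le.1 hb) (abs_le.1 ha)
  simpa using this

theorem hyperbolic {ι : Type*} [Finite ι] {E B : ι → ℂ → ℂ} {τ : ι → ℝ}
    (hB : ∀ ℓ, AnalyticAt ℂ (B ℓ) 0)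
    (hE : ∀ ℓ, ∀ᶠ z in 𝓝 (0:ℂ), E ℓ z = z + z * B ℓ z)
    (hτ : ∀ ℓ, B ℓ 0 = (Real.exp (τ ℓ) : ℝ) - 1)
    {e : ι} (he : τ e < 0)
    (hcom : ∀ ℓ, ∀ᶠ z in 𝓝 (0:ℂ), E e (E ℓ z) = E ℓ (E e z)) : WordConc E τ := by
  obtain ⟨K, r, hK, hr, hr1, hall⟩ := fin_unif (fun ℓ K r => HEst (E ℓ) (Real.exp (τ ℓ)) K r ∧
      ∀ z, ‖z‖ < r → E e (E ℓ z) = E ℓ (E e z))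
    (fun ℓ K r K' r' h hK _ hr => ⟨h.1.mono hK hr, fun z hz => h.2 z (hz.trans_le hr)⟩)
    (fun ℓ => by
      obtain ⟨K, r, hr, h⟩ := hest_exists (hB ℓ) (hE ℓ) (hτ ℓ)
      obtain ⟨r', hr', h'⟩ := Metric.eventually_nhds_iff_ball.1 (hcom ℓ)
      exact ⟨K, min r r', lt_min hr hr', h.mono le_rfl (min_le_left _ _), fun z hz =>
        h' z (by rw [mem_ball_zero_iff]; exact hz.trans_le (min_le_right _ _))⟩)
  obtain ⟨N, hN⟩ := Finite.exists_le (fun ℓ => Real.exp (τ ℓ))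
  have hN0 : 0 < N := (Real.exp_pos _).trans_le (hN e)
  set lam := Real.exp (τ e) with hlam
  have l0 : 0 < lam := Real.exp_pos _
  have l1 : lam < 1 := by rw [hlam]; simpa using he
  obtain ⟨r2, hr2, hr2r, hp⟩ := hpair (r := r / 2) ((hall e).1.mono le_rfl (by linarith)) (by linarith) hK l0 l1
  have hF0 : ∀ n, (E e)^[n] 0 = 0 := fun n => Function.iterate_fixed (hall e).1.1 n
  have up : ∀ z, ‖z‖ < r2 → ∀ n, ‖(E e)^[n] z‖ ≤ 2 * lam ^ n * ‖z‖ := fun z hz n => by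
    have := (hp z 0 hz (by simpa using hr2) n).2.1
    simpa [hF0] using this
  intro C hC ρ hρ
  set M := 4 * Real.exp C with hM
  have hM0 : 0 < M := by positivity
  obtain ⟨r3, hr3, hs⟩ := ev_small_exists ((ev_small M hr2).and ((ev_small ((N + 2 * K) * M) hr2).and
    ((ev_small M hρ).and (ev_small 1 hr2))))
  have key : ∀ z, ‖z‖ < r3 → ∀ l, BW τ C l → ‖cw E l z‖ ≤ M * ‖z‖ ∧
      Tendsto (fun n => ‖(E e)^[n] (cw E l z) - Real.exp (wsum τ l) * (E e)^[n] z‖ / lam ^ n) atTop (𝓝 0) := by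
    intro z hz l
    obtain ⟨s1, s2, s3, s4⟩ := hs ‖z‖ (norm_nonneg _) hz
    have s4' : ‖z‖ < r2 := by linarith
    induction l with
    | nil =>
      intro _
      refine ⟨?_, by simp [cw, wsum_nil]⟩
      have : 1 ≤ Real.exp C := Real.one_le_exp hC
      simp only [cw]
      nlinarith [norm_nonneg z]
    | cons ℓ l ih =>
      intro hl
      obtain ⟨i1, i2⟩ := ih hl.1
      set ζ := cw E l z with hζ
      have z2 : ‖ζ‖ < r2 := i1.trans_lt s1
      have q := (hall ℓ).1.quad (w := ζ) (by linarith)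
      have z3 : ‖E ℓ ζ‖ < r2 := by
        have a1 : ‖E ℓ ζ‖ ≤ ‖E ℓ ζ - Real.exp (τ ℓ) * ζ‖ + ‖(Real.exp (τ ℓ) * ζ : ℂ)‖ := by
          have := norm_add_le (E ℓ ζ - Real.exp (τ ℓ) * ζ) (Real.exp (τ ℓ) * ζ); simpa using this
        rw [norm_mul, Complex.norm_real, Real.norm_eq_abs, abs_of_pos (Real.exp_pos _)] at a1
        have a2 : Real.exp (τ ℓ) * ‖ζ‖ ≤ N * ‖ζ‖ := by gcongr; exact hN ℓ
        have a3 : 2 * K * ‖ζ‖ ^ 2 ≤ 2 * K * ‖ζ‖ := by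
          have : ‖ζ‖ ^ 2 ≤ ‖ζ‖ := by nlinarith [norm_nonneg ζ]
          gcongr
        have a4 : (N + 2 * K) * ‖ζ‖ ≤ (N + 2 * K) * (M * ‖z‖) := by gcongr
        linarith
      have itc : ∀ n, (E e)^[n] (E ℓ ζ) = E ℓ ((E e)^[n] ζ) := fun n =>
        iter_comm (r := r) (hall ℓ).2 (fun n => by
          have := (hp ζ ζ z2 z2 n).1; linarith) n
      have lim : Tendsto (fun n => ‖(E e)^[n] (E ℓ ζ) - Real.exp (wsum τ (ℓ :: l)) * (E e)^[n] z‖ / lam ^ n)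
          atTop (𝓝 0) := by
        have hb : Tendsto (fun n => 8 * K * ‖ζ‖ ^ 2 * lam ^ n + Real.exp (τ ℓ) *
            (‖(E e)^[n] ζ - Real.exp (wsum τ l) * (E e)^[n] z‖ / lam ^ n)) atTop (𝓝 0) := by
          have := ((tendsto_pow_atTop_nhds_zero_of_lt_one l0.le l1).const_mul (8 * K * ‖ζ‖ ^ 2)).add
            (i2.const_mul (Real.exp (τ ℓ)))
          simpa using this
        refine squeeze_zero (fun n => by positivity) (fun n => ?_) hb
        rw [itc]
        set w := (E e)^[n] ζ with hw
        have w1 : ‖w‖ < r2 := (hp ζ ζ z2 z2 n).1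
        have w2 : ‖w‖ ≤ 2 * lam ^ n * ‖ζ‖ := up ζ z2 n
        have w3 := (hall ℓ).1.quad (w := w) (by linarith)
        have e1 : E ℓ w - Real.exp (wsum τ (ℓ :: l)) * (E e)^[n] z = (E ℓ w - Real.exp (τ ℓ) * w)
            + Real.exp (τ ℓ) * (w - Real.exp (wsum τ l) * (E e)^[n] z) := by
          rw [wsum_cons, Real.exp_add]; push_cast; ring
        rw [e1, div_le_iff₀ (by positivity)]
        refine (norm_add_le _ _).trans ?_
        rw [norm_mul, Complex.norm_real, Real.norm_eq_abs, abs_of_pos (Real.exp_pos _)]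
        have w4 : 2 * K * ‖w‖ ^ 2 ≤ 2 * K * (2 * lam ^ n * ‖ζ‖) ^ 2 := by gcongr
        have e2 : (8 * K * ‖ζ‖ ^ 2 * lam ^ n + Real.exp (τ ℓ) *
            (‖w - Real.exp (wsum τ l) * (E e)^[n] z‖ / lam ^ n)) * lam ^ n = 2 * K * (2 * lam ^ n * ‖ζ‖) ^ 2
            + Real.exp (τ ℓ) * ‖w - Real.exp (wsum τ l) * (E e)^[n] z‖ := by
          field_simp; ring
        rw [e2]; linarith
      refine ⟨?_, lim⟩
      have hlim2 : Tendsto (fun n => 2 * (‖(E e)^[n] (E ℓ ζ) - Real.exp (wsum τ (ℓ :: l)) * (E e)^[n] z‖ / lam ^ n)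
          + M * ‖z‖) atTop (𝓝 (M * ‖z‖)) := by
        have := (lim.const_mul 2).add_const (M * ‖z‖)
        simpa using this
      refine ge_of_tendsto' hlim2 (fun n => ?_)
      have b1 := (hp (E ℓ ζ) 0 z3 (by simpa using hr2) n).2.2
      rw [hF0, sub_zero, sub_zero] at b1
      have b2 := up z s4' n
      set X := (E e)^[n] (E ℓ ζ)
      set Y := (E e)^[n] z
      have b3 : ‖X‖ ≤ ‖X - Real.exp (wsum τ (ℓ :: l)) * Y‖ + Real.exp (wsum τ (ℓ :: l)) * ‖Y‖ := by
        have := norm_add_le (X - Real.exp (wsum τ (ℓ :: l)) * Y) (Real.exp (wsum τ (ℓ :: l)) * Y)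
        rw [norm_mul, Complex.norm_real, Real.norm_eq_abs, abs_of_pos (Real.exp_pos _)] at this
        simpa using this
      have b4 : Real.exp (wsum τ (ℓ :: l)) * ‖Y‖ ≤ Real.exp C * (2 * lam ^ n * ‖z‖) := by
        gcongr; exact (abs_le.1 hl.2).2
      show ‖E ℓ ζ‖ ≤ _
      have pl : 0 < lam ^ n := by positivity
      have e3 : (2 * (‖X - Real.exp (wsum τ (ℓ :: l)) * Y‖ / lam ^ n) + M * ‖z‖) * lam ^ n =
        2 * ‖X - Real.exp (wsum τ (ℓ :: l)) * Y‖ + 4 * Real.exp C * lam ^ n * ‖z‖ := by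
        rw [hM]; field_simp
      refine le_of_mul_le_mul_right ?_ pl
      rw [e3]; linarith
  refine ⟨r3, hr3, 4 * Real.exp C * r2, fun l hl z hz => ?_⟩
  obtain ⟨s1, s2, s3, s4⟩ := hs ‖z‖ (norm_nonneg _) hz
  obtain ⟨k1, k2⟩ := key z hz l hl
  refine ⟨k1.trans_lt s3, fun l' hl' => ?_⟩
  obtain ⟨k1', k2'⟩ := key z hz l' hl'
  set ζ := cw E l z
  set ζ' := cw E l' z
  have hlim : Tendsto (fun n => 2 * (‖(E e)^[n] ζ - Real.exp (wsum τ l) * (E e)^[n] z‖ / lam ^ n) +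
      2 * (‖(E e)^[n] ζ' - Real.exp (wsum τ l') * (E e)^[n] z‖ / lam ^ n) + 
      4 * Real.exp C * r2 * |wsum τ l - wsum τ l'|) atTop (𝓝 (4 * Real.exp C * r2 * |wsum τ l - wsum τ l'|)) := by
    have := ((k2.const_mul 2).add (k2'.const_mul 2)).add_const (4 * Real.exp C * r2 * |wsum τ l - wsum τ l'|)
    simpa using this
  refine ge_of_tendsto' hlim (fun n => ?_)
  have pl : 0 < lam ^ n := by positivity
  have b1 := (hp ζ ζ' (k1.trans_lt s1) (k1'.trans_lt s1) n).2.2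
  have s4' : ‖z‖ < r2 := by linarith
  have b2 := up z s4' n
  set X := (E e)^[n] ζ
  set X' := (E e)^[n] ζ'
  set Y := (E e)^[n] z
  have b3 : ‖X - X'‖ ≤ ‖X - Real.exp (wsum τ l) * Y‖ + ‖X' - Real.exp (wsum τ l') * Y‖ + 
      |Real.exp (wsum τ l) - Real.exp (wsum τ l')| * ‖Y‖ := by
    have e1 : X - X' = (X - Real.exp (wsum τ l) * Y) - (X' - Real.exp (wsum τ l') * Y) +
      ((Real.exp (wsum τ l) - Real.exp (wsum τ l') : ℝ) : ℂ) * Y := by push_cast; ring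
    rw [e1]
    refine (norm_add_le _ _).trans ?_
    rw [norm_mul, Complex.norm_real, Real.norm_eq_abs]
    gcongr
    exact norm_sub_le _ _
  have b4 := exp_lip (hl.le hC) (hl'.le hC)
  have b5 : |Real.exp (wsum τ l) - Real.exp (wsum τ l')| * ‖Y‖ ≤ 
    (Real.exp C * |wsum τ l - wsum τ l'|) * (2 * lam ^ n * r2) := by
    gcongr
    exact b2.trans (by gcongr)
  refine le_of_mul_le_mul_right ?_ pl
  have e3 : (2 * (‖X - Real.exp (wsum τ l) * Y‖ / lam ^ n) + 2 * (‖X' - Real.exp (wsum τ l') * Y‖ / lam ^ n) + 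
      4 * Real.exp C * r2 * |wsum τ l - wsum τ l'|) * lam ^ n = 2 * ‖X - Real.exp (wsum τ l) * Y‖ + 
      2 * ‖X' - Real.exp (wsum τ l') * Y‖ + 4 * Real.exp C * r2 * |wsum τ l - wsum τ l'| * lam ^ n := by
    field_simp
  rw [e3]; linarith


/-- a finite symmetric commuting system of diffeomorphisms -/
structure LSys (ι : Type) where
  a : ι → AnDiffeo
  flip : ι → ι
  comm : ∀ ℓ ℓ', ∀ x ∈ Icc (0:ℝ) 1, (a ℓ).toFun ((a ℓ').toFun x) = (a ℓ').toFun ((a ℓ).toFun x)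
  inv : ∀ ℓ, ∀ x ∈ Icc (0:ℝ) 1, (a (flip ℓ)).toFun ((a ℓ).toFun x) = x
  flip_flip : ∀ ℓ, flip (flip ℓ) = ℓ

/-- the diffeomorphism of a word -/
def LSys.wd {ι : Type} (S : LSys ι) : List ι → AnDiffeo
  | [] => AnDiffeo.one
  | ℓ :: l => (S.a ℓ).mul (S.wd l)

theorem LSys.wd_nil {ι : Type} (S : LSys ι) (x : ℝ) : (S.wd []).toFun x = x := rfl
theorem LSys.wd_cons {ι : Type} (S : LSys ι) (ℓ : ι) (l : List ι) (x : ℝ) :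
    (S.wd (ℓ :: l)).toFun x = (S.a ℓ).toFun ((S.wd l).toFun x) := rfl

theorem LSys.wd_comm {ι : Type} (S : LSys ι) (ℓ : ι) (l : List ι) {x : ℝ} (hx : x ∈ Icc (0:ℝ) 1) :
    (S.a ℓ).toFun ((S.wd l).toFun x) = (S.wd l).toFun ((S.a ℓ).toFun x) := by
  induction l with
  | nil => rfl
  | cons k l ih =>
    rw [S.wd_cons, S.wd_cons, S.comm _ _ _ ((S.wd l).mapsTo hx), ih]

theorem LSys.wd_append {ι : Type} (S : LSys ι) (l l' : List ι) (x : ℝ) :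
    (S.wd (l ++ l')).toFun x = (S.wd l).toFun ((S.wd l').toFun x) := by
  induction l with
  | nil => rfl
  | cons k l ih => rw [List.cons_append, S.wd_cons, S.wd_cons, ih]

theorem LSys.wd_perm {ι : Type} (S : LSys ι) {l l' : List ι} (h : l.Perm l') :
    ∀ x ∈ Icc (0:ℝ) 1, (S.wd l).toFun x = (S.wd l').toFun x := by
  induction h with
  | nil => intro x _; rfl
  | cons ℓ _ ih => intro x hx; rw [S.wd_cons, S.wd_cons, ih x hx]
  | swap ℓ k l => intro x hx; exact S.comm _ _ _ ((S.wd l).mapsTo hx)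
  | trans _ _ h1 h2 => intro x hx; rw [h1 x hx, h2 x hx]

theorem iter_mapsTo (f : AnDiffeo) {x : ℝ} (hx : x ∈ Icc (0:ℝ) 1) (n : ℕ) : f.toFun^[n] x ∈ Icc (0:ℝ) 1 := by
  induction n with
  | zero => exact hx
  | succ n ih => rw [Function.iterate_succ_apply']; exact f.mapsTo ih

theorem lim_fixed (f : AnDiffeo) {x p : ℝ} (hp : p ∈ Icc (0:ℝ) 1)
    (h : Tendsto (fun n => f.toFun^[n] x) atTop (𝓝 p)) : f.toFun p = p := by
  have h1 := (f.continuousAt hp).tendsto.comp h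
  have h2 := h.comp (tendsto_add_atTop_nat 1)
  refine tendsto_nhds_unique h1 (h2.congr fun n => ?_)
  simp [Function.iterate_succ_apply']

theorem orbit_up (f : AnDiffeo) {x : ℝ} (hx : x ∈ Icc (0:ℝ) 1) (h : x < f.toFun x) :
    ∃ p ∈ Icc (0:ℝ) 1, x < p ∧ f.toFun p = p ∧ Tendsto (fun n => f.toFun^[n] x) atTop (𝓝 p) ∧
      (∀ n, f.toFun^[n] x < p) ∧ ∀ q ∈ Icc (0:ℝ) 1, f.toFun q = q → x < q → p ≤ q := by
  have hm : StrictMono (fun n => f.toFun^[n] x) := by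
    refine strictMono_nat_of_lt_succ (fun n => ?_)
    induction n with
    | zero => exact h
    | succ n ih =>
      rw [Function.iterate_succ_apply', Function.iterate_succ_apply' (n := n + 1)]
      exact f.strictMono (iter_mapsTo f hx n) (iter_mapsTo f hx (n + 1)) ih
  have hb : BddAbove (range (fun n => f.toFun^[n] x)) := ⟨1, by rintro _ ⟨n, rfl⟩; exact (iter_mapsTo f hx n).2⟩
  have ht := tendsto_atTop_ciSup hm.monotone hb
  set p := ⨆ n, f.toFun^[n] x with hp
  have hlt : ∀ n, f.toFun^[n] x < p := fun n => (hm (Nat.lt_succ_self n)).trans_le (le_ciSup hb (n+1))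
  have hpI : p ∈ Icc (0:ℝ) 1 := isClosed_Icc.mem_of_tendsto ht (Eventually.of_forall (iter_mapsTo f hx))
  refine ⟨p, hpI, hlt 0, lim_fixed f hpI ht, ht, hlt, fun q hq hfq hxq => ?_⟩
  refine le_of_tendsto' ht (fun n => ?_)
  induction n with
  | zero => exact hxq.le
  | succ n ih =>
    rw [Function.iterate_succ_apply', ← hfq]
    exact f.strictMono.monotoneOn (iter_mapsTo f hx n) hq ih

theorem orbit_down (f : AnDiffeo) {x : ℝ} (hx : x ∈ Icc (0:ℝ) 1) (h : f.toFun x < x) :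
    ∃ p ∈ Icc (0:ℝ) 1, p < x ∧ f.toFun p = p ∧ Tendsto (fun n => f.toFun^[n] x) atTop (𝓝 p) ∧
      (∀ n, p < f.toFun^[n] x) ∧ ∀ q ∈ Icc (0:ℝ) 1, f.toFun q = q → q < x → q ≤ p := by
  have hm : StrictAnti (fun n => f.toFun^[n] x) := by
    refine strictAnti_nat_of_succ_lt (fun n => ?_)
    induction n with
    | zero => exact h
    | succ n ih =>
      simp only [Function.iterate_succ_apply'] at ih ⊢
      exact f.strictMono (f.mapsTo (iter_mapsTo f hx n)) (iter_mapsTo f hx n) ih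
  have hb : BddBelow (range (fun n => f.toFun^[n] x)) := ⟨0, by rintro _ ⟨n, rfl⟩; exact (iter_mapsTo f hx n).1⟩
  have ht := tendsto_atTop_ciInf hm.antitone hb
  set p := ⨅ n, f.toFun^[n] x with hp
  have hlt : ∀ n, p < f.toFun^[n] x := fun n => (ciInf_le hb (n+1)).trans_lt (hm (Nat.lt_succ_self n))
  have hpI : p ∈ Icc (0:ℝ) 1 := isClosed_Icc.mem_of_tendsto ht (Eventually.of_forall (iter_mapsTo f hx))
  refine ⟨p, hpI, hlt 0, lim_fixed f hpI ht, ht, hlt, fun q hq hfq hxq => ?_⟩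
  refine ge_of_tendsto' ht (fun n => ?_)
  induction n with
  | zero => exact hxq.le
  | succ n ih =>
    rw [Function.iterate_succ_apply', ← hfq]
    exact f.strictMono.monotoneOn hq (iter_mapsTo f hx n) ih

theorem id_of_freq (g : AnDiffeo) {q : ℝ} (hq : q ∈ Icc (0:ℝ) 1) (h : ∃ᶠ y in 𝓝[≠] q, g.toFun y = y) :
    ∀ y ∈ Icc (0:ℝ) 1, g.toFun y = y :=
  g.analytic.eqOn_of_preconnected_of_frequently_eq (g := fun y => y) (fun _ _ => analyticAt_id)
    isPreconnected_Icc hq h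

theorem orbit_lim (f : AnDiffeo) {x : ℝ} (hx : x ∈ Icc (0:ℝ) 1) (h : f.toFun x ≠ x) :
    ∃ p ∈ Icc (0:ℝ) 1, f.toFun p = p ∧ Tendsto (fun n => f.toFun^[n] x) atTop (𝓝 p) ∧
      ∀ n, 0 < (f.toFun^[n] x - p) * (x - p) := by
  rcases lt_or_gt_of_ne h with h | h
  · obtain ⟨p, hp, h1, h2, h3, h4, -⟩ := orbit_down f hx h
    exact ⟨p, hp, h2, h3, fun n => mul_pos (by linarith [h4 n]) (by linarith)⟩
  · obtain ⟨p, hp, h1, h2, h3, h4, -⟩ := orbit_up f hx h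
    exact ⟨p, hp, h2, h3, fun n => mul_pos_of_neg_of_neg (by linarith [h4 n]) (by linarith)⟩

theorem fix_comm {f g : AnDiffeo} (hc : ∀ x ∈ Icc (0:ℝ) 1, f.toFun (g.toFun x) = g.toFun (f.toFun x))
    {x : ℝ} (hx : x ∈ Icc (0:ℝ) 1) (hf : f.toFun x ≠ x) (hg : g.toFun x = x) :
    ∀ y ∈ Icc (0:ℝ) 1, g.toFun y = y := by
  obtain ⟨p, hp, -, h2, h3⟩ := orbit_lim f hx hf
  refine id_of_freq g hp ?_
  have ht : Tendsto (fun n => f.toFun^[n] x) atTop (𝓝[≠] p) :=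
    tendsto_nhdsWithin_iff.2 ⟨h2, Eventually.of_forall fun n hn => by
      have := h3 n; simp only [mem_singleton_iff] at hn; rw [hn] at this; simp at this⟩
  refine ht.frequently (Frequently.of_forall fun n => ?_)
  induction n with
  | zero => exact hg
  | succ n ih => rw [Function.iterate_succ_apply', ← hc _ (iter_mapsTo f hx n), ih]

theorem fix_finite (f : AnDiffeo) (h : ¬ ∀ y ∈ Icc (0:ℝ) 1, f.toFun y = y) :
    {x | x ∈ Icc (0:ℝ) 1 ∧ f.toFun x = x}.Finite := by
  by_contra hinf
  obtain ⟨q, hq, hacc⟩ := Set.Infinite.exists_accPt_of_subset_isCompact hinf isCompact_Icc (fun x hx => hx.1)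
  refine h (id_of_freq f hq ?_)
  rw [accPt_iff_frequently_nhdsNE] at hacc
  exact hacc.mono fun y hy => hy.2


theorem freqIcc {p : ℝ} (hp : p ∈ Icc (0:ℝ) 1) : ∃ᶠ y in 𝓝[≠] (0:ℝ), p + y ∈ Icc (0:ℝ) 1 := by
  by_cases h : p < 1
  · have h1 : ∀ᶠ y in 𝓝[>] (0:ℝ), p + y ∈ Icc (0:ℝ) 1 := by
      have : ∀ᶠ y in 𝓝[>] (0:ℝ), y ∈ Ioo (0:ℝ) (1 - p) := Ioo_mem_nhdsGT (by linarith)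
      filter_upwards [this] with y hy
      exact ⟨by linarith [hp.1, hy.1], by linarith [hy.2]⟩
    exact h1.frequently.filter_mono (nhdsWithin_mono _ (fun y hy => ne_of_gt hy))
  · have h1 : ∀ᶠ y in 𝓝[<] (0:ℝ), p + y ∈ Icc (0:ℝ) 1 := by
      have : ∀ᶠ y in 𝓝[<] (0:ℝ), y ∈ Ioo (-1:ℝ) 0 := Ioo_mem_nhdsLT (by linarith)
      filter_upwards [this] with y hy
      exact ⟨by linarith [hy.1], by linarith [hy.2, hp.2]⟩
    exact h1.frequently.filter_mono (nhdsWithin_mono _ (fun y hy => ne_of_lt hy))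

theorem tendsto_ofReal_ne : Tendsto (fun y : ℝ => (y:ℂ)) (𝓝[≠] 0) (𝓝[≠] 0) := by
  refine tendsto_nhdsWithin_iff.2 ⟨?_, ?_⟩
  · have : Tendsto (fun y : ℝ => (y:ℂ)) (𝓝 0) (𝓝 ((0:ℝ):ℂ)) := Complex.continuous_ofReal.tendsto 0
    simpa using this.mono_left nhdsWithin_le_nhds
  · filter_upwards [self_mem_nhdsWithin] with y hy
    simpa using hy

theorem real_ident {F G : ℂ → ℂ} (hF : AnalyticAt ℂ F 0) (hG : AnalyticAt ℂ G 0) {p : ℝ}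
    (hp : p ∈ Icc (0:ℝ) 1) (h : ∀ᶠ y : ℝ in 𝓝 0, p + y ∈ Icc (0:ℝ) 1 → F y = G y) :
    ∀ᶠ z in 𝓝 (0:ℂ), F z = G z := by
  refine (hF.frequently_eq_iff_eventually_eq hG).1 ?_
  refine tendsto_ofReal_ne.frequently ?_
  exact ((freqIcc hp).and_eventually (h.filter_mono nhdsWithin_le_nhds)).mono fun y hy => hy.2 hy.1

theorem germ_ext {ι : Type} (S : LSys ι) {p : ℝ} (hp : p ∈ Icc (0:ℝ) 1)
    (hfix : ∀ ℓ, (S.a ℓ).toFun p = p) : ∃ E : ι → ℂ → ℂ, (∀ ℓ, AnalyticAt ℂ (E ℓ) 0) ∧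
      (∀ ℓ, E ℓ 0 = 0) ∧
      (∀ ℓ, ∀ᶠ y : ℝ in 𝓝 0, E ℓ (y:ℂ) = (((S.a ℓ).toFun (p + y) - p : ℝ) : ℂ)) ∧
      (∀ ℓ ℓ', ∀ᶠ z in 𝓝 (0:ℂ), E ℓ (E ℓ' z) = E ℓ' (E ℓ z)) ∧
      ∀ ℓ, ∀ᶠ z in 𝓝 (0:ℂ), E (S.flip ℓ) (E ℓ z) = z := by
  have h1 : ∀ ℓ, ∃ F : ℂ → ℂ, AnalyticAt ℂ F (p:ℂ) ∧ ∀ᶠ y : ℝ in 𝓝 p, F (y:ℂ) = (((S.a ℓ).toFun y : ℝ) : ℂ) :=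
    fun ℓ => ext_local ((S.a ℓ).analytic p hp)
  choose F hF hFe using h1
  have hE : ∀ ℓ, AnalyticAt ℂ (fun z => F ℓ (p + z) - p) 0 := by
    intro ℓ
    have : AnalyticAt ℂ (F ℓ) (p + 0) := by simpa using hF ℓ
    have h2 : AnalyticAt ℂ (fun z : ℂ => (p:ℂ) + z) 0 := by fun_prop
    exact (this.fun_comp h2).fun_sub analyticAt_const
  have h0 : ∀ ℓ, (fun z => F ℓ (p + z) - p) (0:ℂ) = 0 := by
    intro ℓ
    have := (hFe ℓ).self_of_nhds
    simp [this, hfix]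
  have hr : ∀ ℓ, ∀ᶠ y : ℝ in 𝓝 0, (fun z => F ℓ (p + z) - p) (y:ℂ) = (((S.a ℓ).toFun (p + y) - p : ℝ) : ℂ) := by
    intro ℓ
    have ht : Tendsto (fun y : ℝ => p + y) (𝓝 0) (𝓝 p) := by
      have : ContinuousAt (fun y : ℝ => p + y) 0 := by fun_prop
      simpa [ContinuousAt] using this
    filter_upwards [ht.eventually (hFe ℓ)] with y hy
    push_cast at hy ⊢
    rw [hy]
  obtain ⟨E, rfl⟩ : ∃ E, E = fun ℓ z => F ℓ (p + z) - p := ⟨_, rfl⟩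
  have tr : ∀ ℓ, Tendsto (fun y : ℝ => (S.a ℓ).toFun (p + y) - p) (𝓝 0) (𝓝 0) := by
    intro ℓ
    have : ContinuousAt (fun y : ℝ => (S.a ℓ).toFun (p + y) - p) 0 := by
      have h3 : ContinuousAt (S.a ℓ).toFun (p + 0) := by simpa using (S.a ℓ).continuousAt hp
      have h4 : ContinuousAt (fun y : ℝ => p + y) 0 := by fun_prop
      exact (ContinuousAt.comp (f := fun y : ℝ => p + y) h3 h4).sub continuousAt_const
    simpa [ContinuousAt, hfix] using this
  have hcomp : ∀ ℓ ℓ', ∀ᶠ y : ℝ in 𝓝 0, F ℓ (p + (F ℓ' (p + y) - p)) - p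
      = (((S.a ℓ).toFun ((S.a ℓ').toFun (p + y)) - p : ℝ) : ℂ) := by
    intro ℓ ℓ'
    filter_upwards [hr ℓ', (tr ℓ').eventually (hr ℓ)] with y h3 h4
    rw [h3, h4]; congr 3; ring
  have hcA : ∀ ℓ ℓ', AnalyticAt ℂ (fun z => F ℓ (p + (F ℓ' (p + z) - p)) - p) 0 := by
    intro ℓ ℓ'
    have h5 : AnalyticAt ℂ (fun z => F ℓ (p + z) - p) ((fun z => F ℓ' (p + z) - p) 0) := by
      rw [h0]; exact hE ℓ
    exact h5.fun_comp (f := fun z => F ℓ' (p + z) - p) (hE ℓ')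
  refine ⟨fun ℓ z => F ℓ (p + z) - p, hE, h0, hr, fun ℓ ℓ' => ?_, fun ℓ => ?_⟩
  · refine real_ident (hcA ℓ ℓ') (hcA ℓ' ℓ) hp ?_
    filter_upwards [hcomp ℓ ℓ', hcomp ℓ' ℓ] with y h3 h4 hy
    rw [h3, h4, S.comm _ _ _ hy]
  · refine real_ident (hcA (S.flip ℓ) ℓ) analyticAt_id hp ?_
    filter_upwards [hcomp (S.flip ℓ) ℓ] with y h3 hy
    rw [h3, S.inv _ _ hy]; simp

/-- exponential/linear scale -/
def th (m : ℕ) (s : ℝ) : ℝ := if m = 1 then Real.exp s - 1 else s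

theorem th_add {m : ℕ} (hm : 1 ≤ m) (s t : ℝ) :
    th m s + (1 + 0 ^ (m - 1) * th m s) ^ m * th m t = th m (t + s) := by
  unfold th
  by_cases h : m = 1
  · subst h; simp [Real.exp_add]; ring
  · have : m - 1 ≠ 0 := by omega
    simp [h, this]; ring

theorem th_pos {m : ℕ} {s : ℝ} : 0 < th m s ↔ 0 < s := by
  unfold th; split_ifs <;> simp

theorem th_neg {m : ℕ} {s : ℝ} : th m s < 0 ↔ s < 0 := by
  unfold th; split_ifs <;> simp

theorem th_zero {m : ℕ} {s : ℝ} : th m s = 0 ↔ s = 0 := by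
  unfold th; split_ifs <;> simp [sub_eq_zero]

/-- normal form of a germ -/
theorem germ_norm {ι : Type} [Finite ι] (S : LSys ι) {p : ℝ} (hp : p ∈ Icc (0:ℝ) 1)
    (hnt : ∃ ℓ, ¬ ∀ y ∈ Icc (0:ℝ) 1, (S.a ℓ).toFun y = y)
    {E : ι → ℂ → ℂ} (hE : ∀ ℓ, AnalyticAt ℂ (E ℓ) 0) (h0 : ∀ ℓ, E ℓ 0 = 0)
    (hr : ∀ ℓ, ∀ᶠ y : ℝ in 𝓝 0, E ℓ (y:ℂ) = (((S.a ℓ).toFun (p + y) - p : ℝ) : ℂ))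
    (hinv : ∀ ℓ, ∀ᶠ z in 𝓝 (0:ℂ), E (S.flip ℓ) (E ℓ z) = z) :
    ∃ m : ℕ, 1 ≤ m ∧ ∃ B : ι → ℂ → ℂ, (∀ ℓ, AnalyticAt ℂ (B ℓ) 0) ∧
      (∀ ℓ, ∀ᶠ z in 𝓝 (0:ℂ), E ℓ z = z + z ^ m * B ℓ z) ∧ ∃ τ : ι → ℝ, 
      (∀ ℓ, B ℓ 0 = (th m (τ ℓ) : ℝ)) ∧ (∃ ℓ, τ ℓ ≠ 0) ∧ ∀ ℓ, τ (S.flip ℓ) = - τ ℓ := by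
  obtain ⟨ℓ₁, hℓ₁⟩ := hnt
  have hD : ∀ ℓ, AnalyticAt ℂ (fun z => E ℓ z - z) 0 := fun ℓ => (hE ℓ).fun_sub analyticAt_id
  have : Nonempty ι := ⟨ℓ₁⟩
  obtain ⟨ℓ₀, hmin⟩ := Finite.exists_min (fun ℓ => analyticOrderAt (fun z => E ℓ z - z) 0)
  have hfin : analyticOrderAt (fun z => E ℓ₁ z - z) 0 ≠ ⊤ := by
    intro htop
    rw [analyticOrderAt_eq_top] at htop
    refine hℓ₁ (id_of_freq (S.a ℓ₁) hp ?_)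
    have ht : Tendsto (fun y : ℝ => y - p) (𝓝 p) (𝓝 0) := by
      have : ContinuousAt (fun y : ℝ => y - p) p := by fun_prop
      simpa [ContinuousAt] using this
    have ht2 : Tendsto (fun y : ℝ => ((y - p : ℝ) : ℂ)) (𝓝 p) (𝓝 0) := by
      have := (Complex.continuous_ofReal.tendsto 0).comp ht
      simpa [Function.comp_def] using this
    have hev : ∀ᶠ y : ℝ in 𝓝 p, (S.a ℓ₁).toFun y = y := by
      filter_upwards [ht.eventually (hr ℓ₁), ht2.eventually htop] with y h3 h4
      rw [h3] at h4
      have : ((S.a ℓ₁).toFun (p + (y - p)) - p) - (y - p) = 0 := by exact_mod_cast h4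
      have e : p + (y - p) = y := by ring
      rw [e] at this; linarith
    exact (hev.filter_mono nhdsWithin_le_nhds).frequently
  obtain ⟨m, hm⟩ := ENat.ne_top_iff_exists.1 (ne_top_of_le_ne_top hfin (hmin ℓ₁))
  have hm1 : 1 ≤ m := by
    by_contra hlt
    have hm0 : m = 0 := by omega
    subst hm0
    have := (hD ℓ₀).analyticOrderAt_eq_zero.1 hm.symm
    simp [h0] at this
  have hex : ∀ ℓ, ∃ B : ℂ → ℂ, AnalyticAt ℂ B 0 ∧ (∀ᶠ z in 𝓝 (0:ℂ), E ℓ z = z + z ^ m * B z) ∧ (ℓ = ℓ₀ → B 0 ≠ 0) := by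
    intro ℓ
    by_cases hl : ℓ = ℓ₀
    · subst hl
      obtain ⟨g, h1, h2, h3⟩ := (hD ℓ).analyticOrderAt_eq_natCast.1 hm.symm
      refine ⟨g, h1, ?_, fun _ => h2⟩
      filter_upwards [h3] with z hz
      simp only [sub_zero, smul_eq_mul] at hz
      rw [← hz]; ring
    · obtain ⟨g, h1, h3⟩ := (natCast_le_analyticOrderAt (hD ℓ)).1 (hm.le.trans (hmin ℓ))
      refine ⟨g, h1, ?_, fun h => absurd h hl⟩
      filter_upwards [h3] with z hz
      simp only [sub_zero, smul_eq_mul] at hz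
      rw [← hz]; ring
  choose B hB hEB hB0 using hex
  refine ⟨m, hm1, B, hB, hEB, ?_⟩
  have hreal : ∀ ℓ, (B ℓ 0).im = 0 := by
    intro ℓ
    have t1 : Tendsto (fun y : ℝ => (B ℓ (y:ℂ)).im) (𝓝[≠] 0) (𝓝 (B ℓ 0).im) :=
      (Complex.continuous_im.tendsto _).comp (((hB ℓ).continuousAt.tendsto.mono_left nhdsWithin_le_nhds).comp tendsto_ofReal_ne)
    refine tendsto_nhds_unique t1 (tendsto_const_nhds.congr' ?_)
    filter_upwards [(hr ℓ).filter_mono nhdsWithin_le_nhds, tendsto_ofReal_ne.eventually ((hEB ℓ).filter_mono nhdsWithin_le_nhds),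
      self_mem_nhdsWithin] with y h3 h4 h5
    have h5' : (y:ℂ) ≠ 0 := by simpa using h5
    have : B ℓ (y:ℂ) = ((((S.a ℓ).toFun (p + y) - p - y) / y ^ m : ℝ) : ℂ) := by
      push_cast at h3 ⊢
      rw [← h3, h4]; field_simp; ring
    rw [this, Complex.ofReal_im]
  have hBre : ∀ ℓ, B ℓ 0 = ((B ℓ 0).re : ℝ) := fun ℓ => by
    apply Complex.ext <;> simp [hreal]
  have hpos : m = 1 → ∀ ℓ, 0 < 1 + (B ℓ 0).re := by
    intro hm' ℓ
    subst hm'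
    have d1 : HasDerivAt (fun z => z + z ^ 1 * B ℓ z) (1 + B ℓ 0) 0 := by
      have := (hasDerivAt_id (0:ℂ)).add ((hasDerivAt_id (0:ℂ)).mul (hB ℓ).differentiableAt.hasDerivAt)
      simpa [Pi.add_def, Pi.mul_def] using this
    have d2 : HasDerivAt (E ℓ) (1 + B ℓ 0) ((0:ℝ):ℂ) := by
      simpa using d1.congr_of_eventuallyEq (hEB ℓ)
    have d3 := d2.real_of_complex
    have d4 : HasDerivAt (fun y : ℝ => (S.a ℓ).toFun (p + y) - p) (deriv (S.a ℓ).toFun p) 0 := by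
      have e : HasDerivAt (S.a ℓ).toFun (deriv (S.a ℓ).toFun p) (p + 0) := by
        simpa using ((S.a ℓ).analytic p hp).differentiableAt.hasDerivAt
      exact (e.comp_const_add p 0).sub_const p
    have d5 := d3.congr_of_eventuallyEq (f₁ := fun y : ℝ => (S.a ℓ).toFun (p + y) - p) (by
      filter_upwards [hr ℓ] with y hy
      rw [hy]; simp)
    have := d5.unique d4
    simp only [Complex.add_re, Complex.one_re] at this
    rw [this]; exact (S.a ℓ).deriv_pos p hp
  have hτ : ∀ ℓ, ∃ t : ℝ, th m t = (B ℓ 0).re := by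
    intro ℓ
    by_cases h : m = 1
    · refine ⟨Real.log (1 + (B ℓ 0).re), ?_⟩
      rw [th, if_pos h, Real.exp_log (hpos h ℓ)]; ring
    · exact ⟨_, by rw [th, if_neg h]⟩
  choose τ hτ using hτ
  refine ⟨τ, fun ℓ => by rw [hτ]; exact hBre ℓ, ⟨ℓ₀, fun h => hB0 ℓ₀ rfl ?_⟩, fun ℓ => ?_⟩
  · rw [hBre, ← hτ, th_zero.2 h]; simp
  · have hEt : Tendsto (E ℓ) (𝓝 0) (𝓝 0) := by
      have := (hE ℓ).continuousAt.tendsto; rwa [h0] at this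
    have hz : ∀ᶠ z in 𝓝[≠] (0:ℂ), B ℓ z + (1 + z ^ (m - 1) * B ℓ z) ^ m * B (S.flip ℓ) (E ℓ z) = 0 := by
      filter_upwards [(hinv ℓ).filter_mono nhdsWithin_le_nhds, (hEB ℓ).filter_mono nhdsWithin_le_nhds,
        (hEt.eventually (hEB (S.flip ℓ))).filter_mono nhdsWithin_le_nhds, self_mem_nhdsWithin] with z h3 h4 h5 h6
      have h6' : z ≠ 0 := h6
      rw [h3] at h5
      have e1 : E ℓ z = z * (1 + z ^ (m - 1) * B ℓ z) := by
        rw [h4]; obtain ⟨k, rfl⟩ : ∃ k, m = k + 1 := ⟨m - 1, by omega⟩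
        simp only [Nat.add_sub_cancel]; ring
      have e2 : z ^ m * (B ℓ z + (1 + z ^ (m - 1) * B ℓ z) ^ m * B (S.flip ℓ) (E ℓ z)) = 0 := by
        rw [mul_add, ← mul_assoc, ← mul_pow, ← e1]
        have h7 := h5
        linear_combination (-1 : ℂ) * h7 - h4
      exact (mul_eq_zero.1 e2).resolve_left (pow_ne_zero _ h6')
    have tl : Tendsto (fun z => B ℓ z + (1 + z ^ (m - 1) * B ℓ z) ^ m * B (S.flip ℓ) (E ℓ z)) (𝓝[≠] 0)
        (𝓝 (B ℓ 0 + (1 + 0 ^ (m - 1) * B ℓ 0) ^ m * B (S.flip ℓ) 0)) := by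
      have c1 := (hB ℓ).continuousAt
      have c2 : ContinuousAt (fun z => B (S.flip ℓ) (E ℓ z)) 0 := by
        refine ContinuousAt.comp (f := E ℓ) ?_ (hE ℓ).continuousAt
        rw [h0]; exact (hB _).continuousAt
      have c3 : ContinuousAt (fun z => B ℓ z + (1 + z ^ (m - 1) * B ℓ z) ^ m * B (S.flip ℓ) (E ℓ z)) 0 := by
        exact c1.add (((continuousAt_const.add ((continuousAt_id.pow _).mul c1)).pow m).mul c2)
      have := c3.tendsto.mono_left (nhdsWithin_le_nhds (s := {0}ᶜ))
      simpa only [h0] using this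
    have e3 := tendsto_nhds_unique tl (tendsto_const_nhds.congr' (hz.mono fun _ h => h.symm))
    rw [hBre, hBre (S.flip ℓ), ← hτ, ← hτ] at e3
    have e4 : th m (τ ℓ) + (1 + 0 ^ (m - 1) * th m (τ ℓ)) ^ m * th m (τ (S.flip ℓ)) = 0 := by exact_mod_cast e3
    rw [th_add hm1, th_zero] at e4
    linarith


/-- the germ package at a fixed point -/
def Germ {ι : Type} (S : LSys ι) (p : ℝ) (τ : ι → ℝ) : Prop :=
  (∃ ℓ, τ ℓ ≠ 0) ∧ (∀ ℓ, τ (S.flip ℓ) = - τ ℓ) ∧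
  (∃ m : ℕ, ∀ l, (0 < wsum τ l → ∀ᶠ y in 𝓝 p, y ≠ p → 0 < ((S.wd l).toFun y - y) * (y - p) ^ m) ∧
    (wsum τ l < 0 → ∀ᶠ y in 𝓝 p, y ≠ p → ((S.wd l).toFun y - y) * (y - p) ^ m < 0)) ∧
  ∀ C ≥ 0, ∃ r > 0, ∃ L : ℝ, ∃ F : List ι → ℂ → ℂ, ∀ l, BW τ C l →
    DifferentiableOn ℂ (F l) (Metric.ball (p:ℂ) r) ∧ (∀ z ∈ Metric.ball (p:ℂ) r, ‖F l z‖ ≤ 2) ∧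
    (∀ x ∈ Icc (0:ℝ) 1, |x - p| < r → F l (x:ℂ) = (((S.wd l).toFun x : ℝ) : ℂ)) ∧
    ∀ l', BW τ C l' → ∀ z ∈ Metric.ball (p:ℂ) r, ‖F l z - F l' z‖ ≤ L * |wsum τ l - wsum τ l'|

theorem germ_words {ι : Type} (S : LSys ι) {p : ℝ} (hp : p ∈ Icc (0:ℝ) 1)
    (hfix : ∀ ℓ, (S.a ℓ).toFun p = p)
    {E : ι → ℂ → ℂ} (hE : ∀ ℓ, AnalyticAt ℂ (E ℓ) 0) (h0 : ∀ ℓ, E ℓ 0 = 0)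
    (hr : ∀ ℓ, ∀ᶠ y : ℝ in 𝓝 0, E ℓ (y:ℂ) = (((S.a ℓ).toFun (p + y) - p : ℝ) : ℂ))
    {m : ℕ} (hm1 : 1 ≤ m) {B : ι → ℂ → ℂ} (hB : ∀ ℓ, AnalyticAt ℂ (B ℓ) 0)
    (hEB : ∀ ℓ, ∀ᶠ z in 𝓝 (0:ℂ), E ℓ z = z + z ^ m * B ℓ z) {τ : ι → ℝ}
    (hτ : ∀ ℓ, B ℓ 0 = (th m (τ ℓ) : ℝ)) (l : List ι) :
    (S.wd l).toFun p = p ∧ cw E l 0 = 0 ∧ ContinuousAt (cw E l) 0 ∧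
    (∀ᶠ y : ℝ in 𝓝 0, cw E l (y:ℂ) = (((S.wd l).toFun (p + y) - p : ℝ) : ℂ)) ∧
    ∃ D : ℂ → ℂ, ContinuousAt D 0 ∧ D 0 = (th m (wsum τ l) : ℝ) ∧
      ∀ᶠ z in 𝓝 (0:ℂ), cw E l z = z + z ^ m * D z := by
  induction l with
  | nil =>
    refine ⟨rfl, rfl, continuousAt_id, Eventually.of_forall fun y => ?_, fun _ => 0, continuousAt_const, ?_, ?_⟩
    · simp [cw, S.wd_nil]
    · rw [wsum_nil, th_zero.2 rfl]; simp
    · simp [cw]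
  | cons ℓ l ih =>
    obtain ⟨i1, i2, i3, i4, D, i5, i6, i7⟩ := ih
    have tc : Tendsto (cw E l) (𝓝 0) (𝓝 0) := by simpa [ContinuousAt, i2] using i3
    have tr : Tendsto (fun y : ℝ => (S.wd l).toFun (p + y) - p) (𝓝 0) (𝓝 0) := by
      have : ContinuousAt (fun y : ℝ => (S.wd l).toFun (p + y) - p) 0 := by
        have h3 : ContinuousAt (S.wd l).toFun (p + 0) := by simpa using (S.wd l).continuousAt hp
        have h4 : ContinuousAt (fun y : ℝ => p + y) 0 := by fun_prop
        exact (ContinuousAt.comp (f := fun y : ℝ => p + y) h3 h4).sub continuousAt_const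
      simpa [ContinuousAt, i1] using this
    have c1 : ContinuousAt (fun z => B ℓ (cw E l z)) 0 := by
      refine ContinuousAt.comp (f := cw E l) ?_ i3
      rw [i2]; exact (hB ℓ).continuousAt
    refine ⟨?_, ?_, ?_, ?_, fun z => D z + (1 + z ^ (m - 1) * D z) ^ m * B ℓ (cw E l z), ?_, ?_, ?_⟩
    · rw [S.wd_cons, i1, hfix]
    · simp only [cw]; rw [i2, h0]
    · show ContinuousAt (fun z => E ℓ (cw E l z)) 0
      refine ContinuousAt.comp (f := cw E l) ?_ i3
      rw [i2]; exact (hE ℓ).continuousAt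
    · filter_upwards [i4, tr.eventually (hr ℓ)] with y h3 h4
      simp only [cw]
      rw [h3, h4, S.wd_cons]; congr 3; ring
    · exact i5.add (((continuousAt_const.add ((continuousAt_id.pow _).mul i5)).pow m).mul c1)
    · simp only [i2, i6, hτ]
      rw [wsum_cons, ← th_add hm1]; push_cast; ring
    · filter_upwards [i7, tc.eventually (hEB ℓ)] with z h3 h4
      simp only [cw]
      rw [h4]
      have e1 : cw E l z = z * (1 + z ^ (m - 1) * D z) := by
        rw [h3]; obtain ⟨k, rfl⟩ : ∃ k, m = k + 1 := ⟨m - 1, by omega⟩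
        simp only [Nat.add_sub_cancel]; ring
      rw [mul_add (z ^ m), ← mul_assoc, ← mul_pow, ← e1, ← add_assoc, ← h3]

theorem germ_exists {ι : Type} [Finite ι] (S : LSys ι) {p : ℝ} (hp : p ∈ Icc (0:ℝ) 1)
    (hfix : ∀ ℓ, (S.a ℓ).toFun p = p)
    (hnt : ∃ ℓ, ¬ ∀ y ∈ Icc (0:ℝ) 1, (S.a ℓ).toFun y = y) : ∃ τ : ι → ℝ, Germ S p τ := by
  obtain ⟨E, hE, h0, hr, hcom, hinv⟩ := germ_ext S hp hfix
  obtain ⟨m, hm1, B, hB, hEB, τ, hτ, hne, hflip⟩ := germ_norm S hp hnt hE h0 hr hinv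
  have hW : WordConc E τ := by
    by_cases h : m = 1
    · subst h
      obtain ⟨ℓ, hℓ⟩ := hne
      have : ∃ e, τ e < 0 := by
        rcases lt_or_gt_of_ne hℓ with h | h
        · exact ⟨ℓ, h⟩
        · exact ⟨S.flip ℓ, by rw [hflip]; linarith⟩
      obtain ⟨e, he⟩ := this
      refine hyperbolic hB (fun ℓ => ?_) (fun ℓ => ?_) he (fun ℓ => hcom e ℓ)
      · simpa using hEB ℓ
      · rw [hτ]; simp [th]
    · obtain ⟨ℓ, hℓ⟩ := hne
      refine parabolic (k := m - 1) (by omega) hB (fun ℓ => ?_) (fun ℓ => ?_) hℓ (hflip ℓ) (hcom ℓ) (hcom _)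
      · have : m - 1 + 1 = m := by omega
        rw [this]; exact hEB ℓ
      · rw [hτ]; simp [th, h]
  have ht : Tendsto (fun y : ℝ => y - p) (𝓝 p) (𝓝 0) := by
    have : ContinuousAt (fun y : ℝ => y - p) p := by fun_prop
    simpa [ContinuousAt] using this
  have ht2 : Tendsto (fun y : ℝ => ((y - p : ℝ) : ℂ)) (𝓝 p) (𝓝 0) := by
    have := (Complex.continuous_ofReal.tendsto 0).comp ht
    simpa [Function.comp_def] using this
  have hform : ∀ l, ∃ D : ℝ → ℝ, Tendsto D (𝓝 p) (𝓝 (th m (wsum τ l))) ∧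
      ∀ᶠ y in 𝓝 p, (S.wd l).toFun y - y = (y - p) ^ m * D y := by
    intro l
    obtain ⟨-, -, -, g4, D, g5, g6, g7⟩ := germ_words S hp hfix hE h0 hr hm1 hB hEB hτ l
    refine ⟨fun y => (D ((y - p : ℝ) : ℂ)).re, ?_, ?_⟩
    · have := (Complex.continuous_re.tendsto _).comp (g5.tendsto.comp ht2)
      rw [g6, Complex.ofReal_re] at this
      exact this
    · filter_upwards [ht.eventually g4, ht2.eventually g7] with y h3 h4
      rw [h3] at h4
      have h5 := congrArg Complex.re h4
      rw [← Complex.ofReal_pow, Complex.add_re, Complex.re_ofReal_mul, Complex.ofReal_re, Complex.ofReal_re] at h5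
      have e : p + (y - p) = y := by ring
      rw [e] at h5; linarith
  refine ⟨τ, hne, hflip, ⟨m, fun l => ?_⟩, fun C hC => ?_⟩
  · obtain ⟨D, d1, d2⟩ := hform l
    constructor
    · intro hl
      filter_upwards [d2, d1.eventually (lt_mem_nhds (th_pos.2 hl))] with y h3 h4 hy
      have : (y - p) ^ m ≠ 0 := pow_ne_zero _ (sub_ne_zero.2 hy)
      rw [h3]
      have : 0 < ((y - p) ^ m) ^ 2 := by positivity
      nlinarith
    · intro hl
      filter_upwards [d2, d1.eventually (gt_mem_nhds (th_neg.2 hl))] with y h3 h4 hy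
      have : (y - p) ^ m ≠ 0 := pow_ne_zero _ (sub_ne_zero.2 hy)
      rw [h3]
      have : 0 < ((y - p) ^ m) ^ 2 := by positivity
      nlinarith
  · obtain ⟨-, ρ, -, hρ, hρ1, hall⟩ := fin_unif (fun ℓ (K:ℝ) r => DifferentiableOn ℂ (E ℓ) (Metric.ball 0 r) ∧
      ∀ y : ℝ, |y| < r → E ℓ (y:ℂ) = (((S.a ℓ).toFun (p + y) - p : ℝ) : ℂ))
      (fun ℓ K r K' r' h _ _ hr => ⟨h.1.mono (Metric.ball_subset_ball hr), fun y hy => h.2 y (hy.trans_le hr)⟩)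
      (fun ℓ => by
        obtain ⟨r1, h1, h2⟩ := Metric.eventually_nhds_iff_ball.1 ((hE ℓ).eventually_analyticAt)
        obtain ⟨r2, h3, h4⟩ := Metric.eventually_nhds_iff_ball.1 (hr ℓ)
        refine ⟨0, min r1 r2, lt_min h1 h3, fun z hz => ?_, fun y hy => ?_⟩
        · exact (h2 z (Metric.ball_subset_ball (min_le_left _ _) hz)).differentiableAt.differentiableWithinAt
        · exact h4 y (by rw [mem_ball_zero_iff, Real.norm_eq_abs]; exact hy.trans_le (min_le_right _ _)))
    obtain ⟨r, hr0, L, hw⟩ := hW C hC ρ hρ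
    refine ⟨r, hr0, L, fun l z => p + cw E l (z - p), fun l hl => ⟨?_, ?_, ?_, ?_⟩⟩
    · have hd : DifferentiableOn ℂ (cw E l) (Metric.ball 0 r) := by
        induction l with
        | nil => exact differentiableOn_id
        | cons ℓ l ih =>
          refine DifferentiableOn.comp (g := E ℓ) (f := cw E l) (t := Metric.ball 0 ρ) (hall ℓ).1 (ih hl.1) (fun z hz => ?_)
          rw [mem_ball_zero_iff] at hz ⊢
          exact (hw l hl.1 z hz).1
      refine (differentiableOn_const _).add (hd.comp (differentiableOn_id.sub_const _) (fun z hz => ?_))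
      rw [mem_ball_zero_iff]
      show ‖z - (p:ℂ)‖ < r
      rw [← dist_eq_norm]; exact hz
    · intro z hz
      have := (hw l hl (z - p) (by rw [← dist_eq_norm]; exact hz)).1
      refine (norm_add_le _ _).trans ?_
      rw [Complex.norm_real, Real.norm_eq_abs, abs_of_nonneg hp.1]
      linarith [hp.2]
    · intro x hx hxr
      have hxr' : ‖((x - p : ℝ) : ℂ)‖ < r := by rwa [Complex.norm_real, Real.norm_eq_abs]
      have key : cw E l ((x - p : ℝ) : ℂ) = (((S.wd l).toFun x - p : ℝ) : ℂ) := by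
        induction l with
        | nil => rfl
        | cons ℓ l ih =>
          have b := (hw l hl.1 _ hxr').1
          simp only [cw]
          rw [ih hl.1] at b ⊢
          rw [Complex.norm_real, Real.norm_eq_abs] at b
          rw [(hall ℓ).2 _ b, S.wd_cons]; congr 3; ring
      simp only
      rw [← Complex.ofReal_sub, key]; push_cast; ring
    · intro l' hl' z hz
      have := (hw l hl (z - p) (by rw [← dist_eq_norm]; exact hz)).2 l' hl'
      simpa using this


theorem sign_transfer {ι : Type} (S : LSys ι) (e : ι) {x p : ℝ} (hx : x ∈ Icc (0:ℝ) 1)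
    (ht : Tendsto (fun n => (S.a e).toFun^[n] x) atTop (𝓝 p))
    (hs : ∀ n, 0 < ((S.a e).toFun^[n] x - p) * (x - p)) {τ : ι → ℝ} (hg : Germ S p τ) :
    ∃ s : ℝ, s ≠ 0 ∧ ∀ l, (0 < wsum τ l → 0 < ((S.wd l).toFun x - x) * s) ∧
      (wsum τ l < 0 → ((S.wd l).toFun x - x) * s < 0) := by
  obtain ⟨-, -, ⟨m, hm⟩, -⟩ := hg
  have hxp : x - p ≠ 0 := fun h => by have := hs 0; rw [h] at this; simp at this
  have hnp : ∀ n, (S.a e).toFun^[n] x ≠ p := fun n h => by have := hs n; rw [h] at this; simp at this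
  refine ⟨(x - p) ^ m, pow_ne_zero _ hxp, fun l => ?_⟩
  have hu : ∀ n, (S.wd l).toFun ((S.a e).toFun^[n] x) = (S.a e).toFun^[n] ((S.wd l).toFun x) := by
    intro n
    induction n with
    | zero => rfl
    | succ n ih =>
      rw [Function.iterate_succ_apply', Function.iterate_succ_apply', ← ih, S.wd_comm _ _ (iter_mapsTo _ hx n)]
  set u := (S.wd l).toFun x with hudef
  have huI : u ∈ Icc (0:ℝ) 1 := (S.wd l).mapsTo hx
  have hbc : ∀ n, 0 < ((S.a e).toFun^[n] x - p) ^ m * (x - p) ^ m := fun n => by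
    rw [← mul_pow]; exact pow_pos (hs n) m
  have hAd : ∀ n, u ≠ x → 0 < ((S.a e).toFun^[n] u - (S.a e).toFun^[n] x) * (u - x) := by
    intro n hne
    have hst := ((S.a e).pow n).strictMono
    rcases lt_or_gt_of_ne hne with h | h
    · have := hst huI hx h
      rw [AnDiffeo.pow_toFun, AnDiffeo.pow_toFun] at this
      exact mul_pos_of_neg_of_neg (by linarith) (by linarith)
    · have := hst hx huI h
      rw [AnDiffeo.pow_toFun, AnDiffeo.pow_toFun] at this
      exact mul_pos (by linarith) (by linarith)
  constructor
  · intro hl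
    obtain ⟨n, hn⟩ := (ht.eventually ((hm l).1 hl)).exists
    have h1 := hn (hnp n)
    rw [hu] at h1
    by_cases hne : u = x
    · rw [hne] at h1; simp at h1
    have h2 := hbc n
    have h3 := hAd n hne
    set A := (S.a e).toFun^[n] u - (S.a e).toFun^[n] x
    set b := ((S.a e).toFun^[n] x - p) ^ m
    have h4 := mul_pos (mul_pos h1 h2) h3
    have e : A * b * (b * (x - p) ^ m) * (A * (u - x)) = (A * b) ^ 2 * ((u - x) * (x - p) ^ m) := by ring
    rw [e] at h4
    exact pos_of_mul_pos_right h4 (by positivity)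
  · intro hl
    obtain ⟨n, hn⟩ := (ht.eventually ((hm l).2 hl)).exists
    have h1 := hn (hnp n)
    rw [hu] at h1
    by_cases hne : u = x
    · rw [hne] at h1; simp at h1
    have h2 := hbc n
    have h3 := hAd n hne
    set A := (S.a e).toFun^[n] u - (S.a e).toFun^[n] x
    set b := ((S.a e).toFun^[n] x - p) ^ m
    have h4 := mul_pos (mul_pos (neg_pos.2 h1) h2) h3
    have e : -(A * b) * (b * (x - p) ^ m) * (A * (u - x)) = (A * b) ^ 2 * (-((u - x) * (x - p) ^ m)) := by ring
    rw [e] at h4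
    have := pos_of_mul_pos_right h4 (by positivity)
    linarith

theorem wsum_append {ι : Type*} (τ : ι → ℝ) (l l' : List ι) :
    wsum τ (l ++ l') = wsum τ l + wsum τ l' := by simp [wsum]

theorem wsum_replicate {ι : Type*} (τ : ι → ℝ) (n : ℕ) (ℓ : ι) :
    wsum τ (List.replicate n ℓ) = n * τ ℓ := by simp [wsum]

theorem wsum_smul {ι : Type*} (τ : ι → ℝ) (c : ℝ) (l : List ι) :
    wsum (fun ℓ => c * τ ℓ) l = c * wsum τ l := by
  induction l with
  | nil => simp [wsum_nil]
  | cons ℓ l ih => rw [wsum_cons, wsum_cons, ih]; ring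

/-- integer powers of a letter -/
def zw {ι : Type*} (fl : ι → ι) (n : ℤ) (ℓ : ι) : List ι :=
  if 0 ≤ n then List.replicate n.natAbs ℓ else List.replicate n.natAbs (fl ℓ)

theorem wsum_zw {ι : Type*} {fl : ι → ι} {τ : ι → ℝ} (h : ∀ ℓ, τ (fl ℓ) = - τ ℓ) (n : ℤ) (ℓ : ι) :
    wsum τ (zw fl n ℓ) = n * τ ℓ := by
  unfold zw
  split_ifs with hn
  · rw [wsum_replicate, Nat.cast_natAbs, abs_of_nonneg hn]
  · rw [wsum_replicate, h, Nat.cast_natAbs, abs_of_neg (by omega)]; push_cast; ring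

theorem prop_lemma {ι : Type*} {fl : ι → ι} {α β : ι → ℝ} (hα : ∀ ℓ, α (fl ℓ) = - α ℓ)
    (hβ : ∀ ℓ, β (fl ℓ) = - β ℓ) (hne : ∃ e, α e ≠ 0)
    (h : ∀ l, 0 < wsum α l → 0 ≤ wsum β l) : ∃ k : ℝ, ∀ ℓ, β ℓ = k * α ℓ := by
  obtain ⟨e, he⟩ : ∃ e, 0 < α e := by
    obtain ⟨e, he⟩ := hne
    rcases lt_or_gt_of_ne he with h | h
    · exact ⟨fl e, by rw [hα]; linarith⟩
    · exact ⟨e, h⟩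
  have hIneq : ∀ (ℓ : ι) (n M : ℤ), 0 < n * α ℓ + M * α e → 0 ≤ n * β ℓ + M * β e := by
    intro ℓ n M hpos
    have := h (zw fl n ℓ ++ zw fl M e)
    rw [wsum_append, wsum_append, wsum_zw hα, wsum_zw hα, wsum_zw hβ, wsum_zw hβ] at this
    exact this hpos
  have hβe : 0 ≤ β e := by have := hIneq e 0 1 (by simpa using he); simpa using this
  refine ⟨β e / α e, fun ℓ => ?_⟩
  set k := β e / α e with hk
  have hk0 : 0 ≤ k := div_nonneg hβe he.le
  have hke : k * α e = β e := by rw [hk]; field_simp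
  have key : ∀ n : ℤ, -β e ≤ n * (β ℓ - k * α ℓ) := by
    intro n
    set M : ℤ := ⌊-(n * α ℓ / α e)⌋ + 1 with hM
    have m1 : -(n * α ℓ / α e) < M := by rw [hM]; push_cast; exact Int.lt_floor_add_one _
    have m2 : (M:ℝ) ≤ -(n * α ℓ / α e) + 1 := by
      rw [hM]; push_cast; linarith [Int.floor_le (-(n * α ℓ / α e))]
    have e1 : n * α ℓ = n * α ℓ / α e * α e := by field_simp
    have p1 : 0 < n * α ℓ + M * α e := by
      rw [e1, ← add_mul]; exact mul_pos (by linarith) he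
    have p2 : n * α ℓ + M * α e ≤ α e := by
      rw [e1, ← add_mul]; nlinarith
    have := hIneq ℓ n M p1
    rw [← hke] at this ⊢
    nlinarith
  by_contra hne'
  have hd : β ℓ - k * α ℓ ≠ 0 := sub_ne_zero.2 hne'
  rcases lt_or_gt_of_ne hd with hlt | hgt
  · obtain ⟨n, hn⟩ := exists_nat_gt (β e / -(β ℓ - k * α ℓ))
    rw [div_lt_iff₀ (by linarith)] at hn
    have := key n
    push_cast at this
    linarith
  · obtain ⟨n, hn⟩ := exists_nat_gt (β e / (β ℓ - k * α ℓ))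
    rw [div_lt_iff₀ (by linarith)] at hn
    have := key (-n)
    push_cast at this
    linarith

theorem sign_prop {ι : Type} (S : LSys ι) {x s t : ℝ} {α β : ι → ℝ}
    (hα : ∀ ℓ, α (S.flip ℓ) = - α ℓ) (hβ : ∀ ℓ, β (S.flip ℓ) = - β ℓ) (ha : ∃ ℓ, α ℓ ≠ 0) (hb : ∃ ℓ, β ℓ ≠ 0)
    (_hs0 : s ≠ 0) (ht0 : t ≠ 0)
    (h1 : ∀ l, (0 < wsum α l → 0 < ((S.wd l).toFun x - x) * s))
    (h2 : ∀ l, (0 < wsum β l → 0 < ((S.wd l).toFun x - x) * t) ∧ (wsum β l < 0 → ((S.wd l).toFun x - x) * t < 0)) :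
    ∃ k : ℝ, k ≠ 0 ∧ ∀ ℓ, β ℓ = k * α ℓ := by
  have key : ∃ k : ℝ, ∀ ℓ, (s * t) * β ℓ = k * α ℓ := by
    refine prop_lemma (fl := S.flip) (α := α) (β := fun ℓ => (s * t) * β ℓ) hα (fun ℓ => by simp [hβ]) ha (fun l hl => ?_)
    rw [wsum_smul]
    have a := h1 l hl
    obtain ⟨b1, b2⟩ := h2 l
    set D := (S.wd l).toFun x - x
    by_contra hneg
    push Not at hneg
    have hst : s * t ≠ 0 := by
      intro h; rw [h] at hneg; simp at hneg
    have hD : 0 < D * D := by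
      have : D ≠ 0 := fun h => by rw [h] at a; simp at a
      exact mul_self_pos.2 this
    rcases lt_trichotomy (wsum β l) 0 with h | h | h
    · have := mul_neg_of_pos_of_neg a (b2 h)
      have h4 : 0 < s * t := pos_of_mul_neg_left hneg h.le
      nlinarith
    · rw [h] at hneg; simp at hneg
    · have := mul_pos a (b1 h)
      have h4 : s * t < 0 := neg_of_mul_neg_left hneg h.le
      nlinarith
  obtain ⟨k, hk⟩ := key
  have hst : s * t ≠ 0 := mul_ne_zero _hs0 ht0
  have hk' : ∀ ℓ, β ℓ = k / (s * t) * α ℓ := fun ℓ => by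
    rw [div_mul_eq_mul_div, eq_div_iff hst, ← hk]; ring
  refine ⟨k / (s * t), fun h => ?_, hk'⟩
  obtain ⟨ℓ, hℓ⟩ := hb
  exact hℓ (by rw [hk', h, zero_mul])

theorem adj_lemma {ι : Type} (S : LSys ι) (e : ι) {p q x : ℝ} (hp : p ∈ Icc (0:ℝ) 1) (hq : q ∈ Icc (0:ℝ) 1)
    (hpx : p < x) (hxq : x < q) (hfp : (S.a e).toFun p = p) (hfq : (S.a e).toFun q = q)
    (hno : ∀ y ∈ Icc (0:ℝ) 1, p < y → y < q → (S.a e).toFun y ≠ y) (hup : x < (S.a e).toFun x)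
    {α β : ι → ℝ} (hα : Germ S p α) (hβ : Germ S q β) : ∃ k : ℝ, k ≠ 0 ∧ ∀ ℓ, β ℓ = k * α ℓ := by
  have hx : x ∈ Icc (0:ℝ) 1 := ⟨hp.1.trans hpx.le, hxq.le.trans hq.2⟩
  have hfl : ∀ y ∈ Icc (0:ℝ) 1, (S.a e).toFun ((S.a (S.flip e)).toFun y) = y := by
    intro y hy; have := S.inv (S.flip e) y hy; rwa [S.flip_flip] at this
  have hdn : (S.a (S.flip e)).toFun x < x := by
    have := (S.a (S.flip e)).strictMono hx ((S.a e).mapsTo hx) hup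
    rwa [S.inv _ _ hx] at this
  obtain ⟨q', hq'I, hq'1, hq'2, hq'3, hq'4, hq'5⟩ := orbit_up _ hx hup
  have e1 : q' = q := by
    have := hq'5 q hq hfq hxq
    rcases this.lt_or_eq with h | h
    · exact absurd hq'2 (hno q' hq'I (hpx.trans hq'1) h)
    · exact h
  subst e1
  obtain ⟨p', hp'I, hp'1, hp'2, hp'3, hp'4, hp'5⟩ := orbit_down _ hx hdn
  have e2 : p' = p := by
    have h1 : (S.a (S.flip e)).toFun p = p := by
      have := S.inv e p hp; rwa [hfp] at this
    have := hp'5 p hp h1 hpx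
    rcases this.lt_or_eq with h | h
    · have h2 : (S.a e).toFun p' = p' := by have := hfl p' hp'I; rwa [hp'2] at this
      exact absurd h2 (hno p' hp'I h (hp'1.trans hxq))
    · exact h.symm
  subst e2
  obtain ⟨s, hs, h1⟩ := sign_transfer S (S.flip e) hx hp'3 (fun n => mul_pos (by linarith [hp'4 n]) (by linarith)) hα
  obtain ⟨t, ht, h2⟩ := sign_transfer S e hx hq'3
    (fun n => mul_pos_of_neg_of_neg (by linarith [hq'4 n]) (by linarith)) hβ
  exact sign_prop S hα.2.1 hβ.2.1 hα.1 hβ.1 hs ht (fun l => (h1 l).1) h2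

theorem germ_all {ι : Type} [Finite ι] (S : LSys ι)
    (hnt : ∃ ℓ, ¬ ∀ y ∈ Icc (0:ℝ) 1, (S.a ℓ).toFun y = y) : ∃ τ : ι → ℝ, (∃ ℓ, τ ℓ ≠ 0) ∧
      (∀ ℓ, τ (S.flip ℓ) = - τ ℓ) ∧
      ∀ p ∈ Icc (0:ℝ) 1, (∀ ℓ, (S.a ℓ).toFun p = p) → ∃ c : ℝ, Germ S p (fun ℓ => c * τ ℓ) := by
  obtain ⟨e, he⟩ := hnt
  have hall : ∀ p ∈ Icc (0:ℝ) 1, (S.a e).toFun p = p → ∀ ℓ, (S.a ℓ).toFun p = p := by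
    intro p hp hf ℓ
    by_contra hne
    exact he (fix_comm (S.comm ℓ e) hp hne hf)
  have hfin := fix_finite (S.a e) he
  have hex : ∀ p : ℝ, ∃ τ : ι → ℝ, p ∈ Icc (0:ℝ) 1 → (S.a e).toFun p = p → Germ S p τ := by
    intro p
    by_cases h : p ∈ Icc (0:ℝ) 1 ∧ (S.a e).toFun p = p
    · obtain ⟨τ, hτ⟩ := germ_exists S h.1 (hall p h.1 h.2) ⟨e, he⟩
      exact ⟨τ, fun _ _ => hτ⟩
    · exact ⟨0, fun h1 h2 => absurd ⟨h1, h2⟩ h⟩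
  choose T hT using hex
  have z0 : (0:ℝ) ∈ Icc (0:ℝ) 1 := by simp
  have claim : ∀ q ∈ Icc (0:ℝ) 1, (S.a e).toFun q = q → ∃ c : ℝ, c ≠ 0 ∧ ∀ ℓ, T q ℓ = c * T 0 ℓ := by
    by_contra hbad
    push Not at hbad
    set Bad := {q | q ∈ Icc (0:ℝ) 1 ∧ (S.a e).toFun q = q ∧ ¬ ∃ c : ℝ, c ≠ 0 ∧ ∀ ℓ, T q ℓ = c * T 0 ℓ} with hBad
    have bfin : Bad.Finite := hfin.subset fun q hq => ⟨hq.1, hq.2.1⟩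
    have bne : Bad.Nonempty := by
      obtain ⟨q, h1, h2, h3⟩ := hbad
      exact ⟨q, h1, h2, by push Not; exact h3⟩
    obtain ⟨q, hq, hqmin⟩ := bfin.exists_minimal bne
    obtain ⟨hqI, hqf, hqb⟩ := hq
    have hq0 : 0 < q := by
      rcases hqI.1.lt_or_eq with h | h
      · exact h
      · exact absurd ⟨1, one_ne_zero, fun ℓ => by rw [← h, one_mul]⟩ hqb
    set P := {p | p ∈ Icc (0:ℝ) 1 ∧ (S.a e).toFun p = p ∧ p < q} with hP
    have pfin : P.Finite := hfin.subset fun q hq => ⟨hq.1, hq.2.1⟩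
    obtain ⟨p, hp, hpmax⟩ := pfin.exists_maximal ⟨0, z0, (S.a e).map_zero, hq0⟩
    obtain ⟨hpI, hpf, hpq⟩ := hp
    have hno : ∀ y ∈ Icc (0:ℝ) 1, p < y → y < q → (S.a e).toFun y ≠ y := by
      intro y hy h1 h2 hf
      have := hpmax (y := y) ⟨hy, hf, h2⟩ h1.le
      linarith
    have hno' : ∀ y ∈ Icc (0:ℝ) 1, p < y → y < q → (S.a (S.flip e)).toFun y ≠ y := by
      intro y hy h1 h2 hf
      refine hno y hy h1 h2 ?_
      have := S.inv (S.flip e) y hy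
      rw [S.flip_flip, hf] at this; exact this
    have hfixf : ∀ y ∈ Icc (0:ℝ) 1, (S.a e).toFun y = y → (S.a (S.flip e)).toFun y = y := by
      intro y hy hf
      have := S.inv e y hy; rwa [hf] at this
    have hpg : ∃ c : ℝ, c ≠ 0 ∧ ∀ ℓ, T p ℓ = c * T 0 ℓ := by
      by_contra hb
      have := hqmin (y := p) ⟨hpI, hpf, hb⟩ hpq.le
      linarith
    obtain ⟨c, hc, hcT⟩ := hpg
    set x := (p + q) / 2 with hx
    have x1 : p < x := by rw [hx]; linarith
    have x2 : x < q := by rw [hx]; linarith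
    have xI : x ∈ Icc (0:ℝ) 1 := ⟨hpI.1.trans x1.le, x2.le.trans hqI.2⟩
    have hk : ∃ k : ℝ, k ≠ 0 ∧ ∀ ℓ, T q ℓ = k * T p ℓ := by
      rcases lt_or_gt_of_ne (hno x xI x1 x2) with h | h
      · refine adj_lemma S (S.flip e) hpI hqI x1 x2 (hfixf p hpI hpf) (hfixf q hqI hqf) hno' ?_ (hT p hpI hpf) (hT q hqI hqf)
        have := (S.a (S.flip e)).strictMono ((S.a e).mapsTo xI) xI h
        rwa [S.inv _ _ xI] at this
      · exact adj_lemma S e hpI hqI x1 x2 hpf hqf hno h (hT p hpI hpf) (hT q hqI hqf)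
    obtain ⟨k, hk0, hkT⟩ := hk
    exact hqb ⟨k * c, mul_ne_zero hk0 hc, fun ℓ => by rw [hkT, hcT]; ring⟩
  have g0 := hT 0 z0 (S.a e).map_zero
  refine ⟨T 0, g0.1, g0.2.1, fun p hp hf => ?_⟩
  obtain ⟨c, -, hc⟩ := claim p hp (hf e)
  refine ⟨c, ?_⟩
  have : (fun ℓ => c * T 0 ℓ) = T p := funext fun ℓ => (hc ℓ).symm
  rw [this]
  exact hT p hp (hf e)


theorem wsum_perm {ι : Type*} (τ : ι → ℝ) {l l' : List ι} (h : l.Perm l') : wsum τ l = wsum τ l' :=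
  (h.map τ).sum_eq

theorem wsum_neg_of {ι : Type*} {τ : ι → ℝ} {l : List ι} (hl : l ≠ []) (h : ∀ ℓ ∈ l, τ ℓ < 0) : wsum τ l < 0 := by
  induction l with
  | nil => exact absurd rfl hl
  | cons ℓ l ih =>
    rw [wsum_cons]
    have h1 := h ℓ (by simp)
    by_cases h2 : l = []
    · subst h2; rw [wsum_nil]; linarith
    · have := ih h2 (fun k hk => h k (by simp [hk])); linarith

theorem exists_BW {ι : Type*} {τ : ι → ℝ} {B : ℝ} (hB : ∀ ℓ, |τ ℓ| ≤ B) (n : ℕ) :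
    ∀ l : List ι, l.length = n → |wsum τ l| ≤ B → ∃ l' : List ι, l'.Perm l ∧ BW τ B l' := by
  classical
  induction n with
  | zero =>
    intro l hl _
    have : l = [] := List.length_eq_zero_iff.1 hl
    subst this
    exact ⟨[], List.Perm.refl _, trivial⟩
  | succ n ih =>
    intro l hl hs
    have hne : l ≠ [] := by rintro rfl; simp at hl
    have hex : ∃ ℓ ∈ l, |wsum τ l - τ ℓ| ≤ B := by
      rcases le_total 0 (wsum τ l) with h | h
      · by_contra hc
        push Not at hc
        have : wsum τ l < 0 := wsum_neg_of hne (fun ℓ hℓ => by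
          by_contra h2
          push Not at h2
          have h3 := hc ℓ hℓ
          have h4 := abs_le.1 (hB ℓ)
          have h5 := abs_le.1 hs
          have : |wsum τ l - τ ℓ| ≤ B := abs_le.2 ⟨by linarith, by linarith⟩
          linarith)
        linarith
      · by_contra hc
        push Not at hc
        have : wsum (fun ℓ => (-1) * τ ℓ) l < 0 := wsum_neg_of hne (fun ℓ hℓ => by
          by_contra h2
          push Not at h2
          have h3 := hc ℓ hℓ
          have h4 := abs_le.1 (hB ℓ)
          have h5 := abs_le.1 hs
          have : |wsum τ l - τ ℓ| ≤ B := abs_le.2 ⟨by linarith, by linarith⟩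
          linarith)
        rw [wsum_smul] at this
        linarith
    obtain ⟨ℓ, hℓ, hle⟩ := hex
    have hp := List.perm_cons_erase hℓ
    have hsum : wsum τ l = τ ℓ + wsum τ (l.erase ℓ) := by rw [wsum_perm τ hp, wsum_cons]
    obtain ⟨l', h1, h2⟩ := ih (l.erase ℓ) (by rw [List.length_erase_of_mem hℓ, hl]; rfl) (by
      have : wsum τ l - τ ℓ = wsum τ (l.erase ℓ) := by rw [hsum]; ring
      rwa [this] at hle)
    refine ⟨ℓ :: l', (h1.cons ℓ).trans hp.symm, h2, ?_⟩
    rw [wsum_cons, wsum_perm τ h1, ← hsum]; exact hs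

/-- local uniform control of words near a point -/
def Loc {ι : Type} (S : LSys ι) (τ : ι → ℝ) (C x : ℝ) : Prop :=
  ∃ r > 0, ∃ M L : ℝ, ∃ F : List ι → ℂ → ℂ, ∀ l, |wsum τ l| ≤ C →
    DifferentiableOn ℂ (F l) (Metric.ball (x:ℂ) r) ∧ (∀ z ∈ Metric.ball (x:ℂ) r, ‖F l z‖ ≤ M) ∧
    (∀ y ∈ Icc (0:ℝ) 1, |y - x| < r → F l (y:ℂ) = (((S.wd l).toFun y : ℝ) : ℂ)) ∧
    ∀ l', |wsum τ l'| ≤ C → ∀ z ∈ Metric.ball (x:ℂ) r, ‖F l z - F l' z‖ ≤ L * |wsum τ l - wsum τ l'|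

theorem Loc.near {ι : Type} {S : LSys ι} {τ : ι → ℝ} {C p : ℝ} (h : Loc S τ C p) :
    ∃ r > 0, ∀ x, |x - p| < r → Loc S τ C x := by
  obtain ⟨r, hr, M, L, F, hF⟩ := h
  refine ⟨r, hr, fun x hx => ⟨r - |x - p|, by linarith, M, L, F, fun l hl => ?_⟩⟩
  have hsub : Metric.ball (x:ℂ) (r - |x - p|) ⊆ Metric.ball (p:ℂ) r := by
    apply Metric.ball_subset_ball'
    rw [ofReal_dist]; linarith
  obtain ⟨h1, h2, h3, h4⟩ := hF l hl
  refine ⟨h1.mono hsub, fun z hz => h2 z (hsub hz), fun y hy hyx => h3 y hy ?_, fun l' hl' z hz => h4 l' hl' z (hsub hz)⟩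
  have := abs_sub_le y x p; linarith

theorem Loc.of_germ {ι : Type} [Finite ι] {S : LSys ι} {τ : ι → ℝ} {C p c : ℝ}
    (h : Germ S p (fun ℓ => c * τ ℓ)) : Loc S τ C p := by
  obtain ⟨b, hb⟩ := Finite.exists_le (fun ℓ => |c * τ ℓ|)
  obtain ⟨ℓ₀, -⟩ := h.1
  have hb0 : 0 ≤ b := (abs_nonneg _).trans (hb ℓ₀)
  obtain ⟨r, hr, L, F, hF⟩ := h.2.2.2 (max (|c| * C) b) (hb0.trans (le_max_right _ _))
  have hex : ∀ l : List ι, ∃ l' : List ι, |wsum τ l| ≤ C → l'.Perm l ∧ BW (fun ℓ => c * τ ℓ) (max (|c| * C) b) l' := by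
    intro l
    by_cases hl : |wsum τ l| ≤ C
    · obtain ⟨l', h1, h2⟩ := exists_BW (τ := fun ℓ => c * τ ℓ) (B := max (|c| * C) b)
        (fun ℓ => (hb ℓ).trans (le_max_right _ _)) _ l rfl (by
          rw [wsum_smul, abs_mul]
          exact (mul_le_mul_of_nonneg_left hl (abs_nonneg c)).trans (le_max_left _ _))
      exact ⟨l', fun _ => ⟨h1, h2⟩⟩
    · exact ⟨[], fun h => absurd h hl⟩
  choose P hP using hex
  refine ⟨r, hr, 2, L * |c|, fun l => F (P l), fun l hl => ?_⟩
  obtain ⟨h1, h2, h3, h4⟩ := hF (P l) (hP l hl).2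
  refine ⟨h1, h2, fun y hy hyr => ?_, fun l' hl' z hz => ?_⟩
  · show F (P l) (y:ℂ) = _
    rw [h3 y hy hyr, S.wd_perm (hP l hl).1 y hy]
  · have := h4 (P l') (hP l' hl').2 z hz
    rwa [wsum_perm _ (hP l hl).1, wsum_perm _ (hP l' hl').1, wsum_smul, wsum_smul, ← mul_sub, abs_mul, ← mul_assoc] at this

theorem Loc.pull {ι : Type} {S : LSys ι} {τ : ι → ℝ} {C y : ℝ} (hy : y ∈ Icc (0:ℝ) 1) (e : ι)
    (h : Loc S τ C ((S.a e).toFun y)) : Loc S τ C y := by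
  obtain ⟨r, hr, M, L, F, hF⟩ := h
  obtain ⟨r1, hr1, H, hH, hHe⟩ := ext_ball ((S.a e).analytic y hy)
  obtain ⟨U, hU, hK, G, hG, hGe⟩ := ext_global (S.a (S.flip e)).analytic
  have hK' : KI ⊆ U := hK
  obtain ⟨δ, hδ, hδU⟩ := KI_compact.exists_cthickening_subset_open hU hK'
  set K' := Metric.cthickening δ KI with hKdef
  have hKc : IsCompact K' := KI_compact.cthickening
  have hKconv : Convex ℝ K' := KI_convex.cthickening δ
  obtain ⟨M1, hM1⟩ := hKc.exists_bound_of_continuousOn (f := deriv G) ((hG.deriv hU).continuousOn.mono hδU)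
  obtain ⟨M2, hM2⟩ := hKc.exists_bound_of_continuousOn (hG.continuousOn.mono hδU)
  have hGl : ∀ a ∈ K', ∀ b ∈ K', ‖G a - G b‖ ≤ M1 * ‖a - b‖ := fun a ha b hb =>
    hKconv.norm_image_sub_le_of_norm_deriv_le (f := G) (fun z hz => (hG z (hδU hz)).differentiableAt (hU.mem_nhds (hδU hz)))
      hM1 hb ha
  have hM10 : 0 ≤ M1 := (norm_nonneg _).trans (hM1 _ (Metric.self_subset_cthickening _ (mem_KI hy)))
  set q := (S.a e).toFun y with hq
  have hqI : q ∈ Icc (0:ℝ) 1 := (S.a e).mapsTo hy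
  set M3 := 2 * |M| + 1 with hM3
  have hM30 : 0 < M3 := by positivity
  set ε := min r (r * δ / M3) with hε
  have hε0 : 0 < ε := lt_min hr (by positivity)
  have hHq : H (y:ℂ) = (q:ℂ) := hHe y (by simpa using hr1)
  have hHc : ContinuousAt H (y:ℂ) := (hH.differentiableAt (Metric.ball_mem_nhds _ hr1)).continuousAt
  obtain ⟨r2, hr2, hr2H⟩ := Metric.continuousAt_iff.1 hHc ε hε0
  rw [hHq] at hr2H
  have main : ∀ l, |wsum τ l| ≤ C → ∀ w, dist w (q:ℂ) < ε → w ∈ Metric.ball (q:ℂ) r ∧ F l w ∈ K' := by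
    intro l hl w hw
    have hwr : w ∈ Metric.ball (q:ℂ) r := hw.trans_le (min_le_left _ _)
    refine ⟨hwr, ?_⟩
    obtain ⟨h1, h2, h3, -⟩ := hF l hl
    have hc : (q:ℂ) ∈ Metric.ball (q:ℂ) r := Metric.mem_ball_self hr
    have hFq : F l (q:ℂ) = (((S.wd l).toFun q : ℝ) : ℂ) := h3 q hqI (by simpa using hr)
    have hmaps : MapsTo (F l) (Metric.ball (q:ℂ) r) (Metric.ball (F l q) M3) := by
      intro z hz
      rw [Metric.mem_ball, dist_eq_norm]
      have a1 := h2 z hz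
      have a2 := h2 _ hc
      have a3 := norm_sub_le (F l z) (F l q)
      have := le_abs_self M
      rw [hM3]; linarith
    have hd := Complex.dist_le_div_mul_dist_of_mapsTo_ball h1 (hmaps.mono_right Metric.ball_subset_closedBall) hwr
    refine Metric.mem_cthickening_of_dist_le _ (F l q) _ _ ?_ (hd.trans ?_)
    · rw [hFq]; exact mem_KI ((S.wd l).mapsTo hqI)
    · have : dist w (q:ℂ) ≤ r * δ / M3 := hw.le.trans (min_le_right _ _)
      calc M3 / r * dist w (q:ℂ) ≤ M3 / r * (r * δ / M3) := by gcongr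
        _ = δ := by field_simp
  have hball : ∀ z ∈ Metric.ball (y:ℂ) (min r1 r2), z ∈ Metric.ball (y:ℂ) r1 ∧ dist (H z) (q:ℂ) < ε := by
    intro z hz
    exact ⟨Metric.ball_subset_ball (min_le_left _ _) hz, hr2H (Metric.ball_subset_ball (min_le_right _ _) hz)⟩
  refine ⟨min r1 r2, lt_min hr1 hr2, M2, M1 * L, fun l z => G (F l (H z)), fun l hl => ?_⟩
  obtain ⟨h1, h2, h3, h4⟩ := hF l hl
  refine ⟨?_, ?_, ?_, ?_⟩
  · refine hG.comp (h1.comp (hH.mono (Metric.ball_subset_ball (min_le_left _ _))) ?_) ?_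
    · intro z hz; exact (main l hl _ (hball z hz).2).1
    · intro z hz; exact hδU (main l hl _ (hball z hz).2).2
  · intro z hz; exact hM2 _ (main l hl _ (hball z hz).2).2
  · intro x hx hxy
    have hxb : (x:ℂ) ∈ Metric.ball (y:ℂ) (min r1 r2) := by rw [Metric.mem_ball, ofReal_dist]; exact hxy
    have e1 := hHe x (hxy.trans_le (min_le_left _ _))
    have e2 := (main l hl _ (hball _ hxb).2).1
    rw [e1, Metric.mem_ball, ofReal_dist] at e2
    simp only
    rw [e1, h3 _ ((S.a e).mapsTo hx) e2, hGe _ ((S.wd l).mapsTo ((S.a e).mapsTo hx)), ← S.wd_comm _ _ hx,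
      S.inv _ _ ((S.wd l).mapsTo hx)]
  · intro l' hl' z hz
    have b1 := main l hl _ (hball z hz).2
    have b2 := main l' hl' _ (hball z hz).2
    refine (hGl _ b1.2 _ b2.2).trans ?_
    rw [mul_assoc]
    exact mul_le_mul_of_nonneg_left (h4 l' hl' _ b1.1) hM10

theorem Loc.all {ι : Type} [Finite ι] {S : LSys ι} {τ : ι → ℝ}
    (hg : ∀ p ∈ Icc (0:ℝ) 1, (∀ ℓ, (S.a ℓ).toFun p = p) → ∃ c : ℝ, Germ S p (fun ℓ => c * τ ℓ)) (C : ℝ)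
    {x : ℝ} (hx : x ∈ Icc (0:ℝ) 1) : Loc S τ C x := by
  by_cases h : ∀ ℓ, (S.a ℓ).toFun x = x
  · obtain ⟨c, hc⟩ := hg x hx h
    exact Loc.of_germ hc
  push Not at h
  obtain ⟨e, he⟩ := h
  obtain ⟨p, hp, hpf, hlim, -⟩ := orbit_lim (S.a e) hx he
  have hall : ∀ ℓ, (S.a ℓ).toFun p = p := by
    intro ℓ
    by_contra hne
    exact he (fix_comm (S.comm ℓ e) hp hne hpf x hx)
  obtain ⟨c, hc⟩ := hg p hp hall
  obtain ⟨r, hr, hnear⟩ := (Loc.of_germ (C := C) hc).near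
  obtain ⟨n, hn⟩ := (Metric.tendsto_nhds.1 hlim r hr).exists
  have := hnear _ (by rw [← Real.dist_eq]; exact hn)
  clear hn
  induction n with
  | zero => exact this
  | succ n ih =>
    rw [Function.iterate_succ_apply'] at this
    exact ih (Loc.pull (iter_mapsTo _ hx n) e this)

theorem KP {ι : Type} [Finite ι] {S : LSys ι} {τ : ι → ℝ}
    (hg : ∀ p ∈ Icc (0:ℝ) 1, (∀ ℓ, (S.a ℓ).toFun p = p) → ∃ c : ℝ, Germ S p (fun ℓ => c * τ ℓ)) (C : ℝ) :
    ∃ U : Set ℂ, IsOpen U ∧ KI ⊆ U ∧ ∃ L : ℝ, 0 ≤ L ∧ ∃ G : List ι → ℂ → ℂ, ∀ l, |wsum τ l| ≤ C →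
      DifferentiableOn ℂ (G l) U ∧ (∀ x ∈ Icc (0:ℝ) 1, G l (x:ℂ) = (((S.wd l).toFun x : ℝ):ℂ)) ∧
      ∀ l', |wsum τ l'| ≤ C → ∀ z ∈ U, ‖G l z - G l' z‖ ≤ L * |wsum τ l - wsum τ l'| := by
  have hex : ∀ x : ℝ, ∃ r : ℝ, ∃ L : ℝ, ∃ F : List ι → ℂ → ℂ, x ∈ Icc (0:ℝ) 1 → 0 < r ∧ ∀ l, |wsum τ l| ≤ C →
    DifferentiableOn ℂ (F l) (Metric.ball (x:ℂ) r) ∧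
    (∀ y ∈ Icc (0:ℝ) 1, |y - x| < r → F l (y:ℂ) = (((S.wd l).toFun y : ℝ) : ℂ)) ∧
    ∀ l', |wsum τ l'| ≤ C → ∀ z ∈ Metric.ball (x:ℂ) r, ‖F l z - F l' z‖ ≤ L * |wsum τ l - wsum τ l'| := by
    intro x
    by_cases hx : x ∈ Icc (0:ℝ) 1
    · obtain ⟨r, hr, M, L, F, hF⟩ := Loc.all hg C hx
      exact ⟨r, L, F, fun _ => ⟨hr, fun l hl => ⟨(hF l hl).1, (hF l hl).2.2⟩⟩⟩
    · exact ⟨0, 0, fun _ z => z, fun h => absurd h hx⟩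
  choose r L F hF using hex
  obtain ⟨t, ht, hcov⟩ := (isCompact_Icc (a := (0:ℝ)) (b := 1)).elim_nhds_subcover (fun x => Metric.ball x (r x))
    (fun x hx => Metric.ball_mem_nhds _ (hF x hx).1)
  have hgl : ∀ l, ∃ G : ℂ → ℂ, |wsum τ l| ≤ C → ∀ p ∈ t, EqOn G (F p l) (Metric.ball (p:ℂ) (r p)) := by
    intro l
    by_cases hl : |wsum τ l| ≤ C
    · obtain ⟨G, hG⟩ := glue r (fun p => F p l) (S.wd l).toFun (t : Set ℝ) (fun p hp => ht p hp)
        (fun p hp => ((hF p (ht p hp)).2 l hl).1) (fun p hp => ((hF p (ht p hp)).2 l hl).2.1)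
      exact ⟨G, fun _ p hp => hG p hp⟩
    · exact ⟨fun z => z, fun h => absurd h hl⟩
  choose G hG using hgl
  refine ⟨⋃ p ∈ t, Metric.ball (p:ℂ) (r p), isOpen_biUnion fun p _ => Metric.isOpen_ball, ?_, ∑ p ∈ t, |L p|,
    Finset.sum_nonneg (fun _ _ => abs_nonneg _), G, fun l hl => ⟨?_, ?_, ?_⟩⟩
  · rintro _ ⟨x, hx, rfl⟩
    obtain ⟨p, hp, hxp⟩ := mem_iUnion₂.1 (hcov hx)
    refine mem_iUnion₂.2 ⟨p, hp, ?_⟩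
    rw [Metric.mem_ball, ofReal_dist, ← Real.dist_eq]; exact hxp
  · intro z hz
    obtain ⟨p, hp, hzp⟩ := mem_iUnion₂.1 hz
    have h1 := ((hF p (ht p hp)).2 l hl).1.congr (hG l hl p hp)
    exact (h1.differentiableAt (Metric.isOpen_ball.mem_nhds hzp)).differentiableWithinAt
  · intro x hx
    obtain ⟨p, hp, hxp⟩ := mem_iUnion₂.1 (hcov hx)
    have h2 : |x - p| < r p := by rw [← Real.dist_eq]; exact hxp
    rw [hG l hl p hp (by rw [Metric.mem_ball, ofReal_dist]; exact h2)]
    exact ((hF p (ht p hp)).2 l hl).2.1 x hx h2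
  · intro l' hl' z hz
    obtain ⟨p, hp, hzp⟩ := mem_iUnion₂.1 hz
    rw [hG l hl p hp hzp, hG l' hl' p hp hzp]
    refine (((hF p (ht p hp)).2 l hl).2.2 l' hl' z hzp).trans ?_
    gcongr
    exact (le_abs_self _).trans (Finset.single_le_sum (f := fun p => |L p|) (fun _ _ => abs_nonneg _) hp)


theorem AnDiffeo.inv_comm {f h : AnDiffeo}
    (hc : ∀ x ∈ Icc (0:ℝ) 1, f.toFun (h.toFun x) = h.toFun (f.toFun x)) :
    ∀ x ∈ Icc (0:ℝ) 1, f.inv.toFun (h.toFun x) = h.toFun (f.inv.toFun x) := by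
  intro x hx
  have hy := f.inv.mapsTo hx
  have := hc _ hy
  rw [f.mul_inv hx] at this
  rw [← this, f.inv_mul (h.mapsTo hy)]

theorem AnDiffeo.pow_comm {f h : AnDiffeo}
    (hc : ∀ x ∈ Icc (0:ℝ) 1, f.toFun (h.toFun x) = h.toFun (f.toFun x)) (n : ℕ) :
    ∀ x ∈ Icc (0:ℝ) 1, (f.pow n).toFun (h.toFun x) = h.toFun ((f.pow n).toFun x) := by
  induction n with
  | zero => intro x _; rfl
  | succ n ih =>
    intro x hx
    show f.toFun ((f.pow n).toFun (h.toFun x)) = h.toFun (f.toFun ((f.pow n).toFun x))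
    rw [ih x hx, hc _ ((f.pow n).mapsTo hx)]

theorem AnDiffeo.pow_congr {f h : AnDiffeo}
    (hc : ∀ x ∈ Icc (0:ℝ) 1, f.toFun x = h.toFun x) (n : ℕ) :
    ∀ x ∈ Icc (0:ℝ) 1, (f.pow n).toFun x = (h.pow n).toFun x := by
  induction n with
  | zero => intro x _; rfl
  | succ n ih =>
    intro x hx
    show f.toFun ((f.pow n).toFun x) = h.toFun ((h.pow n).toFun x)
    rw [ih x hx, hc _ ((h.pow n).mapsTo hx)]

theorem contr_cyclic {d : ℕ} (ρ : AnAction d) (g g' : AnDiffeo)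
    (hg : ∀ x ∈ Icc (0:ℝ) 1, g.toFun (g'.toFun x) = x)
    (n : Fin d → ℕ) (b : Fin d → Bool)
    (h : ∀ i, ∀ x ∈ Icc (0:ℝ) 1, (ρ.gen i).toFun x = ((bif b i then g else g').pow (n i)).toFun x) :
    Contr ρ := by
  obtain ⟨A, B, hAB, U, hU, hK, L, Φ, Ψ, hΦ⟩ := lin_diffeo g
  have hp : ∀ s : ℝ, ((projIcc (0:ℝ) 1 zero_le_one s : Icc (0:ℝ) 1) : ℝ) ∈ Icc (0:ℝ) 1 := fun s => Subtype.coe_prop _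
  let p : ℝ → ℝ := fun s => (projIcc (0:ℝ) 1 zero_le_one s : Icc (0:ℝ) 1)
  have hpI : ∀ s, p s ∈ Icc (0:ℝ) 1 := hp
  have hps : ∀ s ∈ Icc (0:ℝ) 1, p s = s := fun s hs => by
    show ((projIcc (0:ℝ) 1 zero_le_one s : Icc (0:ℝ) 1) : ℝ) = s
    rw [projIcc_of_mem _ hs]
  have FA : Fam (fun s => (A s).toFun) :=
    Fam.of_lip hU hK L Φ (fun s hs => (hΦ s hs).1) (fun s hs x hx => ((hΦ s hs).2.2.1 x hx).1)
      (fun s hs s' hs' z hz => ((hΦ s hs).2.2.2 s' hs' z hz).1)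
  have FB : Fam (fun s => (B s).toFun) :=
    Fam.of_lip hU hK L Ψ (fun s hs => (hΦ s hs).2.1) (fun s hs x hx => ((hΦ s hs).2.2.1 x hx).2)
      (fun s hs s' hs' z hz => ((hΦ s hs).2.2.2 s' hs' z hz).2)
  have hc : ∀ s, ∀ b b' : Bool, ∀ x ∈ Icc (0:ℝ) 1,
      (bif b then A (p s) else B (p s)).toFun ((bif b' then A (p s) else B (p s)).toFun x)
      = (bif b' then A (p s) else B (p s)).toFun ((bif b then A (p s) else B (p s)).toFun x) := by
    intro s b b' x hx
    obtain ⟨-, h1, h2⟩ := hAB (p s) (hpI s) x hx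
    cases b <;> cases b' <;> simp [h1, h2]
  refine ⟨fun s => ⟨fun i => (bif b i then A (p s) else B (p s)).pow (n i), fun i j x hx => ?_⟩, ?_, ?_, ?_⟩
  · refine AnDiffeo.pow_comm (fun y hy => ?_) _ x hx
    exact (AnDiffeo.pow_comm (fun z hz => hc s (b j) (b i) z hz) _ y hy).symm
  · intro i
    show Fam (fun s => ((bif b i then A (p s) else B (p s)).pow (n i)).toFun)
    cases b i
    · exact (FB.pow (n i)).congr (fun s hs x hx => by simp only [hps s hs, cond_false])
    · exact (FA.pow (n i)).congr (fun s hs x hx => by simp only [hps s hs, cond_true])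
  · intro i x hx
    rw [h i x hx]
    refine AnDiffeo.pow_congr (fun y hy => ?_) _ x hx
    have h0 : (0:ℝ) ∈ Icc (0:ℝ) 1 := by simp
    rw [hps 0 h0]
    have hA0 : ∀ y ∈ Icc (0:ℝ) 1, (A 0).toFun y = g.toFun y := fun y hy => by
      rw [(hAB 0 h0 y hy).1]; simp [lin]
    cases b i
    · show (B 0).toFun y = g'.toFun y
      have := (hAB 0 h0 _ (g'.mapsTo hy)).2.2
      rwa [hA0 _ (g'.mapsTo hy), hg y hy] at this
    · exact hA0 y hy
  · intro i x hx
    have h0 : (1:ℝ) ∈ Icc (0:ℝ) 1 := by simp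
    have hA1 : ∀ y ∈ Icc (0:ℝ) 1, (A 1).toFun y = y := fun y hy => by
      rw [(hAB 1 h0 y hy).1]; simp [lin]
    have hB1 : ∀ y ∈ Icc (0:ℝ) 1, (B 1).toFun y = y := fun y hy => by
      have := (hAB 1 h0 y hy).2.2
      rwa [hA1 y hy] at this
    have := AnDiffeo.pow_congr (f := bif b i then A (p 1) else B (p 1)) (h := AnDiffeo.one) (fun y hy => by
      rw [hps 1 h0]
      cases b i
      · exact hB1 y hy
      · exact hA1 y hy) (n i) x hx
    refine this.trans ?_
    rw [AnDiffeo.pow_toFun]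
    show id^[n i] x = x
    simp

/-- conclusion of `KP` -/
def KPc {ι : Type} (S : LSys ι) (τ : ι → ℝ) : Prop :=
  ∀ C : ℝ, ∃ U : Set ℂ, IsOpen U ∧ KI ⊆ U ∧ ∃ L : ℝ, 0 ≤ L ∧ ∃ G : List ι → ℂ → ℂ,
    ∀ l, |wsum τ l| ≤ C → DifferentiableOn ℂ (G l) U ∧
      (∀ x ∈ Icc (0:ℝ) 1, G l (x:ℂ) = (((S.wd l).toFun x : ℝ) : ℂ)) ∧
      ∀ l', |wsum τ l'| ≤ C → ∀ z ∈ U, ‖G l z - G l' z‖ ≤ L * |wsum τ l - wsum τ l'|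

theorem KPc.eq {ι : Type} {S : LSys ι} {τ : ι → ℝ} (h : KPc S τ) {l l' : List ι}
    (he : wsum τ l = wsum τ l') : ∀ x ∈ Icc (0:ℝ) 1, (S.wd l).toFun x = (S.wd l').toFun x := by
  intro x hx
  obtain ⟨U, hU, hK, L, hL, G, hG⟩ := h |wsum τ l|
  obtain ⟨-, h2, h3⟩ := hG l le_rfl
  obtain ⟨-, h2', -⟩ := hG l' (by rw [he])
  have := h3 l' (by rw [he]) x (hK (mem_KI hx))
  rw [he, sub_self, abs_zero, mul_zero, h2 x hx, h2' x hx, norm_le_zero_iff, sub_eq_zero] at this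
  exact_mod_cast this

theorem wsum_map_flip {ι : Type} {fl : ι → ι} {τ : ι → ℝ} (h : ∀ ℓ, τ (fl ℓ) = -τ ℓ) (l : List ι) :
    wsum τ (l.map fl) = - wsum τ l := by
  induction l with
  | nil => simp [wsum_nil]
  | cons a l ih => rw [List.map_cons, wsum_cons, wsum_cons, ih, h]; ring

theorem wsum_rep {ι : Type} (τ : ι → ℝ) (l : List ι) (n : ℕ) :
    wsum τ (List.replicate n l).flatten = n * wsum τ l := by
  induction n with
  | zero => simp [wsum_nil]
  | succ n ih => rw [List.replicate_succ, List.flatten_cons, wsum_append, ih]; push_cast; ring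

theorem wd_rep {ι : Type} (S : LSys ι) (l : List ι) (n : ℕ) (x : ℝ) :
    (S.wd (List.replicate n l).flatten).toFun x = ((S.wd l).pow n).toFun x := by
  induction n with
  | zero => rfl
  | succ n ih => rw [List.replicate_succ, List.flatten_cons, S.wd_append, ih]; rfl


theorem dense_flow {ι : Type} {S : LSys ι} {τ : ι → ℝ} (h : KPc S τ)
    (hd : ∀ s : ℝ, ∀ ε > 0, ∃ l, |wsum τ l - s| < ε) (b : ℝ) (hb : 0 ≤ b) :
    ∃ φ : ℝ → AnDiffeo,
      (∀ s s', |s| ≤ b → |s'| ≤ b → ∀ x ∈ Icc (0:ℝ) 1,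
        (φ s).toFun ((φ s').toFun x) = (φ s').toFun ((φ s).toFun x)) ∧
      (∀ l, |wsum τ l| ≤ b → ∀ x ∈ Icc (0:ℝ) 1, (φ (wsum τ l)).toFun x = (S.wd l).toFun x) ∧
      ∃ U : Set ℂ, IsOpen U ∧ KI ⊆ U ∧ ∃ L : ℝ, 0 ≤ L ∧ ∃ Φ : ℝ → ℂ → ℂ, ∀ s, |s| ≤ b →
        DifferentiableOn ℂ (Φ s) U ∧ (∀ x ∈ Icc (0:ℝ) 1, Φ s (x:ℂ) = (((φ s).toFun x : ℝ) : ℂ)) ∧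
        ∀ s', |s'| ≤ b → ∀ z ∈ U, ‖Φ s z - Φ s' z‖ ≤ L * |s - s'| := by
  obtain ⟨U, hU, hK, L, hL, G, hG⟩ := h (2 * b + 2)
  have hW : ∀ s : ℝ, ∀ n : ℕ, ∃ l, |wsum τ l - s| < 1 / ((n:ℝ) + 1) := fun s n => hd s _ (by positivity)
  choose W hW using hW
  have hone : ∀ n : ℕ, 1 / ((n:ℝ) + 1) ≤ 1 := fun n => by
    rw [div_le_one (by positivity)]; have : (0:ℝ) ≤ n := n.cast_nonneg
    linarith
  have hWt : ∀ s, Tendsto (fun n => wsum τ (W s n)) atTop (𝓝 s) := by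
    intro s
    rw [tendsto_iff_dist_tendsto_zero]
    exact squeeze_zero (fun _ => dist_nonneg) (fun n => (hW s n).le) tendsto_one_div_add_atTop_nhds_zero_nat
  have hWb : ∀ s, |s| ≤ 2 * b → ∀ n, |wsum τ (W s n)| ≤ 2 * b + 2 := by
    intro s hs n
    have h1 := hW s n
    have h2 := hone n
    rw [abs_lt] at h1; rw [abs_le] at hs ⊢
    constructor <;> linarith
  have hex : ∀ s z, ∃ w, |s| ≤ 2 * b → z ∈ U → Tendsto (fun n => G (W s n) z) atTop (𝓝 w) := by
    intro s z
    by_cases hs : |s| ≤ 2 * b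
    · by_cases hz : z ∈ U
      · have hc : CauchySeq (fun n => G (W s n) z) := by
          refine cauchySeq_of_le_tendsto_0 (fun n : ℕ => L * (2 * (1 / ((n:ℝ) + 1)))) (fun n m N hn hm => ?_) ?_
          · rw [dist_eq_norm]
            refine ((hG _ (hWb s hs n)).2.2 _ (hWb s hs m) z hz).trans ?_
            refine mul_le_mul_of_nonneg_left ?_ hL
            have h1 := (hW s n).le.trans (one_div_le_one_div_of_le (by positivity) (by
              have : (N:ℝ) ≤ n := by exact_mod_cast hn
              linarith) : 1 / ((n:ℝ) + 1) ≤ 1 / ((N:ℝ) + 1))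
            have h2 := (hW s m).le.trans (one_div_le_one_div_of_le (by positivity) (by
              have : (N:ℝ) ≤ m := by exact_mod_cast hm
              linarith) : 1 / ((m:ℝ) + 1) ≤ 1 / ((N:ℝ) + 1))
            rw [abs_le] at h1 h2 ⊢
            constructor <;> linarith [h1.1, h1.2, h2.1, h2.2]
          · have := (tendsto_one_div_add_atTop_nhds_zero_nat (𝕜 := ℝ)).const_mul 2 |>.const_mul L
            simpa using this
        obtain ⟨w, hw⟩ := cauchySeq_tendsto_of_complete hc
        exact ⟨w, fun _ _ => hw⟩
      · exact ⟨0, fun _ h => absurd h hz⟩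
    · exact ⟨0, fun h => absurd h hs⟩
  choose Φ hΦ using hex
  have est : ∀ s, |s| ≤ 2 * b → ∀ l, |wsum τ l| ≤ 2 * b + 2 → ∀ z ∈ U,
      ‖Φ s z - G l z‖ ≤ L * |s - wsum τ l| := by
    intro s hs l hl z hz
    refine le_of_tendsto_of_tendsto' ((hΦ s z hs hz).sub_const _).norm
      ((((hWt s).sub_const (wsum τ l)).abs).const_mul L) fun n => ?_
    exact (hG _ (hWb s hs n)).2.2 l hl z hz
  have lip : ∀ s, |s| ≤ 2 * b → ∀ s', |s'| ≤ 2 * b → ∀ z ∈ U, ‖Φ s z - Φ s' z‖ ≤ L * |s - s'| := by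
    intro s hs s' hs' z hz
    refine le_of_tendsto_of_tendsto' ((hΦ s' z hs' hz).const_sub (Φ s z)).norm
      ((((hWt s').const_sub s).abs).const_mul L) fun n => ?_
    exact est s hs _ (hWb s' hs' n) z hz
  have diff : ∀ s, |s| ≤ 2 * b → DifferentiableOn ℂ (Φ s) U := by
    intro s hs
    have hu : TendstoUniformlyOn (fun n => G (W s n)) (Φ s) atTop U := by
      rw [Metric.tendstoUniformlyOn_iff]
      intro ε hε
      have ht : Tendsto (fun n => L * |s - wsum τ (W s n)|) atTop (𝓝 0) := by
        have := (((hWt s).const_sub s).abs).const_mul L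
        simpa using this
      filter_upwards [ht.eventually (gt_mem_nhds hε)] with n hn z hz
      rw [dist_eq_norm]
      exact (est s hs _ (hWb s hs n) z hz).trans_lt hn
    exact hu.tendstoLocallyUniformlyOn.differentiableOn
      (Eventually.of_forall fun n => (hG _ (hWb s hs n)).1) hU
  let f : ℝ → ℝ → ℝ := fun s x => (Φ s (x:ℂ)).re
  have hxU : ∀ x ∈ Icc (0:ℝ) 1, (x:ℂ) ∈ U := fun x hx => hK (mem_KI hx)
  have ft : ∀ s, |s| ≤ 2 * b → ∀ x ∈ Icc (0:ℝ) 1,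
      Tendsto (fun n => (S.wd (W s n)).toFun x) atTop (𝓝 (f s x)) := by
    intro s hs x hx
    have := (Complex.continuous_re.tendsto _).comp (hΦ s x hs (hxU x hx))
    refine this.congr fun n => ?_
    simp [(hG _ (hWb s hs n)).2.1 x hx]
  have fe : ∀ s, |s| ≤ 2 * b → ∀ x ∈ Icc (0:ℝ) 1, Φ s (x:ℂ) = ((f s x : ℝ) : ℂ) := by
    intro s hs x hx
    refine tendsto_nhds_unique (hΦ s x hs (hxU x hx)) ?_
    refine ((Complex.continuous_ofReal.tendsto _).comp (ft s hs x hx)).congr fun n => ?_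
    simp [(hG _ (hWb s hs n)).2.1 x hx]
  have festim : ∀ s, |s| ≤ 2 * b → ∀ l, |wsum τ l| ≤ 2 * b + 2 → ∀ x ∈ Icc (0:ℝ) 1,
      |f s x - (S.wd l).toFun x| ≤ L * |s - wsum τ l| := by
    intro s hs l hl x hx
    have := est s hs l hl x (hxU x hx)
    rwa [fe s hs x hx, (hG l hl).2.1 x hx, ← Complex.ofReal_sub, Complex.norm_real, Real.norm_eq_abs] at this
  have fmaps : ∀ s, |s| ≤ 2 * b → MapsTo (f s) (Icc (0:ℝ) 1) (Icc (0:ℝ) 1) := fun s hs x hx =>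
    isClosed_Icc.mem_of_tendsto (ft s hs x hx) (Eventually.of_forall fun n => (S.wd _).mapsTo hx)
  have fmono : ∀ s, |s| ≤ 2 * b → MonotoneOn (f s) (Icc (0:ℝ) 1) := fun s hs x hx y hy hxy =>
    le_of_tendsto_of_tendsto' (ft s hs x hx) (ft s hs y hy) fun n => (S.wd _).strictMono.monotoneOn hx hy hxy
  have fan : ∀ s, |s| ≤ 2 * b → AnalyticOnNhd ℝ (f s) (Icc (0:ℝ) 1) := fun s hs x hx =>
    re_analyticAt ((diff s hs).analyticAt (hU.mem_nhds (hxU x hx)))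
  have hb2 : ∀ s, |s| ≤ b → |s| ≤ 2 * b := fun s hs => by linarith
  have fadd : ∀ s s', |s| ≤ b → |s'| ≤ b → ∀ x ∈ Icc (0:ℝ) 1, f s (f s' x) = f (s + s') x := by
    intro s s' hs hs' x hx
    have hss : |s + s'| ≤ 2 * b := (abs_add_le s s').trans (by linarith)
    have t1 : Tendsto (fun n => f s ((S.wd (W s' n)).toFun x)) atTop (𝓝 (f s (f s' x))) :=
      ((fan s (hb2 s hs) _ (fmaps s' (hb2 s' hs') hx)).continuousAt.tendsto).comp (ft s' (hb2 s' hs') x hx)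
    have t2 : Tendsto (fun n => f s ((S.wd (W s' n)).toFun x) - (S.wd (W s n)).toFun ((S.wd (W s' n)).toFun x))
        atTop (𝓝 0) := by
      refine squeeze_zero_norm (fun n => festim s (hb2 s hs) _ (hWb s (hb2 s hs) n) _ ((S.wd _).mapsTo hx)) ?_
      have := (((hWt s).const_sub s).abs).const_mul L
      simpa using this
    have t3 : Tendsto (fun n => f (s + s') x - (S.wd (W s n)).toFun ((S.wd (W s' n)).toFun x))
        atTop (𝓝 0) := by
      have : ∀ n, |f (s + s') x - (S.wd (W s n)).toFun ((S.wd (W s' n)).toFun x)| ≤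
          L * |(s + s') - (wsum τ (W s n) + wsum τ (W s' n))| := by
        intro n
        rw [← S.wd_append, ← wsum_append]
        refine festim _ hss _ ?_ x hx
        rw [wsum_append]
        have h1 := hW s n
        have h2 := hW s' n
        have h3 := hone n
        rw [abs_lt] at h1 h2; rw [abs_le] at hss ⊢
        constructor <;> linarith [h1.1, h1.2, h2.1, h2.2]
      refine squeeze_zero_norm this ?_
      have := ((((hWt s).add (hWt s')).const_sub (s + s')).abs).const_mul L
      simpa using this
    have t4 := (t1.sub t2).add t3
    have := tendsto_nhds_unique t4 (tendsto_const_nhds.congr fun n => by ring : Tendsto _ atTop (𝓝 (f (s + s') x)))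
    linarith
  have f0 : ∀ x ∈ Icc (0:ℝ) 1, f 0 x = x := by
    intro x hx
    have := festim 0 (by simpa using hb) [] (by rw [wsum_nil]; simp; linarith) x hx
    rw [wsum_nil, S.wd_nil, sub_zero, abs_zero, mul_zero] at this
    linarith [abs_nonpos_iff.1 this]
  have finv : ∀ s, |s| ≤ b → ∀ x ∈ Icc (0:ℝ) 1, f s (f (-s) x) = x := fun s hs x hx => by
    rw [fadd s (-s) hs (by rwa [abs_neg]) x hx, add_neg_cancel, f0 x hx]
  have finv' : ∀ s, |s| ≤ b → ∀ x ∈ Icc (0:ℝ) 1, f (-s) (f s x) = x := fun s hs x hx => by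
    rw [fadd (-s) s (by rwa [abs_neg]) hs x hx, neg_add_cancel, f0 x hx]
  have hbn : ∀ s, |s| ≤ b → |-s| ≤ 2 * b := fun s hs => by rw [abs_neg]; exact hb2 s hs
  let φ : ℝ → AnDiffeo := fun s => if hs : |s| ≤ b then
    mkDiffeo (f s) (f (-s)) (fan s (hb2 s hs)) (fan _ (hbn s hs)) (fmaps s (hb2 s hs)) (fmaps _ (hbn s hs))
      (fmono s (hb2 s hs)) (finv' s hs) (finv s hs) else AnDiffeo.one
  have hφ : ∀ s, |s| ≤ b → (φ s).toFun = f s := fun s hs => by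
    simp only [φ, dif_pos hs]; rfl
  refine ⟨φ, fun s s' hs hs' x hx => ?_, fun l hl x hx => ?_, U, hU, hK, L, hL, Φ, fun s hs => ⟨diff s (hb2 s hs), fun x hx => ?_, fun s' hs' => lip s (hb2 s hs) s' (hb2 s' hs')⟩⟩
  · rw [hφ s hs, hφ s' hs', fadd s s' hs hs' x hx, fadd s' s hs' hs x hx, add_comm]
  · rw [hφ _ hl]
    have := festim _ (hb2 _ hl) l (by linarith) x hx
    rw [sub_self, abs_zero, mul_zero] at this
    linarith [abs_nonpos_iff.1 this]
  · rw [hφ s hs]; exact fe s (hb2 s hs) x hx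


/-- generators and their inverses -/
def actSys {d : ℕ} (ρ : AnAction d) : LSys (Fin d × Bool) where
  a := fun p => bif p.2 then ρ.gen p.1 else (ρ.gen p.1).inv
  flip := fun p => (p.1, !p.2)
  comm := by
    rintro ⟨i, b⟩ ⟨j, c⟩
    have h1 : ∀ i j, ∀ x ∈ Icc (0:ℝ) 1, (ρ.gen i).inv.toFun ((ρ.gen j).toFun x) = (ρ.gen j).toFun ((ρ.gen i).inv.toFun x) :=
      fun i j => AnDiffeo.inv_comm (ρ.comm i j)
    cases b <;> cases c
    · exact AnDiffeo.inv_comm (fun x hx => (h1 j i x hx).symm)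
    · exact h1 i j
    · exact fun x hx => (h1 j i x hx).symm
    · exact ρ.comm i j
  inv := by
    rintro ⟨i, b⟩ x hx
    cases b
    · exact (ρ.gen i).mul_inv hx
    · exact (ρ.gen i).inv_mul hx
  flip_flip := by
    rintro ⟨i, b⟩
    simp

/-- the group of values of the weight -/
def wgrp {ι : Type} (fl : ι → ι) (τ : ι → ℝ) (h : ∀ ℓ, τ (fl ℓ) = -τ ℓ) : AddSubgroup ℝ where
  carrier := {r | ∃ l, wsum τ l = r}
  zero_mem' := ⟨[], wsum_nil _⟩
  add_mem' := by
    rintro _ _ ⟨l, rfl⟩ ⟨l', rfl⟩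
    exact ⟨l ++ l', wsum_append _ _ _⟩
  neg_mem' := by
    rintro _ ⟨l, rfl⟩
    exact ⟨l.map fl, wsum_map_flip h l⟩

theorem contr_all {d : ℕ} (ρ : AnAction d) : Contr ρ := by
  by_cases hid : ∀ i, ∀ x ∈ Icc (0:ℝ) 1, (ρ.gen i).toFun x = x
  · exact ⟨fun _ => ρ, fun i => Fam.id.congr (fun s _ x hx => (hid i x hx).symm), fun _ _ _ => rfl, hid⟩
  push Not at hid
  obtain ⟨i₀, x₀, hx₀, hne⟩ := hid
  obtain ⟨τ, -, hfl, hgerm⟩ := germ_all (actSys ρ) ⟨(i₀, true), fun h => hne (h x₀ hx₀)⟩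
  have hKP : KPc (actSys ρ) τ := fun C => KP hgerm C
  have hgen : ∀ i, ∀ x, (ρ.gen i).toFun x = ((actSys ρ).wd [(i, true)]).toFun x := fun i x => rfl
  have hws : ∀ i : Fin d, wsum τ [(i, true)] = τ (i, true) := fun i => by
    rw [wsum_cons, wsum_nil, add_zero]
  rcases AddSubgroup.dense_or_cyclic (wgrp _ τ hfl) with hD | ⟨a, ha⟩
  · have hd : ∀ s : ℝ, ∀ ε > 0, ∃ l, |wsum τ l - s| < ε := by
      intro s ε hε
      obtain ⟨y, ⟨l, rfl⟩, hy⟩ := hD.exists_dist_lt s hε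
      exact ⟨l, by rwa [dist_comm, Real.dist_eq] at hy⟩
    have : Nonempty (Fin d) := ⟨i₀⟩
    obtain ⟨b, hb⟩ := Finite.exists_le (fun i : Fin d => |τ (i, true)|)
    have hb0 : 0 ≤ b := (abs_nonneg _).trans (hb i₀)
    obtain ⟨φ, hc, hw, U, hU, hK, L, hL, Φ, hΦ⟩ := dense_flow hKP hd b hb0
    let p : ℝ → ℝ := fun s => (projIcc (0:ℝ) 1 zero_le_one s : Icc (0:ℝ) 1)
    have hpI : ∀ s, p s ∈ Icc (0:ℝ) 1 := fun s => Subtype.coe_prop _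
    have hps : ∀ s ∈ Icc (0:ℝ) 1, p s = s := fun s hs => by
      show ((projIcc (0:ℝ) 1 zero_le_one s : Icc (0:ℝ) 1) : ℝ) = s
      rw [projIcc_of_mem _ hs]
    have hbd : ∀ s ∈ Icc (0:ℝ) 1, ∀ i, |(1 - s) * τ (i, true)| ≤ b := by
      intro s hs i
      rw [abs_mul, abs_of_nonneg (by linarith [hs.2])]
      have := hb i
      have h2 := abs_nonneg (τ (i, true))
      nlinarith [hs.1, mul_nonneg hs.1 h2]
    refine ⟨fun s => ⟨fun i => φ ((1 - p s) * τ (i, true)), fun i j x hx =>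
      hc _ _ (hbd _ (hpI s) i) (hbd _ (hpI s) j) x hx⟩, fun i => ?_, fun i x hx => ?_, fun i x hx => ?_⟩
    · refine Fam.of_lip hU hK (L * |τ (i, true)|) (fun s => Φ ((1 - s) * τ (i, true))) (fun s hs => (hΦ _ (hbd s hs i)).1) (fun s hs x hx => ?_)
        (fun s hs s' hs' z hz => ?_)
      · rw [(hΦ _ (hbd s hs i)).2.1 x hx]
        simp only [hps s hs]
      · refine ((hΦ _ (hbd s hs i)).2.2 _ (hbd s' hs' i) z hz).trans (le_of_eq ?_)
        rw [← sub_mul, abs_mul, sub_sub_sub_cancel_left, abs_sub_comm]; ring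
    · show (φ ((1 - p 0) * τ (i, true))).toFun x = _
      rw [hps 0 (by simp), sub_zero, one_mul, ← hws i, hw _ (by rw [hws]; exact hb i) x hx]
      rfl
    · show (φ ((1 - p 1) * τ (i, true))).toFun x = _
      have h0 : wsum τ [] = 0 := wsum_nil _
      rw [hps 1 (by simp), sub_self, zero_mul, ← h0, hw [] (by rw [h0, abs_zero]; exact hb0) x hx]
      rfl
  · have ham : a ∈ wgrp _ τ hfl := by rw [ha]; exact AddSubgroup.subset_closure rfl
    obtain ⟨l0, hl0⟩ := ham
    have hk : ∀ i : Fin d, ∃ k : ℤ, k • a = τ (i, true) := by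
      intro i
      have : τ (i, true) ∈ wgrp _ τ hfl := ⟨_, hws i⟩
      rw [ha] at this
      exact AddSubgroup.mem_closure_singleton.1 this
    choose k hk using hk
    refine contr_cyclic ρ ((actSys ρ).wd l0) ((actSys ρ).wd (l0.map (actSys ρ).flip)) ?_
      (fun i => (k i).natAbs) (fun i => decide (0 ≤ k i)) ?_
    · intro x hx
      rw [← LSys.wd_append, hKP.eq (l' := []) _ x hx]
      · rfl
      · rw [wsum_append, wsum_map_flip hfl, wsum_nil]; ring
    · intro i x hx
      rw [hgen]
      by_cases h0 : 0 ≤ k i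
      · simp only [h0, decide_true, cond_true]
        rw [← wd_rep]
        refine hKP.eq ?_ x hx
        rw [wsum_rep, hws, hl0, ← hk i, zsmul_eq_mul, Nat.cast_natAbs, abs_of_nonneg h0]
      · simp only [h0, decide_false, cond_false]
        rw [← wd_rep]
        refine hKP.eq ?_ x hx
        rw [wsum_rep, hws, wsum_map_flip hfl, hl0, ← hk i, zsmul_eq_mul, Nat.cast_natAbs, abs_of_neg (not_le.1 h0)]
        push_cast; ring

/-- **Theorem C.** The space of orientation-preserving real-analytic actions of `ℤᵈ` on the
closed interval `[0,1]` is path-connected. -/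
theorem pathConnected_space_of_analytic_Zd_actions (d : ℕ) (ρ₀ ρ₁ : AnAction d) :
    ∃ γ : ℝ → AnAction d, γ 0 = ρ₀ ∧ γ 1 = ρ₁ ∧ AnPathContinuous γ := by
  exact final_of_contr ρ₀ ρ₁ (contr_all ρ₀) (contr_all ρ₁)
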